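/- arXiv:math/9711203 — 2 statements merged into one kernel-verified Lean document; each statement's English description precedes it below -/
import Mathlib

section
/- Let F be a non-abelian free group. Then the automorphism group Aut(F) is complete: it has trivial center and every automorphism of Aut(F) is inner. -/
namespace FreeProdInt

open HNNExtension

/-- The free product of `G` with an infinite cyclic group generated by `t`. -/
abbrev H (G : Type*) [Group G] := HNNExtension G ⊥ ⊥ (MulEquiv.refl _)

variable {G : Type*} [Group G]

/-- The element of `H G` spelled by a head and a list of syllables. -/
def ev (g : G) (L : List (ℤˣ × G)) : H G :=
  of g * (L.map fun x => t ^ (x.1 : ℤ) * of x.2).prod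

/-- No cancellation occurs in the list of syllables. -/
def Red (L : List (ℤˣ × G)) : Prop := L.IsChain fun a b => a.2 = 1 → a.1 = b.1

lemma ev_nil (g : G) : ev g [] = of g := by simp [ev]

lemma ev_cons (g h : G) (u : ℤˣ) (L : List (ℤˣ × G)) :
    ev g ((u, h) :: L) = of g * t ^ (u : ℤ) * ev h L := by simp [ev, mul_assoc]

lemma of_mul_ev (g h : G) (L : List (ℤˣ × G)) : of g * ev h L = ev (g * h) L := by
  simp [ev, mul_assoc]

lemma ev_concat_mul_ev (g c h : G) (u : ℤˣ) (M L : List (ℤˣ × G)) :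
    ev g (M ++ [(u, c)]) * ev h L = ev g (M ++ [(u, c * h)] ++ L) := by
  simp [ev, mul_assoc]

lemma map_fst_eq {g g' : G} {L L' : List (ℤˣ × G)} (hL : Red L) (hL' : Red L')
    (h : ev g L = ev g' L') : L.map Prod.fst = L'.map Prod.fst ∧ g = g' := by
  have key := ReducedWord.map_fst_eq_and_of_prod_eq (MulEquiv.refl (⊥ : Subgroup G))
    (w₁ := ⟨g, L, by simpa [Red, toSubgroup] using hL⟩)
    (w₂ := ⟨g', L', by simpa [Red, toSubgroup] using hL'⟩) h
  refine ⟨key.1, ?_⟩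
  cases L with
  | nil =>
    have : L' = [] := by simpa using key.1.symm
    subst this
    simpa [ev_nil] using of_injective _ (by simpa [ev_nil] using h)
  | cons a L =>
    have := key.2 a.1 (by simp)
    simpa [toSubgroup, inv_mul_eq_one] using this

lemma exists_ev (h : H G) : ∃ g L, Red L ∧ ev g L = h := by
  obtain ⟨d⟩ := NormalWord.TransversalPair.nonempty G ⊥ ⊥
  let w := NormalWord.equiv (MulEquiv.refl (⊥ : Subgroup G)) d h
  refine ⟨w.head, w.toList, by simpa [Red, toSubgroup] using w.chain, ?_⟩
  exact (NormalWord.equiv (MulEquiv.refl (⊥ : Subgroup G)) d).symm_apply_apply h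

/-- The endomorphism fixing `G` and sending `t` to `x`. -/
def fixLift (x : H G) : H G →* H G :=
  HNNExtension.lift of x (by rintro ⟨a, ha⟩; obtain rfl := Subgroup.mem_bot.1 ha; simp)

@[simp] lemma fixLift_of (x : H G) (g : G) : fixLift x (of g) = of g := by simp [fixLift]

@[simp] lemma fixLift_t (x : H G) : fixLift x t = x := by simp [fixLift]

/-- The involution fixing `G` and sending `t` to `w * t⁻¹ * w`. -/
def tau (w : G) : H G →* H G := fixLift (of w * t⁻¹ * of w)

/-- The endomorphism fixing `G` and sending `t` to `w * t * w`. -/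
def dil (w : G) : H G →* H G := fixLift (of w * t * of w)

lemma dil_eq (w : G) (h : H G) : dil w h = tau w⁻¹ (tau 1 h) := by
  have : dil w = (tau w⁻¹).comp (tau 1) := by
    apply HNNExtension.hom_ext
    · ext g; simp [dil, tau]
    · simp [dil, tau, mul_assoc]
  rw [this]; rfl

/-- The head of the image of a word under `dil w`. -/
def dilHead (w : G) : List (ℤˣ × G) → G
  | [] => 1
  | (u, _) :: _ => w ^ (u : ℤ)

/-- The tail of the image of a word under `dil w`. -/
def dilTail (w : G) : List (ℤˣ × G) → List (ℤˣ × G)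
  | [] => []
  | (u, g) :: L => (u, w ^ (u : ℤ) * g * dilHead w L) :: dilTail w L

lemma dil_ev (w g : G) (L : List (ℤˣ × G)) :
    dil w (ev g L) = ev (g * dilHead w L) (dilTail w L) := by
  induction L generalizing g with
  | nil => simp [ev_nil, dil, dilHead, dilTail]
  | cons a L ih =>
    obtain ⟨u, c⟩ := a
    simp only [dilHead, dilTail, ev_cons, map_mul, ih, map_zpow]
    rw [mul_assoc (w ^ (u : ℤ)), ← of_mul_ev (w ^ (u : ℤ))]
    rcases Int.units_eq_one_or u with rfl | rfl <;> simp [dil, mul_assoc]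

lemma red_dilTail (w : G) {L : List (ℤˣ × G)} (hL : Red L) : Red (dilTail w L) := by
  unfold Red at *
  induction L with
  | nil => simp [dilTail]
  | cons a L ih =>
    obtain ⟨u, c⟩ := a
    cases L with
    | nil => simp [dilTail]
    | cons b L =>
      obtain ⟨v, d⟩ := b
      have ih := ih hL.tail
      simp only [dilTail, List.isChain_cons_cons] at ih ⊢
      refine ⟨fun h => ?_, ih⟩
      by_contra huv
      have h1 : c = 1 → u = v := (List.isChain_cons_cons.1 hL).1
      have : (v : ℤ) = -(u : ℤ) := by
        rcases Int.units_eq_one_or u with rfl | rfl <;>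
          rcases Int.units_eq_one_or v with rfl | rfl <;>
            first | exact absurd rfl huv | simp
      simp only [dilHead, this, zpow_neg] at h
      exact huv (h1 (by simpa using h))

lemma tau_one_ev (g : G) (L : List (ℤˣ × G)) :
    tau 1 (ev g L) = ev g (L.map fun x => (-x.1, x.2)) := by
  induction L generalizing g with
  | nil => simp [ev_nil, tau]
  | cons a L ih =>
    obtain ⟨u, c⟩ := a
    simp only [ev_cons, map_mul, ih, map_zpow, List.map_cons]
    rcases Int.units_eq_one_or u with rfl | rfl <;> simp [tau]

lemma red_neg {L : List (ℤˣ × G)} (hL : Red L) : Red (L.map fun x => (-x.1, x.2)) := by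
  unfold Red at *
  rw [List.isChain_map]
  exact hL.imp fun a b h h' => by rw [h h']

lemma red_concat_congr {M : List (ℤˣ × G)} {u : ℤˣ} {c : G} (c' : G)
    (h : Red (M ++ [(u, c)])) : Red (M ++ [(u, c')]) := by
  unfold Red at *
  rw [List.isChain_append] at *
  refine ⟨h.1, by simp, ?_⟩
  simpa using h.2.2

lemma fixed_of_tau_one {h : H G} (hh : tau 1 h = h) : ∃ g, h = of g := by
  obtain ⟨g, L, hL, rfl⟩ := exists_ev h
  rw [tau_one_ev] at hh
  have := (map_fst_eq (red_neg hL) hL hh).1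
  cases L with
  | nil => exact ⟨g, ev_nil g⟩
  | cons a L =>
    simp only [List.map_cons, List.cons.injEq] at this
    rcases Int.units_eq_one_or a.1 with h | h <;> simp [h] at this

end FreeProdInt

namespace FreeProdInt

open HNNExtension

variable {G : Type*} [Group G]

lemma ev_mul_of (g c h : G) (u : ℤˣ) (M : List (ℤˣ × G)) :
    ev g (M ++ [(u, c)]) * of h = ev g (M ++ [(u, c * h)]) := by
  simp [ev, mul_assoc]

/-- The syllables of a word after the substitution `t ↦ ev 1 (M ++ [(1, 1)])`, where
`N ++ [(-1, 1)]` spells the inverse. -/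
def subst (M N : List (ℤˣ × G)) (x : ℤˣ × G) : List (ℤˣ × G) :=
  if x.1 = 1 then M ++ [(1, x.2)] else N ++ [(-1, x.2)]

omit [Group G] in
lemma subst_ne_nil (M N : List (ℤˣ × G)) (x : ℤˣ × G) : subst M N x ≠ [] := by
  unfold subst; split_ifs <;> simp

lemma red_flatMap_subst {M N : List (ℤˣ × G)} (hM : Red (M ++ [(1, 1)])) (hN : Red (N ++ [(-1, 1)]))
    (hM1 : ∀ x ∈ (M ++ [(1, (1 : G))]).head?, x.1 = 1)
    (hN1 : ∀ x ∈ (N ++ [(-1, (1 : G))]).head?, x.1 = -1) {L : List (ℤˣ × G)} (hL : Red L) :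
    Red (L.flatMap (subst M N)) := by
  have head : ∀ a, ∀ x ∈ (subst M N a).head?, x.1 = a.1 := by
    intro a x hx
    unfold subst at hx
    rcases Int.units_eq_one_or a.1 with h | h
    · rw [if_pos h] at hx
      cases M with
      | nil => obtain rfl : (1, a.2) = x := by simpa using hx
               exact h.symm
      | cons b M => rw [h]; exact hM1 x (by simpa using hx)
    · rw [if_neg (by rw [h]; decide)] at hx
      cases N with
      | nil => obtain rfl : (-1, a.2) = x := by simpa using hx
               exact h.symm
      | cons b N => rw [h]; exact hN1 x (by simpa using hx)
  have last : ∀ a, ∀ x ∈ (subst M N a).getLast?, x = a := by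
    intro a x hx
    unfold subst at hx
    rcases Int.units_eq_one_or a.1 with h | h
    · rw [if_pos h] at hx
      simp only [List.getLast?_append, List.getLast?_singleton, Option.some_or,
        Option.mem_def, Option.some.injEq] at hx
      rw [← hx, ← h]
    · rw [if_neg (by rw [h]; decide)] at hx
      simp only [List.getLast?_append, List.getLast?_singleton, Option.some_or,
        Option.mem_def, Option.some.injEq] at hx
      rw [← hx, ← h]
  unfold Red at *
  rw [List.flatMap_def, List.isChain_flatten (by simp [subst_ne_nil])]
  refine ⟨?_, ?_⟩
  · intro l hl
    obtain ⟨a, -, rfl⟩ := List.mem_map.1 hl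
    unfold subst
    split_ifs
    · exact red_concat_congr _ hM
    · exact red_concat_congr _ hN
  · rw [List.isChain_map]
    refine hL.imp fun a b hab x hx y hy hx1 => ?_
    rw [last a x hx] at hx1 ⊢
    rw [head b y hy]
    exact hab hx1

lemma map_ev {y : H G →* H G} {M N : List (ℤˣ × G)} (hy : ∀ g, y (of g) = of g)
    (ht : y t = ev 1 (M ++ [(1, 1)])) (hN : (y t)⁻¹ = ev 1 (N ++ [(-1, 1)])) (g : G)
    (L : List (ℤˣ × G)) : y (ev g L) = ev g (L.flatMap (subst M N)) := by
  induction L generalizing g with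
  | nil => simp [ev_nil, hy]
  | cons a L ih =>
    obtain ⟨u, c⟩ := a
    rw [ev_cons, map_mul, map_mul, hy, ih, map_zpow, List.flatMap_cons]
    rcases Int.units_eq_one_or u with rfl | rfl
    · simp only [subst, if_true, Units.val_one, zpow_one]
      have := ev_concat_mul_ev 1 1 c 1 M (L.flatMap (subst M N))
      rw [one_mul] at this
      rw [mul_assoc, ht, this, of_mul_ev, mul_one]
    · simp only [subst, if_neg (show ¬(-1 : ℤˣ) = 1 by decide), Units.val_neg, Units.val_one,
        zpow_neg, zpow_one]
      have := ev_concat_mul_ev 1 1 c (-1) N (L.flatMap (subst M N))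
      rw [one_mul] at this
      rw [mul_assoc, hN, this, of_mul_ev, mul_one]

lemma eq_t_of_surjective {y : H G →* H G} (hs : Function.Surjective y) (hy : ∀ g, y (of g) = of g)
    {M : List (ℤˣ × G)} (hM : Red (M ++ [(1, 1)]))
    (hM1 : ∀ x ∈ (M ++ [(1, (1 : G))]).head?, x.1 = 1)
    (ht : y t = ev 1 (M ++ [(1, 1)])) (hinv : tau 1 (y t) = (y t)⁻¹) : y t = t := by
  set N : List (ℤˣ × G) := M.map fun x => (-x.1, x.2) with hNdef
  have hN' : (M ++ [(1, (1 : G))]).map (fun x : ℤˣ × G => (-x.1, x.2)) = N ++ [(-1, 1)] := by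
    simp [N]
  have hN : (y t)⁻¹ = ev 1 (N ++ [(-1, 1)]) := by
    rw [← hinv, ht, tau_one_ev, hN']
  have hNr : Red (N ++ [(-1, 1)]) := hN' ▸ red_neg hM
  have hN1 : ∀ x ∈ (N ++ [(-1, (1 : G))]).head?, x.1 = -1 := by
    rw [← hN']
    intro x hx
    cases M with
    | nil => obtain rfl : (-1, 1) = x := by simpa using hx
             rfl
    | cons b M =>
      obtain rfl : (-b.1, b.2) = x := by simpa using hx
      simp [hM1 b (by simp)]
  obtain ⟨h, hh⟩ := hs t
  obtain ⟨g, L, hL, rfl⟩ := exists_ev h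
  rw [map_ev hy ht hN] at hh
  have h1 : (t : H G) = ev 1 [(1, 1)] := by simp [ev]
  rw [h1] at hh
  have := (map_fst_eq (red_flatMap_subst hM hNr hM1 hN1 hL) (by simp [Red]) hh).1
  have hlen := congrArg List.length this
  have hM0 : M = [] := by
    cases L with
    | nil => simp at hlen
    | cons a L =>
      have hML : N.length = M.length := by simp [N]
      simp only [List.flatMap_cons, List.length_map, List.length_append, List.length_singleton]
        at hlen
      have : (subst M N a).length = M.length + 1 := by
        unfold subst; split_ifs <;> simp [hML]
      exact List.length_eq_zero_iff.1 (by omega)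
  rw [ht, hM0, h1]; rfl

/-- An automorphism commuting with all `tau w` is inner unless it induces a twisted inversion
on `G`. -/
theorem exists_eq_conj (y : H G ≃* H G) (hy : ∀ w h, y (tau w h) = tau w (y h))
    (hinv : ¬ ∃ b : G, ∀ w : G, y (of w) = of (b * w⁻¹ * b⁻¹)) : ∃ b, ∀ h, y h = b * h * b⁻¹ := by
  have hfix : ∀ w : G, ∃ w', y (of w) = of w' := fun w =>
    fixed_of_tau_one (by rw [← hy]; simp [tau])
  choose β hβ using hfix
  have hdil : ∀ w h, y (dil w h) = dil w (y h) := by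
    intro w h; rw [dil_eq, dil_eq, hy, hy]
  obtain ⟨b, L, hL, hb⟩ := exists_ev (y t)
  obtain ⟨M, u, c, rfl⟩ : ∃ M u c, L = M ++ [(u, c)] := by
    rcases List.eq_nil_or_concat L with rfl | ⟨M, a, rfl⟩
    · exfalso
      rw [ev_nil] at hb
      obtain ⟨g, hg⟩ : ∃ g, y.symm (of b) = of g :=
        fixed_of_tau_one (y.injective (by rw [hy]; simp [tau]))
      have : ev 1 [(1, 1)] = ev g [] := by
        rw [ev_nil, ← hg, hb]; simp [ev]
      simpa using (map_fst_eq (by simp [Red]) (by simp [Red]) this).1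
    · exact ⟨M, a.1, a.2, by simp⟩
  have hconj : ∀ w, b * dilHead w (M ++ [(u, c)]) = β w * b := by
    intro w
    have h := hdil w t
    have h2 : dil w t = of w * t * of w := by simp [dil]
    rw [h2, map_mul, map_mul, hβ, ← hb, dil_ev, of_mul_ev, ev_mul_of] at h
    exact (map_fst_eq (red_concat_congr _ hL) (red_dilTail _ hL) h).2.symm
  obtain ⟨u1, c1, L1, hL1⟩ : ∃ u1 c1 L1, M ++ [(u, c)] = (u1, c1) :: L1 := by
    cases h : M ++ [(u, c)] with
    | nil => simp at h
    | cons a L1 => exact ⟨a.1, a.2, L1, rfl⟩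
  simp only [hL1, dilHead] at hconj
  have hu1 : u1 = 1 := by
    rcases Int.units_eq_one_or u1 with h | h
    · exact h
    · refine (hinv ⟨b, fun w => ?_⟩).elim
      rw [hβ, eq_mul_inv_of_mul_eq (hconj w).symm, h]
      simp
  have hcu : c * b = 1 ∧ u = 1 := by
    have h1 : tau 1 (y t) * y t = 1 := by
      rw [← hy, ← map_mul]; simp [tau]
    rw [← hb, tau_one_ev, List.map_append, List.map_singleton, ev_concat_mul_ev] at h1
    by_contra hcon
    have hred : Red ((M.map fun x => (-x.1, x.2)) ++ [(-u, c * b)] ++ (M ++ [(u, c)])) := by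
      have h2 : Red ((M.map fun x => (-x.1, x.2)) ++ [(-u, c * b)]) := by
        refine red_concat_congr (c := c) _ ?_
        have := red_neg hL
        rwa [List.map_append, List.map_singleton] at this
      unfold Red at *
      rw [List.isChain_append]
      refine ⟨h2, hL, ?_⟩
      intro x hx z hz hx1
      obtain rfl : (-u, c * b) = x := by simpa using hx
      rw [hL1] at hz
      obtain rfl : (u1, c1) = z := by simpa using hz
      rcases Int.units_eq_one_or u with h | h
      · exact (hcon ⟨hx1, h⟩).elim
      · simp [h, hu1]
    have := (map_fst_eq hred (by simp [Red]) (h1.trans (by simp [ev_nil] : (1 : H G) = ev 1 []))).1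
    simp at this
  obtain ⟨hcb, rfl⟩ := hcu
  have hc : c = b⁻¹ := eq_inv_of_mul_eq_one_left hcb
  subst hc
  let y1 : H G →* H G := ((MulAut.conj (of b))⁻¹ * y : MulAut (H G)).toMonoidHom
  have hy1 : ∀ h, y1 h = of b⁻¹ * y h * of b := by
    intro h; simp [y1]
  have hs : Function.Surjective y1 := MulEquiv.surjective _
  have hy1of : ∀ g, y1 (of g) = of g := by
    intro g
    rw [hy1, hβ, eq_mul_inv_of_mul_eq (hconj g).symm, hu1, ← map_mul, ← map_mul]
    simp [mul_assoc]
  have hy1t : y1 t = ev 1 (M ++ [(1, 1)]) := by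
    rw [hy1, ← hb, of_mul_ev, ev_mul_of]; simp
  have hend := eq_t_of_surjective hs hy1of (red_concat_congr _ hL)
    (by
      intro x hx
      cases M with
      | nil => obtain rfl : (1, 1) = x := by simpa using hx
               rfl
      | cons a M =>
        have : a = (u1, c1) := by simpa using congrArg List.head? hL1
        obtain rfl : a = x := by simpa using hx
        rw [this, hu1]) hy1t
    (by
      rw [hy1, map_mul, map_mul, ← hy]
      simp [tau, mul_assoc])
  refine ⟨of b, fun h => ?_⟩
  have : y1 = MonoidHom.id _ := by
    apply HNNExtension.hom_ext
    · ext g; simp [hy1of]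
    · simpa using hend
  have h2 := hy1 h
  rw [this] at h2
  simp only [MonoidHom.id_apply] at h2
  have h3 : y h = of b * (of b⁻¹ * y h * of b) * (of b)⁻¹ := by rw [map_inv]; group
  rwa [← h2] at h3

end FreeProdInt

namespace FreeAut

open FreeGroup (of of_ne_one)

lemma of_mul_of_ne {α : Type*} {a b : α} (h : a ≠ b) : of a * of b ≠ of b * of a := by
  classical
  intro H
  have := congrArg FreeGroup.toWord H
  simp [FreeGroup.toWord_mul, FreeGroup.reduce.cons, h] at this

lemma exists_zpow_eq_zpow {X : Type*} {z b : FreeGroup X} (h : z * b = b * z) (hz : z ≠ 1)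
    (hb : b ≠ 1) : ∃ p q : ℤ, p ≠ 0 ∧ q ≠ 0 ∧ z ^ p = b ^ q := by
  let S := Subgroup.closure {z, b}
  have hcomm : ∀ x y : S, x * y = y * x := by
    intro x y
    have := Subgroup.isMulCommutative_closure (k := {z, b}) (by
      rintro x (rfl | rfl) y (rfl | rfl) <;> first | rfl | exact h | exact h.symm)
    exact this.is_comm.comm x y
  let e := IsFreeGroup.toFreeGroup S
  have hsub : Subsingleton (IsFreeGroup.Generators S) := by
    refine ⟨fun a b => ?_⟩
    by_contra hne
    apply of_mul_of_ne hne
    apply e.symm.injective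
    rw [map_mul, map_mul, hcomm]
  have hmem : ∀ x ∈ ({z, b} : Set _), x ∈ S := fun x hx => Subgroup.subset_closure hx
  let z' : S := ⟨z, hmem z (by simp)⟩
  let b' : S := ⟨b, hmem b (by simp)⟩
  rcases isEmpty_or_nonempty (IsFreeGroup.Generators S) with hE | ⟨⟨g⟩⟩
  · exfalso
    apply hz
    have : z' = 1 := e.injective (Subsingleton.elim _ _)
    exact congrArg Subtype.val this
  · have hp : ∀ x : S, ∃ n : ℤ, e x = of g ^ n := by
      intro x
      induction e x using FreeGroup.induction_on with
      | C1 => exact ⟨0, by simp⟩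
      | of y => exact ⟨1, by rw [Subsingleton.elim y g, zpow_one]⟩
      | inv_of y _ => exact ⟨-1, by rw [Subsingleton.elim y g, zpow_neg, zpow_one]⟩
      | mul x y hx hy =>
        obtain ⟨n, rfl⟩ := hx
        obtain ⟨m, rfl⟩ := hy
        exact ⟨n + m, (zpow_add _ _ _).symm⟩
    obtain ⟨n, hn⟩ := hp z'
    obtain ⟨m, hm⟩ := hp b'
    refine ⟨m, n, ?_, ?_, ?_⟩
    · rintro rfl
      apply hb
      have : b' = 1 := e.injective (by simpa using hm)
      exact congrArg Subtype.val this
    · rintro rfl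
      apply hz
      have : z' = 1 := e.injective (by simpa using hn)
      exact congrArg Subtype.val this
    · have : z' ^ m = b' ^ n := e.injective (by
        rw [map_zpow, map_zpow, hn, hm, ← zpow_mul, ← zpow_mul, mul_comm])
      exact congrArg Subtype.val this

lemma eq_one_of_zpow_eq_one {X : Type*} {z : FreeGroup X} {n : ℤ} (hn : n ≠ 0) (h : z ^ n = 1) :
    z = 1 := by
  by_contra hz
  exact not_isOfFinOrder_of_isMulTorsionFree hz (isOfFinOrder_iff_zpow_eq_one.2 ⟨n, hn, h⟩)

/-- An element commuting with two distinct generators is trivial. -/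
lemma eq_one_of_commute_of {X : Type*} {a b : X} (hab : a ≠ b) {z : FreeGroup X}
    (ha : z * of a = of a * z) (hb : z * of b = of b * z) : z = 1 := by
  by_contra hz
  obtain ⟨p, q, hp, hq, h⟩ := exists_zpow_eq_zpow ha hz (of_ne_one a)
  obtain ⟨p', q', hp', hq', h'⟩ := exists_zpow_eq_zpow hb hz (of_ne_one b)
  classical
  have h1 : (of a ^ (q * p') : FreeGroup X) = of b ^ (q' * p) := by
    rw [zpow_mul, zpow_mul, ← h, ← h', ← zpow_mul, ← zpow_mul, mul_comm]
  have h2 := congrArg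
    (FreeGroup.lift fun k : X => Multiplicative.ofAdd (if k = a then (1 : ℤ) else 0)) h1
  rw [map_zpow, map_zpow, FreeGroup.lift_apply_of, FreeGroup.lift_apply_of, if_pos rfl,
    if_neg hab.symm] at h2
  have h3 : (q * p') * 1 = (q' * p) * (0 : ℤ) := congrArg Multiplicative.toAdd h2
  simp_all

open MulAut

variable {X : Type*}

lemma conj_apply_aut (a : MulAut (FreeGroup X)) (x : FreeGroup X) :
    a * conj x * a⁻¹ = conj (a x) := by
  ext1 u; simp

lemma conj_injective_aut {a b : X} (hab : a ≠ b) :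
    Function.Injective (conj : FreeGroup X →* MulAut (FreeGroup X)) := by
  rw [injective_iff_map_eq_one]
  intro z hz
  have : ∀ u, z * u = u * z := fun u => by
    have := DFunLike.congr_fun hz u
    rwa [conj_apply, MulAut.one_apply, mul_inv_eq_iff_eq_mul] at this
  exact eq_one_of_commute_of hab (this _) (this _)

lemma center_aut {a b : X} (hab : a ≠ b) : Subgroup.center (MulAut (FreeGroup X)) = ⊥ := by
  rw [eq_bot_iff]
  intro g hg
  rw [Subgroup.mem_center_iff] at hg
  rw [Subgroup.mem_bot]
  ext x
  apply conj_injective_aut hab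
  rw [← conj_apply_aut, ← hg, mul_inv_cancel_right]; rfl

/-- Burnside's criterion: if automorphisms of `Aut F` preserve inner automorphisms then they are
inner. -/
lemma exists_eq_conj_aut {a b : X} (hab : a ≠ b)
    (H : ∀ (f : MulAut (MulAut (FreeGroup X))) (u : FreeGroup X), ∃ v, f (conj u) = conj v)
    (f : MulAut (MulAut (FreeGroup X))) : ∃ g : MulAut (FreeGroup X), f = conj g := by
  choose φ hφ using H f
  choose ψ hψ using H f⁻¹
  have inj := conj_injective_aut hab
  let g : MulAut (FreeGroup X) :=
    { toFun := φ
      invFun := ψ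
      left_inv := fun u => inj (by rw [← hψ, ← hφ]; simp)
      right_inv := fun u => inj (by rw [← hφ, ← hψ]; simp)
      map_mul' := fun u v => inj (by rw [← hφ, map_mul, map_mul, hφ, hφ, map_mul]) }
  have hg : ∀ u, f (conj u) = conj (g u) := hφ
  refine ⟨g, ?_⟩
  ext1 α
  rw [MulAut.conj_apply]
  have key : ∀ x, f α (g x) = g (α x) := by
    intro x
    apply inj
    rw [← conj_apply_aut, ← hg, ← hg, ← conj_apply_aut, map_mul, map_mul, map_inv]
  ext x
  have := key (g⁻¹ x)
  simpa using this

end FreeAut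

namespace FreeAut

open FreeGroup (of of_ne_one)
open MulAut (conj)

variable {X : Type*}

/-- The inclusion of the free group on the letters other than `i`. -/
def incl (i : X) : FreeGroup {k // k ≠ i} →* FreeGroup X := FreeGroup.map Subtype.val

@[simp] lemma incl_of (i : X) (k : {k // k ≠ i}) : incl i (of k) = of k.1 := by simp [incl]

lemma exists_finset_mem_range_incl (u : FreeGroup X) :
    ∃ s : Finset X, ∀ i ∉ s, u ∈ (incl i).range := by
  classical
  induction u using FreeGroup.induction_on with
  | C1 => exact ⟨∅, fun i _ => one_mem _⟩
  | of k => exact ⟨{k}, fun i hi => ⟨of ⟨k, by simpa [eq_comm] using hi⟩, by simp⟩⟩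
  | inv_of k h =>
    obtain ⟨s, hs⟩ := h
    exact ⟨s, fun i hi => inv_mem (hs i hi)⟩
  | mul x y hx hy =>
    obtain ⟨s, hs⟩ := hx
    obtain ⟨t, ht⟩ := hy
    refine ⟨s ∪ t, fun i hi => mul_mem (hs i ?_) (ht i ?_)⟩ <;> simp_all

variable [DecidableEq X]

/-- The endomorphism sending the letter `i` to `x` and fixing the others. -/
def substHom (i : X) (x : FreeGroup X) : FreeGroup X →* FreeGroup X :=
  FreeGroup.lift fun k => if k = i then x else of k

@[simp] lemma substHom_self (i : X) (x : FreeGroup X) : substHom i x (of i) = x := by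
  simp [substHom]

lemma substHom_of_ne {i k : X} (x : FreeGroup X) (h : k ≠ i) : substHom i x (of k) = of k := by
  simp [substHom, h]

@[simp] lemma substHom_incl (i : X) (x : FreeGroup X) (w : FreeGroup {k // k ≠ i}) :
    substHom i x (incl i w) = incl i w := by
  have : (substHom i x).comp (incl i) = incl i := by
    ext k
    simp [substHom_of_ne x k.2]
  exact DFunLike.congr_fun this w

lemma hom_ext_incl {M : Type*} [Monoid M] (i : X) {f g : FreeGroup X →* M}
    (h : ∀ w, f (incl i w) = g (incl i w)) (hi : f (of i) = g (of i)) : f = g := by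
  ext k
  by_cases hk : k = i
  · subst hk; exact hi
  · simpa using h (of ⟨k, hk⟩)

/-- The involution `i ↦ w * i⁻¹ * w` fixing all other letters. -/
def tau (i : X) (w : FreeGroup {k // k ≠ i}) : MulAut (FreeGroup X) :=
  MonoidHom.toMulEquiv (substHom i (incl i w * (of i)⁻¹ * incl i w))
    (substHom i (incl i w * (of i)⁻¹ * incl i w))
    (hom_ext_incl i (by simp) (by simp [mul_assoc]))
    (hom_ext_incl i (by simp) (by simp [mul_assoc]))

@[simp] lemma tau_self (i : X) (w : FreeGroup {k // k ≠ i}) :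
    tau i w (of i) = incl i w * (of i)⁻¹ * incl i w := substHom_self _ _

lemma tau_of_ne {i k : X} (w : FreeGroup {k // k ≠ i}) (h : k ≠ i) : tau i w (of k) = of k :=
  substHom_of_ne _ h

@[simp] lemma tau_incl (i : X) (w v : FreeGroup {k // k ≠ i}) : tau i w (incl i v) = incl i v :=
  substHom_incl _ _ _

lemma tau_mul_self (i : X) (w : FreeGroup {k // k ≠ i}) : tau i w * tau i w = 1 :=
  MulEquiv.ext fun x => (tau i w).symm_apply_apply x

/-- The decomposition of the free group as a free product splitting off the letter `i`. -/
noncomputable def splitEquiv (i : X) : FreeGroup X ≃* FreeProdInt.H (FreeGroup {k // k ≠ i}) :=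
  MonoidHom.toMulEquiv
    (FreeGroup.lift fun k => if h : k = i then HNNExtension.t else HNNExtension.of (of ⟨k, h⟩))
    (HNNExtension.lift (incl i) (of i)
      (by rintro ⟨a, ha⟩; obtain rfl := Subgroup.mem_bot.1 ha; simp))
    (by
      ext k
      by_cases h : k = i
      · subst h; simp
      · simp [h])
    (by
      apply HNNExtension.hom_ext
      · ext k; simp [k.2]
      · simp)

lemma splitEquiv_self (i : X) : splitEquiv i (of i) = HNNExtension.t := by
  simp [splitEquiv]

lemma splitEquiv_incl (i : X) (w : FreeGroup {k // k ≠ i}) :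
    splitEquiv i (incl i w) = HNNExtension.of w := by
  have : (splitEquiv i).toMonoidHom.comp (incl i) = HNNExtension.of := by
    ext k
    simp [splitEquiv, k.2]
  exact DFunLike.congr_fun this w

lemma splitEquiv_tau (i : X) (w : FreeGroup {k // k ≠ i}) (u : FreeGroup X) :
    splitEquiv i (tau i w u) = FreeProdInt.tau w (splitEquiv i u) := by
  have : (splitEquiv i).toMonoidHom.comp (tau i w).toMonoidHom =
      (FreeProdInt.tau w).comp (splitEquiv i).toMonoidHom := by
    apply hom_ext_incl i
    · intro v
      simp [splitEquiv_incl, FreeProdInt.tau]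
    · simp [splitEquiv_incl, splitEquiv_self, FreeProdInt.tau]
  exact DFunLike.congr_fun this u

lemma eq_conj_of_commute_tau (i : X) (y : MulAut (FreeGroup X))
    (hy : ∀ w u, y (tau i w u) = tau i w (y u))
    (hinv : ¬ ∃ b, ∀ w, y (incl i w) = b * (incl i w)⁻¹ * b⁻¹) : ∃ g, y = conj g := by
  let e := splitEquiv i
  have hsymm : ∀ w h, e.symm (FreeProdInt.tau w h) = tau i w (e.symm h) := by
    intro w h
    rw [MulEquiv.symm_apply_eq, splitEquiv_tau, e.apply_symm_apply]
  obtain ⟨b, hb⟩ := FreeProdInt.exists_eq_conj ((e.symm.trans y).trans e)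
    (by
      intro w h
      simp only [MulEquiv.trans_apply, hsymm, hy]
      exact splitEquiv_tau _ _ _)
    (by
      rintro ⟨b, hb⟩
      refine hinv ⟨incl i b, fun w => e.injective ?_⟩
      have := hb w
      rw [MulEquiv.trans_apply, MulEquiv.trans_apply, ← splitEquiv_incl, e.symm_apply_apply] at this
      rw [this, ← splitEquiv_incl, ← map_inv, ← map_inv, ← map_mul, ← map_mul])
  refine ⟨e.symm b, ?_⟩
  ext1 u
  apply e.injective
  have := hb (e u)
  simp only [MulEquiv.trans_apply, e.symm_apply_apply] at this
  simp [this]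

/-- A fixed element of an involution centralizes the displacement of any element whose
conjugate of it is fixed. -/
lemma fixed_of_fixed_conj {α : MulAut (FreeGroup X)} (hα : ∀ u, α (α u) = u) {b v : FreeGroup X}
    (hb1 : b ≠ 1) (hb : α b = b) (hbv : α (v⁻¹ * b * v) = v⁻¹ * b * v) : α v = v := by
  set z := α v * v⁻¹ with hz
  have hzb : z * b = b * z := by
    rw [map_mul, map_mul, map_inv, hb] at hbv
    rw [hz]
    calc α v * v⁻¹ * b = α v * (v⁻¹ * b * v) * v⁻¹ := by group
      _ = _ := by rw [← hbv]; group
  have hαz : α z = z⁻¹ := by rw [hz, map_mul, map_inv, hα]; group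
  by_contra hne
  have hz1 : z ≠ 1 := fun h => hne (by rwa [hz, mul_inv_eq_one] at h)
  obtain ⟨p, q, hp, hq, h⟩ := exists_zpow_eq_zpow hzb hz1 hb1
  have h2 := congrArg α h
  rw [map_zpow, map_zpow, hαz, hb, ← h, inv_zpow, inv_eq_iff_mul_eq_one, ← zpow_add] at h2
  exact hz1 (eq_one_of_zpow_eq_one (by omega) h2)

lemma map_conj_eq_conj_of_infinite [Infinite X] (f : MulAut (MulAut (FreeGroup X)))
    (v : FreeGroup X) : ∃ g, f (conj v) = conj g := by
  obtain ⟨a, a', haa⟩ := exists_pair_ne X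
  have inj := conj_injective_aut haa
  have star : ∀ (α : MulAut (FreeGroup X)) (u : FreeGroup X),
      α * f (conj u) * α⁻¹ = f (conj (f⁻¹ α u)) := by
    intro α u
    rw [← conj_apply_aut, map_mul, map_mul, map_inv]
    simp
  obtain ⟨k, b, hk, hkb⟩ : ∃ k b, k ≠ 1 ∧ conj k = f (conj b) := by
    have h0 : f (conj (of a)) ≠ 1 := by
      rw [Ne, map_eq_one_iff f f.injective, map_eq_one_iff _ inj]
      exact of_ne_one a
    obtain ⟨u, hu⟩ : ∃ u, f (conj (of a)) u ≠ u := by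
      by_contra hcon
      push Not at hcon
      exact h0 (MulEquiv.ext hcon)
    refine ⟨f (conj (of a)) u * u⁻¹, of a * (f⁻¹ (conj u) (of a))⁻¹,
      fun h => hu (by rwa [mul_inv_eq_one] at h), ?_⟩
    rw [map_mul, map_mul, map_mul, map_inv, map_inv, map_inv, ← star, ← conj_apply_aut]
    group
  set y := f (conj v) with hy
  obtain ⟨s, hs⟩ := exists_finset_mem_range_incl k
  obtain ⟨t, ht⟩ := exists_finset_mem_range_incl (y⁻¹ k)
  obtain ⟨i, hi⟩ := Infinite.exists_notMem_finset (s ∪ t)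
  simp only [Finset.mem_union, not_or] at hi
  obtain ⟨k1, hk1⟩ := hs i hi.1
  obtain ⟨k2, hk2⟩ := ht i hi.2
  have hb1 : b ≠ 1 := by
    rintro rfl
    rw [map_one, map_one, map_eq_one_iff _ inj] at hkb
    exact hk hkb
  have finj : Function.Injective fun u => f (conj u) := f.injective.comp inj
  have hcomm : ∀ w u, y (tau i w u) = tau i w (y u) := by
    intro w
    have hfix : ∀ u x, tau i w u = u → conj u = f (conj x) → f⁻¹ (tau i w) x = x := by
      intro u x hu hx
      apply finj
      simp only
      rw [← star, ← hx, conj_apply_aut, hu]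
    have h1 : f⁻¹ (tau i w) v = v := by
      refine fixed_of_fixed_conj (fun u => ?_) hb1 (hfix k b (by rw [← hk1, tau_incl]) hkb)
        (hfix (y⁻¹ k) _ (by rw [← hk2, tau_incl]) ?_)
      · rw [← MulAut.mul_apply, ← map_mul, tau_mul_self, map_one, MulAut.one_apply]
      · rw [← conj_apply_aut, hkb, hy, map_mul, map_mul, map_mul, map_mul, map_inv, map_inv,
          inv_inv]
    have h2 := star (tau i w) v
    rw [h1, ← hy, mul_inv_eq_iff_eq_mul] at h2
    intro u
    exact (DFunLike.congr_fun h2 u).symm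
  refine eq_conj_of_commute_tau i y hcomm ?_
  rintro ⟨b, hb⟩
  obtain ⟨j, hj⟩ := Infinite.exists_notMem_finset ({i} : Finset X)
  obtain ⟨l, hl⟩ := Infinite.exists_notMem_finset ({i, j} : Finset X)
  simp only [Finset.mem_singleton, Finset.mem_insert, not_or] at hj hl
  apply of_mul_of_ne hl.2
  have h1 := hb (of ⟨j, hj⟩)
  have h2 := hb (of ⟨l, hl.1⟩)
  have h3 := hb (of ⟨l, hl.1⟩ * of ⟨j, hj⟩)
  rw [map_mul, map_mul, h1, h2] at h3
  simp only [incl_of] at h3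
  have h4 : (of l)⁻¹ * (of j)⁻¹ = (of l * of j : FreeGroup X)⁻¹ := by
    apply mul_left_cancel (a := b)
    apply mul_right_cancel (b := b⁻¹)
    rw [← h3]; group
  rw [← mul_inv_rev, inv_inj] at h4
  exact h4.symm

end FreeAut

namespace FreeAut

open FreeGroup (of of_ne_one)
open MulAut (conj)

variable {X : Type*} [DecidableEq X]

/-- Left multiplication by the variable `i` on noncommutative power series. -/
def varOp (i : X) : Module.End ℤ (List X → ℤ) where
  toFun f
    | [] => 0
    | j :: w => if j = i then f w else 0
  map_add' f g := by
    funext w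
    cases w with
    | nil => rfl
    | cons j w => by_cases h : j = i <;> simp [h]
  map_smul' c f := by
    funext w
    cases w with
    | nil => simp
    | cons j w => by_cases h : j = i <;> simp [h]

/-- The coefficients of the power series `(1 + i)⁻¹ * f`. -/
def invFun (i : X) (f : List X → ℤ) : List X → ℤ
  | [] => f []
  | j :: w => f (j :: w) - if j = i then invFun i f w else 0

/-- Left multiplication by the inverse of `1 + i` on noncommutative power series. -/
def invOp (i : X) : Module.End ℤ (List X → ℤ) where
  toFun := invFun i
  map_add' f g := by
    funext w
    induction w with
    | nil => rfl
    | cons j w ih =>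
      by_cases h : j = i
      · simp only [Pi.add_apply] at ih
        simp only [invFun, h, if_true, ih, Pi.add_apply]; ring
      · simp [invFun, h]
  map_smul' c f := by
    funext w
    induction w with
    | nil => rfl
    | cons j w ih =>
      by_cases h : j = i
      · simp only [Pi.smul_apply] at ih
        simp only [invFun, h, if_true, ih, Pi.smul_apply, smul_sub, RingHom.id_apply]
      · simp [invFun, h]

/-- The unit `1 + i` acting on noncommutative power series. -/
def genUnit (i : X) : (Module.End ℤ (List X → ℤ))ˣ where
  val := 1 + varOp i
  inv := invOp i
  val_inv := by
    ext1 f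
    funext w
    cases w with
    | nil => simp [varOp, invOp, invFun]
    | cons j w => by_cases h : j = i <;> simp [varOp, invOp, invFun, h]
  inv_val := by
    ext1 f
    funext w
    induction w with
    | nil => simp [varOp, invOp, invFun]
    | cons j w ih =>
      by_cases h : j = i
      · simp only [invOp, LinearMap.coe_mk, AddHom.coe_mk, Module.End.mul_apply,
          Module.End.one_apply] at ih ⊢
        rw [invFun, ih]
        simp [varOp, h]
      · simp [varOp, invOp, invFun, h]

/-- The integral group ring of the free group. -/
abbrev ZF (X : Type*) := MonoidAlgebra ℤ (FreeGroup X)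

/-- The inclusion of the free group in its group ring. -/
noncomputable def el : FreeGroup X →* ZF X := MonoidAlgebra.of ℤ _

/-- The Magnus representation, by operators on power series. -/
noncomputable def magnus : ZF X →ₐ[ℤ] Module.End ℤ (List X → ℤ) :=
  MonoidAlgebra.lift ℤ _ _ ((Units.coeHom _).comp (FreeGroup.lift genUnit))

/-- The coefficient of the monomial `w` in the Magnus expansion. -/
noncomputable def coef (w : List X) : ZF X →ₗ[ℤ] ℤ :=
  (LinearMap.proj w).comp ((LinearMap.applyₗ (Pi.single [] 1)).comp magnus.toLinearMap)

lemma coef_apply (w : List X) (z : ZF X) : coef w z = magnus z (Pi.single [] 1) w := rfl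

lemma magnus_el_of_mul (i : X) (z : ZF X) :
    magnus (el (of i) * z) = (1 + varOp i) * magnus z := by
  rw [map_mul]
  congr 1
  rw [magnus, el, MonoidAlgebra.lift_of]
  simp [genUnit]

lemma coef_nil_el_of_mul (i : X) (z : ZF X) : coef [] (el (of i) * z) = coef [] z := by
  rw [coef_apply, magnus_el_of_mul]
  simp [varOp, coef_apply]

lemma coef_cons_el_of_mul (i j : X) (w : List X) (z : ZF X) :
    coef (j :: w) (el (of i) * z) = coef (j :: w) z + if j = i then coef w z else 0 := by
  rw [coef_apply, magnus_el_of_mul]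
  simp [varOp, coef_apply]

lemma coef_one (w : List X) : coef w (1 : ZF X) = if w = [] then 1 else 0 := by
  rw [coef_apply, map_one]
  simp [Pi.single_apply]

@[simp] lemma coef_nil_one : coef ([] : List X) (1 : ZF X) = 1 := by simp [coef_one]

@[simp] lemma coef_cons_one (i : X) (w : List X) : coef (i :: w) (1 : ZF X) = 0 := by
  simp [coef_one]

variable [Fintype X]

omit [DecidableEq X] in
lemma exists_fox (z : ZF X) : ∃ (n : ℤ) (d : X → ZF X), z = n • 1 + ∑ i, (el (of i) - 1) * d i := by
  classical
  induction z using MonoidAlgebra.induction_on with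
  | of u =>
    change ∃ (n : ℤ) (d : X → ZF X), el u = n • 1 + ∑ i, (el (of i) - 1) * d i
    suffices H : ∀ u v : FreeGroup X, (∃ (n : ℤ) (d : X → ZF X), el v = n • 1 +
        ∑ i, (el (of i) - 1) * d i) → ∃ (n : ℤ) (d : X → ZF X), el (u * v) = n • 1 +
        ∑ i, (el (of i) - 1) * d i by
      have := H u 1 ⟨1, 0, by simp⟩
      simpa using this
    intro u
    induction u using FreeGroup.induction_on with
    | C1 => intro v h; simpa using h
    | of k =>
      rintro v ⟨n, d, h⟩
      refine ⟨n, d + Pi.single k (el v), ?_⟩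
      simp only [Pi.add_apply, mul_add, Finset.sum_add_distrib, ← add_assoc, ← h]
      rw [Finset.sum_eq_single k (by simp +contextual) (by simp)]
      simp [sub_mul]
    | inv_of k _ =>
      rintro v ⟨n, d, h⟩
      refine ⟨n, d - Pi.single k (el ((of k)⁻¹ * v)), ?_⟩
      simp only [Pi.sub_apply, mul_sub, Finset.sum_sub_distrib, ← add_sub_assoc, ← h]
      rw [Finset.sum_eq_single k (by simp +contextual) (by simp)]
      rw [Pi.single_eq_same, sub_mul, one_mul, ← map_mul, mul_inv_cancel_left]
      abel
    | mul x y hx hy =>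
      intro v h
      rw [mul_assoc]
      exact hx _ (hy _ h)
  | add f g hf hg =>
    obtain ⟨n, d, hd⟩ := hf
    obtain ⟨m, e, he⟩ := hg
    refine ⟨n + m, d + e, ?_⟩
    simp only [Pi.add_apply, mul_add, Finset.sum_add_distrib, add_smul]
    rw [hd, he]; abel
  | smul r f hf =>
    obtain ⟨n, d, hd⟩ := hf
    refine ⟨r * n, r • d, ?_⟩
    rw [hd, smul_add, smul_smul, Finset.smul_sum]
    simp only [Pi.smul_apply, mul_smul_comm]

lemma coef_nil_fox (n : ℤ) (d : X → ZF X) (z : ZF X) :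
    coef [] ((n • 1 + ∑ i, (el (of i) - 1) * d i) * z) = n * coef [] z := by
  simp only [add_mul, Finset.sum_mul, sub_mul, mul_assoc, map_add, map_sum, map_sub,
    coef_nil_el_of_mul, one_mul, sub_self, Finset.sum_const_zero, add_zero, smul_mul_assoc,
    map_smul, smul_eq_mul]

lemma coef_cons_fox (n : ℤ) (d : X → ZF X) (z : ZF X) (j : X) (w : List X) :
    coef (j :: w) ((n • 1 + ∑ i, (el (of i) - 1) * d i) * z) =
      n * coef (j :: w) z + coef w (d j * z) := by
  simp only [add_mul, Finset.sum_mul, sub_mul, mul_assoc, map_add, map_sum, map_sub,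
    coef_cons_el_of_mul, one_mul, smul_mul_assoc, map_smul, smul_eq_mul]
  simp

lemma coef_mul (w : List X) (z z' : ZF X) : coef w (z * z') =
    ∑ k ∈ Finset.range (w.length + 1), coef (w.take k) z * coef (w.drop k) z' := by
  induction w generalizing z with
  | nil =>
    obtain ⟨n, d, rfl⟩ := exists_fox z
    rw [coef_nil_fox]
    have := coef_nil_fox n d 1
    simp only [mul_one, coef_nil_one] at this
    rw [List.length_nil, Finset.sum_range_one, List.take_nil, List.drop_nil, this]
  | cons j w ih =>
    obtain ⟨n, d, rfl⟩ := exists_fox z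
    rw [coef_cons_fox, ih, List.length_cons, Finset.sum_range_succ' _ (w.length + 1)]
    have h0 := coef_nil_fox n d 1
    have h1 := fun w => coef_cons_fox n d 1 j w
    simp only [mul_one, coef_nil_one, coef_cons_one, mul_zero, zero_add] at h0 h1
    simp only [List.take_succ_cons, List.drop_succ_cons, h1, List.take_zero, List.drop_zero, h0]
    ring

/-- The powers of the augmentation ideal, described by vanishing of Magnus coefficients. -/
def J (k : ℕ) (z : ZF X) : Prop := ∀ w : List X, w.length < k → coef w z = 0

omit [Fintype X] in
lemma J_zero (z : ZF X) : J 0 z := fun w hw => by simp at hw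

omit [Fintype X] in
lemma J.mono {k l : ℕ} (h : l ≤ k) {z : ZF X} (hz : J k z) : J l z := fun w hw => hz w (by omega)

omit [Fintype X] in
lemma J.add {k : ℕ} {z z' : ZF X} (hz : J k z) (hz' : J k z') : J k (z + z') := fun w hw => by
  rw [map_add, hz w hw, hz' w hw, add_zero]

omit [Fintype X] in
lemma J.neg {k : ℕ} {z : ZF X} (hz : J k z) : J k (-z) := fun w hw => by
  rw [map_neg, hz w hw, neg_zero]

omit [Fintype X] in
lemma J.sub {k : ℕ} {z z' : ZF X} (hz : J k z) (hz' : J k z') : J k (z - z') := by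
  rw [sub_eq_add_neg]; exact hz.add hz'.neg

omit [Fintype X] in
lemma J.smul {k : ℕ} {z : ZF X} (n : ℤ) (hz : J k z) : J k (n • z) := fun w hw => by
  rw [map_smul, hz w hw, smul_zero]

omit [Fintype X] in
lemma J.sum {k : ℕ} {ι : Type*} (s : Finset ι) {z : ι → ZF X} (hz : ∀ i, J k (z i)) :
    J k (∑ i ∈ s, z i) := fun w hw => by
  rw [map_sum]; exact Finset.sum_eq_zero fun i _ => hz i w hw

lemma J.mul {k l : ℕ} {z z' : ZF X} (hz : J k z) (hz' : J l z') : J (k + l) (z * z') := by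
  intro w hw
  rw [coef_mul]
  refine Finset.sum_eq_zero fun m hm => ?_
  by_cases h : (w.take m).length < k
  · rw [hz _ h, zero_mul]
  · rw [hz' (w.drop m), mul_zero]
    rw [List.length_take] at h
    rw [List.length_drop]
    omega

lemma J.mul_right {k : ℕ} {z : ZF X} (hz : J k z) (z' : ZF X) : J k (z * z') := hz.mul (J_zero z')

lemma J.mul_left {k : ℕ} {z : ZF X} (hz : J k z) (z' : ZF X) : J k (z' * z) := by
  simpa using (J_zero z').mul hz

/-- The coefficient of a product in the lowest possible degree. -/
lemma coef_append_mul {k l : ℕ} {z z' : ZF X} (hz : J k z) (hz' : J l z') {v w : List X}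
    (hv : v.length = k) (hw : w.length = l) : coef (v ++ w) (z * z') = coef v z * coef w z' := by
  rw [coef_mul, Finset.sum_eq_single k]
  · subst hv; simp
  · intro m hm hmk
    rcases lt_or_gt_of_ne hmk with h | h
    · rw [hz, zero_mul]
      rw [List.length_take]; omega
    · rw [hz' (List.drop m _), mul_zero]
      simp only [Finset.mem_range, List.length_append, List.length_drop] at hm ⊢
      omega
  · intro h
    exact (h (by simp only [Finset.mem_range, List.length_append]; omega)).elim

omit [Fintype X] in
lemma coef_nil_el (u : FreeGroup X) : coef [] (el u) = 1 := by
  suffices H : ∀ z : ZF X, coef [] (el u * z) = coef [] z by simpa using H 1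
  induction u using FreeGroup.induction_on with
  | C1 => intro z; simp
  | of k => exact coef_nil_el_of_mul k
  | inv_of k _ =>
    intro z
    rw [← coef_nil_el_of_mul k (el (of k)⁻¹ * z), ← mul_assoc, ← map_mul el]
    simp
  | mul x y hx hy => intro z; rw [map_mul el, mul_assoc, hx, hy]

omit [Fintype X] in
lemma J_one_el_sub_one (u : FreeGroup X) : J 1 (el u - 1) := by
  intro w hw
  obtain rfl : w = [] := List.length_eq_zero_iff.1 (by omega)
  rw [map_sub, coef_nil_el, coef_nil_one, sub_self]

/-- The action of endomorphisms on the group ring. -/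
noncomputable def lin (y : FreeGroup X →* FreeGroup X) : ZF X →ₐ[ℤ] ZF X :=
  MonoidAlgebra.mapDomainAlgHom ℤ ℤ y

omit [DecidableEq X] [Fintype X] in
@[simp] lemma lin_el (y : FreeGroup X →* FreeGroup X) (u : FreeGroup X) :
    lin y (el u) = el (y u) := by
  simp [lin, el, MonoidAlgebra.of_apply]

lemma exists_fox_of_J {k : ℕ} {z : ZF X} (hz : J (k + 1) z) :
    ∃ d : X → ZF X, (∀ i, J k (d i)) ∧ z = ∑ i, (el (of i) - 1) * d i := by
  obtain ⟨n, d, hd⟩ := exists_fox z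
  have h0 := coef_nil_fox n d 1
  have h1 := fun j w => coef_cons_fox n d 1 j w
  simp only [mul_one, coef_nil_one, coef_cons_one, mul_zero, zero_add, ← hd] at h0 h1
  obtain rfl : n = 0 := by rw [← h0, hz [] (by simp)]
  exact ⟨d, fun i w hw => by rw [← h1, hz _ (by simpa using hw)], by simpa using hd⟩

lemma J.lin {k : ℕ} {z : ZF X} (hz : J k z) (y : FreeGroup X →* FreeGroup X) : J k (lin y z) := by
  induction k generalizing z with
  | zero => exact J_zero _
  | succ k ih =>
    obtain ⟨d, hd, rfl⟩ := exists_fox_of_J hz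
    rw [map_sum]
    refine J.sum _ fun i => ?_
    rw [map_mul, map_sub, lin_el, map_one, add_comm]
    exact (J_one_el_sub_one _).mul (ih (hd i))

lemma J_sub_of_gen {k : ℕ} {y : FreeGroup X →* FreeGroup X}
    (hy : ∀ i, J k (el (y (of i)) - el (of i))) (u : FreeGroup X) : J k (el (y u) - el u) := by
  induction u using FreeGroup.induction_on with
  | C1 => rw [map_one, sub_self]; intro w _; simp
  | of i => exact hy i
  | inv_of i _ =>
    have h : el (y (of i)⁻¹) - el (of i)⁻¹ =
        -(el (y (of i)⁻¹) * (el (y (of i)) - el (of i)) * el (of i)⁻¹) := by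
      rw [mul_sub, sub_mul, mul_assoc (el (y (of i)⁻¹)) (el (of i)), ← map_mul, ← map_mul,
        ← map_mul, ← map_mul]
      simp
    rw [h]
    exact (((hy i).mul_left _).mul_right _).neg
  | mul a b ha hb =>
    have h : el (y (a * b)) - el (a * b) =
        (el (y a) - el a) * el (y b) + el a * (el (y b) - el b) := by
      rw [map_mul y, map_mul el, map_mul el]; noncomm_ring
    rw [h]
    exact (ha.mul_right _).add (hb.mul_left _)

lemma J.lin_sub {k : ℕ} {y : FreeGroup X →* FreeGroup X}
    (hy : ∀ u, J (k + 1) (el (y u) - el u)) {j : ℕ} {z : ZF X} (hz : J j z) :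
    J (j + k) (FreeAut.lin y z - z) := by
  induction j generalizing z with
  | zero =>
    induction z using MonoidAlgebra.induction_on with
    | of u =>
      change J _ (FreeAut.lin y (el u) - el u)
      rw [lin_el]; exact (hy u).mono (by omega)
    | add f g hf hg =>
      rw [map_add, add_sub_add_comm]
      exact (hf (J_zero _)).add (hg (J_zero _))
    | smul r f hf => rw [map_smul, ← smul_sub]; exact (hf (J_zero _)).smul r
  | succ j ih =>
    obtain ⟨d, hd, rfl⟩ := exists_fox_of_J hz
    rw [map_sum, ← Finset.sum_sub_distrib]
    refine J.sum _ fun i => ?_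
    have h : FreeAut.lin y ((el (of i) - 1) * d i) - (el (of i) - 1) * d i =
        (el (y (of i)) - el (of i)) * FreeAut.lin y (d i) +
          (el (of i) - 1) * (FreeAut.lin y (d i) - d i) := by
      rw [map_mul, map_sub, lin_el, map_one]; noncomm_ring
    rw [h]
    exact (((hy _).mul ((hd i).lin y)).mono (by omega)).add
      (((J_one_el_sub_one _).mul (ih (hd i))).mono (by omega))

end FreeAut

namespace FreeAut

open FreeGroup (of of_ne_one)
open MulAut (conj)

variable {X : Type*} [DecidableEq X] [Fintype X]

/-- The coefficient of `w` in the Magnus expansion of a group element. -/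
noncomputable def lam (w : List X) (u : FreeGroup X) : ℤ := coef w (el u)

omit [Fintype X] in
@[simp] lemma lam_nil (u : FreeGroup X) : lam [] u = 1 := coef_nil_el u

omit [Fintype X] in
lemma lam_one {w : List X} (hw : w ≠ []) : lam w 1 = 0 := by
  rw [lam, map_one, coef_one, if_neg hw]

lemma lam_mul (w : List X) (u v : FreeGroup X) : lam w (u * v) =
    ∑ k ∈ Finset.range (w.length + 1), lam (w.take k) u * lam (w.drop k) v := by
  rw [lam, map_mul, coef_mul]; rfl

lemma lam_singleton_mul (i : X) (u v : FreeGroup X) :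
    lam [i] (u * v) = lam [i] u + lam [i] v := by
  simp [lam_mul, Finset.sum_range_succ, add_comm]

lemma lam_pair_mul (i j : X) (u v : FreeGroup X) :
    lam [i, j] (u * v) = lam [i, j] u + lam [i] u * lam [j] v + lam [i, j] v := by
  simp [lam_mul, Finset.sum_range_succ]; ring

lemma lam_singleton_inv (i : X) (u : FreeGroup X) : lam [i] u⁻¹ = -lam [i] u := by
  have := lam_singleton_mul i u u⁻¹
  rw [mul_inv_cancel, lam_one (by simp)] at this
  omega

lemma lam_singleton_conj (i : X) (u v : FreeGroup X) : lam [i] (u * v * u⁻¹) = lam [i] v := by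
  rw [lam_singleton_mul, lam_singleton_mul, lam_singleton_inv]; ring

omit [Fintype X] in
lemma lam_cons_of_mul (i j : X) (w : List X) (u : FreeGroup X) :
    lam (j :: w) (of i * u) = lam (j :: w) u + if j = i then lam w u else 0 := by
  rw [lam, map_mul, coef_cons_el_of_mul]; rfl

omit [Fintype X] in
lemma lam_cons_of (i j : X) (w : List X) :
    lam (j :: w) (of i) = if j = i ∧ w = [] then 1 else 0 := by
  have := lam_cons_of_mul i j w 1
  have h1 : lam w (1 : FreeGroup X) = if w = [] then 1 else 0 := by rw [lam, map_one, coef_one]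
  rw [mul_one, lam_one (by simp), zero_add, h1] at this
  rw [this]
  split_ifs <;> simp_all

omit [Fintype X] in
@[simp] lemma lam_singleton_of (i j : X) : lam [j] (of i) = if j = i then 1 else 0 := by
  simp [lam_cons_of]

lemma lam_singleton_zpow (i : X) (u : FreeGroup X) (n : ℤ) : lam [i] (u ^ n) = n * lam [i] u := by
  induction n with
  | zero => simp [lam_one]
  | succ n ih => rw [zpow_add_one, lam_singleton_mul, ih]; ring
  | pred n ih => rw [zpow_sub_one, lam_singleton_mul, ih, lam_singleton_inv]; ring

/-- The dimension subgroups of the free group. -/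
def FF (X : Type*) [DecidableEq X] [Fintype X] (k : ℕ) : Subgroup (FreeGroup X) where
  carrier := {u | J k (el u - 1)}
  one_mem' := fun w _ => by simp
  mul_mem' {u v} hu hv := by
    have : el (u * v) - 1 = (el u - 1) * el v + (el v - 1) := by rw [map_mul]; noncomm_ring
    rw [Set.mem_ofPred_eq, this]
    exact (J.mul_right hu _).add hv
  inv_mem' {u} hu := by
    have : el u⁻¹ - 1 = -(el u⁻¹ * (el u - 1)) := by
      rw [mul_sub, ← map_mul, inv_mul_cancel, map_one]; noncomm_ring
    rw [Set.mem_ofPred_eq, this]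
    exact (J.mul_left hu _).neg

lemma mem_FF {k : ℕ} {u : FreeGroup X} : u ∈ FF X k ↔ J k (el u - 1) := Iff.rfl

lemma mem_FF_iff_lam {k : ℕ} {u : FreeGroup X} :
    u ∈ FF X k ↔ ∀ w : List X, w ≠ [] → w.length < k → lam w u = 0 := by
  rw [mem_FF]
  constructor
  · intro h w hw hk
    have := h w hk
    rwa [map_sub, coef_one, if_neg hw, sub_zero] at this
  · intro h w hk
    rcases eq_or_ne w [] with rfl | hw
    · rw [map_sub, coef_nil_el, coef_nil_one, sub_self]
    · rw [map_sub, coef_one, if_neg hw, sub_zero]; exact h w hw hk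

lemma FF_one_eq : FF X 1 = ⊤ := by
  ext u; simpa [mem_FF] using J_one_el_sub_one u

lemma FF_anti {k l : ℕ} (h : l ≤ k) : FF X k ≤ FF X l := fun _ hu => J.mono h hu

lemma mem_FF_two {u : FreeGroup X} : u ∈ FF X 2 ↔ ∀ i, lam [i] u = 0 := by
  rw [mem_FF_iff_lam]
  constructor
  · intro h i; exact h [i] (by simp) (by simp)
  · intro h w hw hk
    match w, hw, hk with
    | [i], _, _ => exact h i
    | _ :: _ :: _, _, hk => simp at hk

/-- Congruence of group elements in terms of the group ring. -/
lemma mul_inv_mem_FF {k : ℕ} {u v : FreeGroup X} :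
    u * v⁻¹ ∈ FF X k ↔ J k (el u - el v) := by
  have h1 : el (u * v⁻¹) - 1 = (el u - el v) * el v⁻¹ := by
    rw [sub_mul, ← map_mul, ← map_mul, mul_inv_cancel, map_one]
  have h2 : el u - el v = (el (u * v⁻¹) - 1) * el v := by
    rw [sub_mul, ← map_mul, inv_mul_cancel_right, one_mul]
  rw [mem_FF]
  constructor
  · intro h; rw [h2]; exact h.mul_right _
  · intro h; rw [h1]; exact h.mul_right _

lemma map_mem_FF {k : ℕ} {u : FreeGroup X} (hu : u ∈ FF X k) (y : FreeGroup X →* FreeGroup X) :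
    y u ∈ FF X k := by
  have := J.lin (mem_FF.1 hu) y
  rwa [map_sub, lin_el, map_one] at this

lemma map_aut_mem_FF {k : ℕ} {u : FreeGroup X} (y : MulAut (FreeGroup X)) :
    y u ∈ FF X k ↔ u ∈ FF X k := by
  refine ⟨fun h => ?_, fun h => map_mem_FF h y.toMonoidHom⟩
  simpa using map_mem_FF h (y⁻¹ : MulAut _).toMonoidHom

instance FF_normal (k : ℕ) : (FF X k).Normal := ⟨fun _ hu g => (map_aut_mem_FF (conj g)).2 hu⟩

lemma J_commutator {k l : ℕ} {u v : FreeGroup X} (hu : u ∈ FF X k) (hv : v ∈ FF X l) :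
    J (k + l) (el (u * v) - el (v * u)) := by
  have h : el (u * v) - el (v * u) = (el u - 1) * (el v - 1) - (el v - 1) * (el u - 1) := by
    rw [map_mul, map_mul]; noncomm_ring
  rw [h]
  exact (J.mul hu hv).sub (by rw [add_comm]; exact J.mul hv hu)

lemma commutator_mem_FF {k l : ℕ} {u v : FreeGroup X} (hu : u ∈ FF X k) (hv : v ∈ FF X l) :
    u * v * (v * u)⁻¹ ∈ FF X (k + l) :=
  mul_inv_mem_FF.2 (J_commutator hu hv)

/-- The Andreadakis filtration of the automorphism group. -/
def AA (X : Type*) [DecidableEq X] [Fintype X] (k : ℕ) : Subgroup (MulAut (FreeGroup X)) where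
  carrier := {y | ∀ u, J (k + 1) (el (y u) - el u)}
  one_mem' := fun u => by
    rw [MulAut.one_apply, sub_self]; intro w _; simp
  mul_mem' {y z} hy hz u := by
    have : el ((y * z) u) - el u = (el (y (z u)) - el (z u)) + (el (z u) - el u) := by
      rw [MulAut.mul_apply]; abel
    rw [this]
    exact (hy _).add (hz _)
  inv_mem' {y} hy u := by
    have := (hy (y⁻¹ u)).neg
    rwa [MulAut.apply_inv_self, neg_sub] at this

lemma mem_AA {k : ℕ} {y : MulAut (FreeGroup X)} :
    y ∈ AA X k ↔ ∀ u, J (k + 1) (el (y u) - el u) := Iff.rfl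

lemma mem_AA_iff {k : ℕ} {y : MulAut (FreeGroup X)} :
    y ∈ AA X k ↔ ∀ u, y u * u⁻¹ ∈ FF X (k + 1) := by
  simp_rw [mem_AA, mul_inv_mem_FF]

lemma mem_AA_of_gen {k : ℕ} {y : MulAut (FreeGroup X)}
    (h : ∀ i, J (k + 1) (el (y (of i)) - el (of i))) : y ∈ AA X k :=
  J_sub_of_gen (y := y.toMonoidHom) h

lemma AA_anti {k l : ℕ} (h : l ≤ k) : AA X k ≤ AA X l := fun _ hy u => (hy u).mono (by omega)

instance AA_normal (k : ℕ) : (AA X k).Normal := ⟨fun y hy g => by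
  rw [mem_AA_iff] at *
  intro u
  have := (map_aut_mem_FF g).2 (hy (g⁻¹ u))
  rwa [map_mul, map_inv, MulAut.apply_inv_self] at this⟩

lemma commutator_mem_AA {k l : ℕ} {y z : MulAut (FreeGroup X)} (hy : y ∈ AA X k)
    (hz : z ∈ AA X l) : y * z * (z * y)⁻¹ ∈ AA X (k + l) := by
  have key : ∀ u, J (k + l + 1) (el (y (z u)) - el (z (y u))) := by
    intro u
    have hy' := fun {j} {x : ZF X} => J.lin_sub (y := y.toMonoidHom) hy (j := j) (z := x)
    have hz' := fun {j} {x : ZF X} => J.lin_sub (y := z.toMonoidHom) hz (j := j) (z := x)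
    have h1 := hy' (hz u)
    have h2 := hz' (hy u)
    rw [map_sub, lin_el, lin_el] at h1 h2
    have := (h1.mono (l := k + l + 1) (by omega)).sub (h2.mono (l := k + l + 1) (by omega))
    simp only [MulEquiv.toMonoidHom_eq_coe, MonoidHom.coe_coe] at this
    have e : el (y (z u)) - el (y u) - (el (z u) - el u) -
      (el (z (y u)) - el (z u) - (el (y u) - el u)) = el (y (z u)) - el (z (y u)) := by abel
    rwa [e] at this
  intro u
  have := key ((z * y)⁻¹ u)
  have h : z (y ((z * y)⁻¹ u)) = u := (z * y).apply_symm_apply u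
  rwa [h] at this

lemma conj_mem_AA {k : ℕ} {u : FreeGroup X} (hu : u ∈ FF X k) : conj u ∈ AA X k := by
  rw [mem_AA_iff]
  intro v
  have := commutator_mem_FF hu (v := v) (l := 1) (by rw [FF_one_eq]; trivial)
  rw [MulAut.conj_apply]
  simpa [mul_assoc] using this

lemma mem_FF_of_conj_mem_AA [Nontrivial X] {k : ℕ} {u : FreeGroup X} (hu : conj u ∈ AA X k) :
    u ∈ FF X k := by
  induction k with
  | zero => exact J_zero _
  | succ k ih =>
    have ih := ih (AA_anti (by omega) hu)
    rcases Nat.eq_zero_or_pos k with rfl | hk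
    · rw [zero_add, FF_one_eq]; trivial
    rw [mem_FF_iff_lam]
    intro w hw hwk
    rcases Nat.lt_succ_iff_lt_or_eq.1 hwk with h | h
    · exact mem_FF_iff_lam.1 ih w hw h
    obtain ⟨j, w', rfl⟩ := List.exists_cons_of_ne_nil hw
    obtain ⟨i, hi⟩ := exists_ne j
    have h1 : J (k + 2) ((el u - 1) * (el (of i) - 1) - (el (of i) - 1) * (el u - 1)) := by
      have h2 := (hu (of i)).mul_right (el u)
      rw [MulAut.conj_apply, sub_mul, ← map_mul, ← map_mul, inv_mul_cancel_right, map_mul,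
        map_mul] at h2
      convert h2 using 1
      noncomm_ring
    have h3 := h1 ((j :: w') ++ [i]) (by simp only [List.length_append, h]; simp)
    rw [map_sub, coef_append_mul (mem_FF.1 ih) (J_one_el_sub_one _) h (by simp)] at h3
    have h4 := coef_append_mul (J_one_el_sub_one (of i)) (mem_FF.1 ih) (v := [j]) (w := w' ++ [i])
      (by simp) (by simpa using h)
    rw [List.singleton_append, ← List.cons_append] at h4
    rw [h4] at h3
    have h5 : coef [j] (el (of i) - 1) = 0 := by
      rw [map_sub, coef_cons_one, sub_zero]
      change lam [j] (of i) = 0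
      simp [hi.symm]
    have h6 : coef [i] (el (of i) - 1) = 1 := by
      rw [map_sub, coef_cons_one, sub_zero]
      change lam [i] (of i) = 1
      simp
    rw [h5, h6, zero_mul, sub_zero, mul_one, map_sub, coef_cons_one, sub_zero] at h3
    exact h3

lemma conj_mem_AA_iff [Nontrivial X] {k : ℕ} {u : FreeGroup X} :
    conj u ∈ AA X k ↔ u ∈ FF X k := ⟨mem_FF_of_conj_mem_AA, conj_mem_AA⟩

end FreeAut

namespace FreeAut

open FreeGroup (of of_ne_one)
open MulAut (conj)

variable {X : Type*} [DecidableEq X]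

omit [DecidableEq X] in
lemma aut_ext {y z : MulAut (FreeGroup X)} (h : ∀ i, y (of i) = z (of i)) : y = z := by
  have : y.toMonoidHom = z.toMonoidHom := FreeGroup.ext_hom _ _ h
  exact MulEquiv.ext fun u => DFunLike.congr_fun this u

/-- The transvection `i ↦ i * j`. -/
def trv {i j : X} (h : j ≠ i) : MulAut (FreeGroup X) :=
  MonoidHom.toMulEquiv (substHom i (of i * of j)) (substHom i (of i * (of j)⁻¹))
    (hom_ext_incl i (by simp) (by simp [substHom_of_ne _ h]))
    (hom_ext_incl i (by simp) (by simp [substHom_of_ne _ h]))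

lemma trv_self {i j : X} (h : j ≠ i) : trv h (of i) = of i * of j := substHom_self _ _

lemma trv_of_ne {i j k : X} (h : j ≠ i) (hk : k ≠ i) : trv h (of k) = of k := substHom_of_ne _ hk

lemma trv_inv_self {i j : X} (h : j ≠ i) : (trv h)⁻¹ (of i) = of i * (of j)⁻¹ := substHom_self _ _

lemma trv_inv_of_ne {i j k : X} (h : j ≠ i) (hk : k ≠ i) : (trv h)⁻¹ (of k) = of k :=
  substHom_of_ne _ hk

lemma tau_one_self (i : X) : tau i 1 (of i) = (of i)⁻¹ := by simp

lemma tau_one_commute (i j : X) : tau i 1 * tau j 1 = tau j 1 * tau i 1 := by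
  rcases eq_or_ne i j with rfl | h
  · rfl
  apply aut_ext
  intro k
  simp only [MulAut.mul_apply]
  rcases eq_or_ne k i with rfl | hi
  · rw [tau_of_ne _ h, tau_one_self, map_inv, tau_of_ne _ h]
  rcases eq_or_ne k j with rfl | hj
  · rw [tau_of_ne _ hi, tau_one_self, map_inv, tau_of_ne _ hi]
  · rw [tau_of_ne _ hi, tau_of_ne _ hj, tau_of_ne _ hi]

lemma perm_mul_tau (σ : Equiv.Perm X) (t : X) : (FreeGroup.freeGroupCongr σ : MulAut (FreeGroup X))
    * tau t 1 = tau (σ t) 1 * (FreeGroup.freeGroupCongr σ : MulAut (FreeGroup X)) := by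
  apply aut_ext
  intro k
  simp only [MulAut.mul_apply, FreeGroup.freeGroupCongr_apply, FreeGroup.map.of]
  rcases eq_or_ne k t with rfl | h
  · rw [tau_one_self, tau_one_self, map_inv, FreeGroup.map.of]
  · rw [tau_of_ne _ h, tau_of_ne _ (σ.injective.ne h), FreeGroup.map.of]

lemma trv_mul_tau {i j k : X} (h : j ≠ i) (hi : k ≠ i) (hj : k ≠ j) :
    trv h * tau k 1 = tau k 1 * trv h := by
  apply aut_ext
  intro l
  simp only [MulAut.mul_apply]
  rcases eq_or_ne l i with rfl | hl
  · rw [tau_of_ne _ hi.symm, trv_self, map_mul, tau_of_ne _ hi.symm, tau_of_ne _ hj.symm]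
  rw [trv_of_ne _ hl]
  rcases eq_or_ne l k with rfl | hlk
  · rw [tau_one_self, map_inv, trv_of_ne _ hl]
  · rw [tau_of_ne _ hlk, trv_of_ne _ hl]

lemma tau_mul_trv_mul_tau {i j : X} (h : j ≠ i) : tau j 1 * trv h * tau j 1 = (trv h)⁻¹ := by
  apply aut_ext
  intro l
  simp only [MulAut.mul_apply]
  rcases eq_or_ne l i with rfl | hl
  · rw [trv_inv_self, tau_of_ne _ h.symm, trv_self, map_mul, tau_of_ne _ h.symm, tau_one_self]
  rw [trv_inv_of_ne _ hl]
  rcases eq_or_ne l j with rfl | hlj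
  · rw [tau_one_self, map_inv, trv_of_ne _ hl, map_inv, tau_one_self, inv_inv]
  · rw [tau_of_ne _ hlj, trv_of_ne _ hl, tau_of_ne _ hlj]

/-- A homomorphism under which each transvection commutes with the inversion of both of its
letters kills the inner automorphisms. -/
lemma map_conj_eq_one_of_commute [Finite X] {M : Type*} [Monoid M] (ρ : MulAut (FreeGroup X) →* M)
    (hρ : ∀ {i j : X} (h : j ≠ i),
      ρ (trv h * (tau i 1 * tau j 1)) = ρ ((tau i 1 * tau j 1) * trv h)) (u : FreeGroup X) :
    ρ (conj u) = 1 := by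
  have := Fintype.ofFinite X
  have h1 {i j : X} (h : j ≠ i) : ρ (trv h * (tau i 1 * trv h * tau i 1)) = 1 := by
    have e1 := tau_mul_self i 1
    have e2 := tau_mul_trv_mul_tau h
    have h2 := hρ h
    have h3 : trv h * (tau i 1 * trv h * tau i 1) = trv h * (tau i 1 * tau j 1) *
        ((tau i 1 * tau j 1) * trv h)⁻¹ := by
      have e3 : (tau j 1 : MulAut (FreeGroup X))⁻¹ = tau j 1 := by
        rw [inv_eq_iff_mul_eq_one]; exact tau_mul_self j 1
      have e4 : (tau i 1 : MulAut (FreeGroup X))⁻¹ = tau i 1 := by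
        rw [inv_eq_iff_mul_eq_one]; exact e1
      have e5 : trv h = tau j 1 * (trv h)⁻¹ * tau j 1 := by
        rw [← e2]; nth_rewrite 1 [← e3]; nth_rewrite 3 [← e3]; group
      rw [mul_inv_rev, mul_inv_rev, e3, e4]
      nth_rewrite 2 [e5]
      group
    rw [h3, map_mul, h2, ← map_mul, mul_inv_cancel, map_one]
  have h2 {i j : X} (h : j ≠ i) : (trv h * (tau i 1 * trv h * tau i 1)) (of i) =
      (of j)⁻¹ * of i * of j := by
    simp only [MulAut.mul_apply]
    rw [tau_one_self, map_inv, trv_self, mul_inv_rev, map_mul, map_inv, map_inv, tau_one_self,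
      tau_of_ne _ h, inv_inv, map_mul, map_inv, trv_self, trv_of_ne _ h, mul_assoc]
  have h3 {i j k : X} (h : j ≠ i) (hk : k ≠ i) :
      (trv h * (tau i 1 * trv h * tau i 1)) (of k) = of k := by
    simp only [MulAut.mul_apply]
    rw [tau_of_ne _ hk, trv_of_ne _ hk, tau_of_ne _ hk, trv_of_ne _ hk]
  have h4 (j : X) (T : Finset X) : ∃ m ∈ ρ.ker, ∀ i,
      m (of i) = if i ∈ T then (of j)⁻¹ * of i * of j else of i := by
    induction T using Finset.induction_on with
    | empty => exact ⟨1, one_mem _, by simp⟩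
    | insert i T hi ih =>
      obtain ⟨m, hm, hmT⟩ := ih
      rcases eq_or_ne j i with rfl | h
      · refine ⟨m, hm, fun k => ?_⟩
        rw [hmT]
        rcases eq_or_ne k j with rfl | hk <;> simp [*]
      refine ⟨m * (trv h * (tau i 1 * trv h * tau i 1)), mul_mem hm (h1 h), fun k => ?_⟩
      rw [MulAut.mul_apply]
      have hj : m (of j) = of j := by rw [hmT]; simp
      rcases eq_or_ne k i with rfl | hk
      · rw [h2, map_mul, map_mul, map_inv, hj, hmT, if_neg hi, if_pos (by simp)]
      · rw [h3 h hk, hmT]; simp [hk]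
  have h5 (j : X) : ρ (conj (of j)) = 1 := by
    obtain ⟨m, hm, hmT⟩ := h4 j Finset.univ
    have : m = (conj (of j))⁻¹ := aut_ext fun i => by
      rw [hmT, ← map_inv]; simp
    rw [this, inv_mem_iff] at hm
    exact hm
  have : ρ.comp conj = 1 := FreeGroup.ext_hom _ _ h5
  exact DFunLike.congr_fun this u

end FreeAut

namespace FreeAut

open FreeGroup (of of_ne_one)
open MulAut (conj)

lemma le_choose {n s : ℕ} (h1 : 1 ≤ s) (h2 : s < n) : n ≤ n.choose s := by
  induction n generalizing s with
  | zero => omega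
  | succ n ih =>
    obtain ⟨s, rfl⟩ := Nat.exists_eq_add_of_le' h1
    rw [Nat.choose_succ_succ']
    rcases Nat.lt_or_ge (s + 1) n with h | h
    · have := ih (by omega) h
      have := Nat.choose_pos (n := n) (k := s) (by omega)
      omega
    · obtain rfl : n = s + 1 := by omega
      simp [Nat.choose_succ_self_right]

variable {X : Type*} [DecidableEq X] {V : Type*} [AddCommGroup V] [Module ℚ V]
  {ρ : MulAut (FreeGroup X) →* Module.End ℚ V}

/-- `v` is a common eigenvector of the inversions of letters; `S` records the eigenvalues `-1`. -/
def IsWeight (ρ : MulAut (FreeGroup X) →* Module.End ℚ V) (S : Finset X) (v : V) : Prop :=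
  ∀ t, ρ (tau t 1) v = (if t ∈ S then -1 else 1 : ℚ) • v

lemma rep_tau_tau (t : X) (v : V) : ρ (tau t 1) (ρ (tau t 1) v) = v := by
  rw [← Module.End.mul_apply, ← map_mul, tau_mul_self, map_one, Module.End.one_apply]

lemma rep_tau_comm (s t : X) (v : V) :
    ρ (tau s 1) (ρ (tau t 1) v) = ρ (tau t 1) (ρ (tau s 1) v) := by
  rw [← Module.End.mul_apply, ← Module.End.mul_apply, ← map_mul, ← map_mul, tau_one_commute]

lemma exists_isWeight_perm {S : Finset X} {v : V} (hv : IsWeight ρ S v) (h0 : v ≠ 0)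
    (σ : Equiv.Perm X) : ∃ v, IsWeight ρ (S.map σ.toEmbedding) v ∧ v ≠ 0 := by
  refine ⟨ρ (FreeGroup.freeGroupCongr σ : MulAut (FreeGroup X)) v, fun t => ?_, fun h => h0 ?_⟩
  · have := congrArg (fun y => ρ y v) (perm_mul_tau σ (σ.symm t))
    rw [Equiv.apply_symm_apply] at this
    simp only [map_mul, Module.End.mul_apply] at this
    rw [← this, hv, map_smul]
    congr 2
    simp [Finset.mem_map_equiv]
  · have := congrArg (ρ (FreeGroup.freeGroupCongr σ : MulAut (FreeGroup X))⁻¹) h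
    rwa [← Module.End.mul_apply, ← map_mul, inv_mul_cancel, map_one, map_zero] at this

lemma card_weights_le [FiniteDimensional ℚ V] {P : Finset (Finset X)}
    (hP : ∀ S ∈ P, ∃ v, IsWeight ρ S v ∧ v ≠ 0) : P.card ≤ Module.finrank ℚ V := by
  have hind := Module.End.independent_iInf_maxGenEigenspace_of_forall_mapsTo
    (fun t : X => ρ (tau t 1)) (fun i j φ => Module.End.mapsTo_maxGenEigenspace_of_comm (by
      ext v; exact rep_tau_comm (ρ := ρ) _ _ v) φ)
  choose v hv h0 using hP
  have hinj : Function.Injective (fun (S : P) (t : X) => if t ∈ S.1 then (-1 : ℚ) else 1) := by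
    intro S S' h
    ext t
    have := congrFun h t
    by_cases h1 : t ∈ S.1 <;> by_cases h2 : t ∈ S'.1 <;>
      simp [h1, h2] at this ⊢ <;> norm_num at this
  have := (hind.comp hinj).linearIndependent _ (v := fun S : P => v S.1 S.2)
    (fun S => ?_) (fun S => h0 S.1 S.2)
  · simpa using this.fintype_card_le_finrank
  · rw [Function.comp_apply, Module.End.mem_iInf_maxGenEigenspace_iff]
    intro t
    refine ⟨1, ?_⟩
    rw [pow_one, LinearMap.sub_apply, hv S.1 S.2 t, LinearMap.smul_apply]
    exact sub_self _

variable [Fintype X] [FiniteDimensional ℚ V]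

lemma card_eq_of_isWeight (hV : Module.finrank ℚ V ≤ Fintype.card X) {S S' : Finset X} {v v' : V}
    (hv : IsWeight ρ S v) (h0 : v ≠ 0) (hv' : IsWeight ρ S' v') (h0' : v' ≠ 0)
    (h1 : 1 ≤ S.card) (h2 : S.card < Fintype.card X) : S.card = S'.card := by
  by_contra hne
  have h := card_weights_le (ρ := ρ) (P := insert S' (Finset.powersetCard S.card Finset.univ)) (by
    intro T hT
    rw [Finset.mem_insert, Finset.mem_powersetCard] at hT
    rcases hT with rfl | ⟨-, hT⟩
    · exact ⟨v', hv', h0'⟩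
    obtain ⟨σ, hσ⟩ : ∃ σ : Equiv.Perm X, S.map σ.toEmbedding = T := by
      obtain ⟨e⟩ := Fintype.card_eq.1 (show Fintype.card S = Fintype.card T by simp [hT])
      refine ⟨e.extendSubtype, Finset.eq_of_subset_of_card_le ?_ (by simp [hT])⟩
      intro x hx
      obtain ⟨s, hs, rfl⟩ := Finset.mem_map.1 hx
      exact e.extendSubtype_mem s hs
    exact hσ ▸ exists_isWeight_perm hv h0 σ)
  rw [Finset.card_insert_of_notMem (by simp [Finset.mem_powersetCard, Ne.symm hne]),
    Finset.card_powersetCard, Finset.card_univ] at h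
  have := le_choose h1 h2
  omega

omit [FiniteDimensional ℚ V] in
lemma isWeight_induction {p : V → Prop} (hadd : ∀ u v, p u → p v → p (u + v))
    (h : ∀ S v, IsWeight ρ S v → p v) (v : V) : p v := by
  suffices ∀ (T : Finset X) (v : V), (∃ S : Finset X, ∀ t, t ∉ T →
      ρ (tau t 1) v = (if t ∈ S then -1 else 1 : ℚ) • v) → p v from
    this Finset.univ v ⟨∅, by simp⟩
  intro T
  induction T using Finset.induction_on with
  | empty => rintro v ⟨S, hS⟩; exact h S v fun t => hS t (by simp)
  | insert t T ht ih =>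
    rintro v ⟨S, hS⟩
    have e : v = (1 / 2 : ℚ) • (v + ρ (tau t 1) v) + (1 / 2 : ℚ) • (v - ρ (tau t 1) v) := by
      module
    rw [e]
    refine hadd _ _ (ih _ ⟨S.erase t, fun s hs => ?_⟩) (ih _ ⟨insert t S, fun s hs => ?_⟩)
    · rcases eq_or_ne s t with rfl | hst
      · rw [map_smul, map_add, rep_tau_tau, add_comm]; simp
      · rw [map_smul, map_add, rep_tau_comm, hS s (by simp [hst, hs]), map_smul, ← smul_add,
          smul_comm]
        simp [hst]
    · rcases eq_or_ne s t with rfl | hst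
      · rw [map_smul, map_sub, rep_tau_tau, if_pos (by simp)]; module
      · rw [map_smul, map_sub, rep_tau_comm, hS s (by simp [hst, hs]), map_smul, ← smul_sub,
          smul_comm]
        simp [hst]

/-- A vector behaving like a weight vector outside `i, j` has the expected parity at `i, j`. -/
lemma rep_tau_tau_of_isWeight (hV : Module.finrank ℚ V ≤ Fintype.card X) {S : Finset X} {v : V}
    (hv : IsWeight ρ S v) (h0 : v ≠ 0) {i j : X} (hij : j ≠ i) {w : V}
    (hw : ∀ t, t ≠ i → t ≠ j → ρ (tau t 1) w = (if t ∈ S then -1 else 1 : ℚ) • w) :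
    ρ (tau i 1 * tau j 1) w = (if i ∈ S ↔ j ∈ S then 1 else -1 : ℚ) • w := by
  set χ : ℚ := if i ∈ S ↔ j ∈ S then 1 else -1 with hχ
  have hχ2 : χ * χ = 1 := by rw [hχ]; split_ifs <;> norm_num
  have none {S' : Finset X} {w' : V} (hS : ∀ t, t ≠ i → t ≠ j → (t ∈ S' ↔ t ∈ S))
      (hpar : (i ∈ S ↔ j ∈ S) ↔ ¬ (i ∈ S' ↔ j ∈ S')) (hw' : IsWeight ρ S' w') : w' = 0 := by
    by_contra h0'
    have card (T : Finset X) : T.card = ((T.erase i).erase j).card + (if i ∈ T then 1 else 0) +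
        (if j ∈ T then 1 else 0) := by
      by_cases hi : i ∈ T <;> by_cases hj : j ∈ T <;>
        simp [hi, hj, hij, Finset.card_erase_of_mem, Finset.erase_eq_of_notMem]
      · have := Finset.one_lt_card.2 ⟨i, hi, j, hj, hij.symm⟩
        omega
      · have := Finset.card_pos.2 ⟨i, hi⟩
        omega
      · have := Finset.card_pos.2 ⟨j, hj⟩
        omega
    have e : (S'.erase i).erase j = (S.erase i).erase j := by
      ext t
      simp only [Finset.mem_erase]
      constructor
      · rintro ⟨h1, h2, h3⟩; exact ⟨h1, h2, (hS t h2 h1).1 h3⟩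
      · rintro ⟨h1, h2, h3⟩; exact ⟨h1, h2, (hS t h2 h1).2 h3⟩
    have c1 := card S
    have c2 := card S'
    have c3 := card Finset.univ
    have c4 : ((S.erase i).erase j).card ≤ (((Finset.univ : Finset X).erase i).erase j).card :=
      Finset.card_le_card fun t ht => by simp at ht ⊢; tauto
    have n1 := fun h1 h2 => card_eq_of_isWeight hV hv h0 hw' h0' h1 h2
    have n2 := fun h1 h2 => card_eq_of_isWeight hV hw' h0' hv h0 h1 h2
    rw [e] at c2
    rw [Finset.card_univ] at c3
    generalize ((S.erase i).erase j).card = m at *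
    generalize ((Finset.univ.erase i).erase j).card = m' at *
    by_cases hi : i ∈ S <;> by_cases hj : j ∈ S <;> by_cases hi' : i ∈ S' <;>
      by_cases hj' : j ∈ S' <;> simp [hi, hj, hi', hj'] at c1 c2 c3 hpar <;> omega
  have hb (w : V) : ρ (tau i 1 * tau j 1) w = ρ (tau i 1) (ρ (tau j 1) w) := by
    rw [map_mul, Module.End.mul_apply]
  rw [hb]
  set w' := w - χ • ρ (tau i 1) (ρ (tau j 1) w) with hw'
  have h1 : ρ (tau i 1) (ρ (tau j 1) w') = - χ • w' := by
    rw [hw', map_sub, map_sub, map_smul, map_smul, rep_tau_comm (ρ := ρ) j i (ρ (tau j 1) w),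
      rep_tau_tau, rep_tau_tau, smul_sub, smul_smul, neg_mul, hχ2]
    module
  have h2 : ρ (tau j 1) w' = - χ • ρ (tau i 1) w' := by
    rw [← map_smul, ← h1, rep_tau_tau]
  have hwt (t : X) (hi : t ≠ i) (hj : t ≠ j) :
      ρ (tau t 1) w' = (if t ∈ S then -1 else 1 : ℚ) • w' := by
    rw [hw', map_sub, map_smul, rep_tau_comm, rep_tau_comm (ρ := ρ) t j, hw t hi hj, map_smul,
      map_smul, smul_comm χ, smul_sub]
  have key (ε : ℚ) (hε : ε = 1 ∨ ε = -1) : w' + ε • ρ (tau i 1) w' = 0 := by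
    have hε2 : ε * ε = 1 := by rcases hε with rfl | rfl <;> norm_num
    have a1 : ρ (tau i 1) (w' + ε • ρ (tau i 1) w') = ε • (w' + ε • ρ (tau i 1) w') := by
      rw [map_add, map_smul, rep_tau_tau, smul_add, smul_smul, hε2]; module
    have a2 : ρ (tau j 1) (w' + ε • ρ (tau i 1) w') = (-χ * ε) • (w' + ε • ρ (tau i 1) w') := by
      rw [map_add, map_smul, rep_tau_comm, h2, map_smul, rep_tau_tau, smul_add, smul_smul,
        smul_smul, mul_assoc, hε2]; module
    refine none (S' := ((S.erase i).erase j ∪ (if ε = -1 then {i} else ∅)) ∪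
      (if -χ * ε = -1 then {j} else ∅)) (fun t hi hj => ?_) ?_ (fun t => ?_)
    · split_ifs <;> simp [hi, hj]
    · rcases hε with rfl | rfl <;> by_cases h : i ∈ S ↔ j ∈ S <;> simp [hχ, h, hij, hij.symm] <;>
        norm_num
    · by_cases hi : t = i
      · subst hi
        rw [a1]
        congr 1
        rcases hε with rfl | rfl <;> by_cases h : t ∈ S ↔ j ∈ S <;>
          simp [hχ, h, hij.symm] <;> norm_num
      by_cases hj : t = j
      · subst hj
        rw [a2]
        congr 1
        rcases hε with rfl | rfl <;> by_cases h : i ∈ S ↔ t ∈ S <;>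
          simp [hχ, h, hij] <;> norm_num
      · rw [map_add, map_smul, rep_tau_comm, hwt t hi hj, map_smul, smul_comm ε, ← smul_add]
        congr 1
        have : t ∈ ((S.erase i).erase j ∪ (if ε = -1 then {i} else ∅)) ∪
            (if -χ * ε = -1 then {j} else ∅) ↔ t ∈ S := by
          split_ifs <;> simp [hi, hj]
        simp only [this]
  have : w' = 0 := by
    have e : w' = (1 / 2 : ℚ) • ((w' + (1 : ℚ) • ρ (tau i 1) w') + (w' + (-1 : ℚ) • ρ (tau i 1) w'))
      := by module
    rw [e, key 1 (by simp), key (-1) (by simp)]; simp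
  rw [hw', sub_eq_zero] at this
  nth_rewrite 2 [this]
  rw [smul_smul, hχ2, one_smul]

/-- The free group acts trivially in representations of its automorphism group of dimension at
most its rank. -/
theorem rep_conj_eq_one (hV : Module.finrank ℚ V ≤ Fintype.card X)
    (ρ : MulAut (FreeGroup X) →* Module.End ℚ V) (u : FreeGroup X) : ρ (conj u) = 1 := by
  refine map_conj_eq_one_of_commute ρ (fun {i j} h => LinearMap.ext fun v => ?_) u
  refine isWeight_induction (ρ := ρ)
    (p := fun v => ρ (trv h * (tau i 1 * tau j 1)) v = ρ ((tau i 1 * tau j 1) * trv h) v)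
    (fun u v hu hv => by rw [map_add, map_add, hu, hv])
    (fun S v hv => ?_) v
  rcases eq_or_ne v 0 with rfl | h0
  · rw [map_zero, map_zero]
  rw [map_mul ρ (trv h), map_mul ρ _ (trv h), Module.End.mul_apply, Module.End.mul_apply,
    rep_tau_tau_of_isWeight hV hv h0 h (fun t _ _ => hv t),
    rep_tau_tau_of_isWeight hV hv h0 h (w := ρ (trv h) v) (fun t hi hj => ?_), map_smul]
  rw [← Module.End.mul_apply, ← map_mul, ← trv_mul_tau h hi hj, map_mul, Module.End.mul_apply,
    hv t, map_smul]

end FreeAut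

namespace FreeAut

open FreeGroup (of of_ne_one)
open MulAut (conj)

variable {X : Type*}

/-- The product of a list of syllables. -/
def syl (L : List (X × ℤ)) : FreeGroup X := (L.map fun p => of p.1 ^ p.2).prod

@[simp] lemma syl_nil : syl ([] : List (X × ℤ)) = 1 := rfl

@[simp] lemma syl_cons (p : X × ℤ) (L : List (X × ℤ)) : syl (p :: L) = of p.1 ^ p.2 * syl L := by
  simp [syl]

@[simp] lemma syl_append (L M : List (X × ℤ)) : syl (L ++ M) = syl L * syl M := by simp [syl]

/-- A list of syllables is reduced if exponents do not vanish and adjacent letters are distinct. -/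
def Syl (L : List (X × ℤ)) : Prop :=
  (∀ p ∈ L, p.2 ≠ 0) ∧ (L.map Prod.fst).IsChain (· ≠ ·)

lemma Syl.tail {p : X × ℤ} {L : List (X × ℤ)} (h : Syl (p :: L)) : Syl L :=
  ⟨fun q hq => h.1 q (List.mem_cons_of_mem _ hq), h.2.tail⟩

lemma exists_syl_zpow_mul {L : List (X × ℤ)} (hL : Syl L) (i : X) (e : ℤ) :
    ∃ L', Syl L' ∧ syl L' = of i ^ e * syl L ∧ L'.length ≤ L.length + 1 := by
  rcases eq_or_ne e 0 with rfl | he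
  · exact ⟨L, hL, by simp, by omega⟩
  match L, hL with
  | [], _ => exact ⟨[(i, e)], ⟨by simpa using he, by simp⟩, by simp, by simp⟩
  | (j, e') :: L, hL =>
    rcases eq_or_ne i j with rfl | hij
    · rcases eq_or_ne (e + e') 0 with h0 | h0
      · exact ⟨L, hL.tail, by simp [← mul_assoc, ← zpow_add, h0], by simp; omega⟩
      · refine ⟨(i, e + e') :: L, ⟨?_, hL.2⟩, by simp [← mul_assoc, ← zpow_add], by simp⟩
        intro p hp
        rcases List.mem_cons.1 hp with rfl | hp
        · exact h0
        · exact hL.1 p (List.mem_cons_of_mem _ hp)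
    · refine ⟨(i, e) :: (j, e') :: L, ⟨?_, ?_⟩, by simp, by simp⟩
      · intro p hp
        rcases List.mem_cons.1 hp with rfl | hp
        · exact he
        · exact hL.1 p hp
      · simpa using ⟨hij, by simpa using hL.2⟩

lemma exists_syl (u : FreeGroup X) : ∃ L, Syl L ∧ syl L = u := by
  obtain ⟨W, rfl⟩ : ∃ W, FreeGroup.mk W = u := Quot.exists_rep u
  induction W with
  | nil => exact ⟨[], ⟨by simp, by simp⟩, rfl⟩
  | cons p W ih =>
    obtain ⟨L, hL, h⟩ := ih
    obtain ⟨i, b⟩ := p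
    obtain ⟨L', hL', h', -⟩ := exists_syl_zpow_mul hL i (if b then 1 else -1)
    refine ⟨L', hL', ?_⟩
    rw [h', h]
    change _ = FreeGroup.mk ([(i, b)] ++ W)
    rw [← FreeGroup.mul_mk]
    cases b
    · simp [of, FreeGroup.inv_mk, FreeGroup.invRev]
    · simp [of]

lemma Syl.prod_ne_zero {L : List (X × ℤ)} (hL : Syl L) : (L.map Prod.snd).prod ≠ 0 := by
  intro h
  rw [List.prod_eq_zero_iff] at h
  obtain ⟨p, hp, h0⟩ := List.mem_map.1 h
  exact hL.1 p hp h0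

variable [DecidableEq X]

lemma lam_of_inv_mul {i : X} {w : List X} (hw : ∀ j ∈ w.head?, j ≠ i) (g : FreeGroup X) :
    lam w ((of i)⁻¹ * g) = lam w g := by
  match w, hw with
  | [], _ => simp
  | j :: w, hw =>
    have hj : j ≠ i := hw j (by simp)
    have := lam_cons_of_mul i j w ((of i)⁻¹ * g)
    rw [mul_inv_cancel_left, if_neg hj, add_zero] at this
    exact this.symm

lemma lam_cons_zpow_mul (i j : X) {w : List X} (hw : (j :: w).IsChain (· ≠ ·)) (e : ℤ)
    (g : FreeGroup X) :
    lam (j :: w) (of i ^ e * g) = lam (j :: w) g + if j = i then e * lam w g else 0 := by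
  have hhead : ∀ k ∈ w.head?, k ≠ j := by
    cases w with
    | nil => simp
    | cons k w => simpa using (List.isChain_cons_cons.1 hw).1.symm
  have step (g : FreeGroup X) : lam w (of j * g) = lam w g := by
    rw [← lam_of_inv_mul hhead, inv_mul_cancel_left]
  have stepz (e : ℤ) : lam w (of j ^ e * g) = lam w g := by
    induction e with
    | zero => simp
    | succ n ih => rw [add_comm, zpow_add, zpow_one, mul_assoc, step, ih]
    | pred n ih => rw [sub_eq_add_neg, add_comm, zpow_add, zpow_neg_one, mul_assoc,
        lam_of_inv_mul hhead, ih]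
  induction e with
  | zero => simp
  | succ n ih =>
    rw [add_comm, zpow_add, zpow_one, mul_assoc, lam_cons_of_mul, ih]
    split_ifs with h
    · subst h; rw [stepz]; ring
    · ring
  | pred n ih =>
    have := lam_cons_of_mul i j w (of i ^ (-(n : ℤ) - 1) * g)
    rw [← mul_assoc, ← zpow_one_add, add_sub_cancel, ih] at this
    split_ifs at this ⊢ with h
    · subst h; rw [stepz] at this; linarith
    · linarith

/-- The top coefficient of the Magnus expansion of a reduced product of syllables. -/
lemma lam_syl {L : List (X × ℤ)} (hL : Syl L) {w : List X} (hw : w.IsChain (· ≠ ·))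
    (h : L.length ≤ w.length) :
    lam w (syl L) = if w = L.map Prod.fst then (L.map Prod.snd).prod else 0 := by
  induction L generalizing w with
  | nil =>
    cases w with
    | nil => simp
    | cons j w => simp [lam_one]
  | cons p L ih =>
    match w, hw, h with
    | j :: w, hw, h =>
      rw [syl_cons, lam_cons_zpow_mul _ _ hw, ih hL.tail hw (by simp at h ⊢; omega),
        ih hL.tail (w := w) hw.tail (by simpa using h), if_neg]
      · by_cases hj : j = p.1 <;> by_cases hw : w = L.map Prod.fst <;> simp [hj, hw]
      · intro h'
        have := congrArg List.length h'
        simp at this h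
        omega

lemma lam_syl_self {L : List (X × ℤ)} (hL : Syl L) : lam (L.map Prod.fst) (syl L) ≠ 0 := by
  rw [lam_syl hL hL.2 (by simp), if_pos rfl]; exact hL.prod_ne_zero

variable [Fintype X]

lemma eq_one_of_forall_mem_FF {u : FreeGroup X} (h : ∀ k, u ∈ FF X k) : u = 1 := by
  obtain ⟨L, hL, rfl⟩ := exists_syl u
  match L, hL with
  | [], _ => rfl
  | p :: L, hL =>
    exact absurd (mem_FF_iff_lam.1 (h (L.length + 2)) ((p :: L).map Prod.fst) (by simp) (by simp))
      (lam_syl_self hL)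

lemma eq_one_of_forall_mem_AA {y : MulAut (FreeGroup X)} (h : ∀ k, y ∈ AA X k) : y = 1 := by
  refine aut_ext fun i => ?_
  rw [MulAut.one_apply, ← mul_inv_eq_one]
  exact eq_one_of_forall_mem_FF fun k => FF_anti (Nat.le_succ k) (mem_AA_iff.1 (h k) (of i))

/-- The sum of the Magnus coefficients over the rotations of a word. -/
noncomputable def tr (w : List X) (u : FreeGroup X) : ℤ :=
  ∑ k ∈ Finset.range w.length, lam (w.rotate k) u

omit [DecidableEq X] [Fintype X] in
lemma sum_range_rotate (w : List X) (F : List X → ℤ) (m : ℕ) :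
    ∑ k ∈ Finset.range w.length, F ((w.rotate k).rotate m) =
      ∑ k ∈ Finset.range w.length, F (w.rotate k) := by
  simp_rw [List.rotate_rotate]
  induction m with
  | zero => rfl
  | succ m ih =>
    rw [← ih]
    have h1 := Finset.sum_range_succ (fun k => F (w.rotate (k + m))) w.length
    have h2 := Finset.sum_range_succ' (fun k => F (w.rotate (k + m))) w.length
    have h3 : w.rotate (w.length + m) = w.rotate (0 + m) := by
      rw [zero_add, ← List.rotate_rotate, List.rotate_length]
    rw [h3] at h1
    have h4 : ∀ k, k + 1 + m = k + (m + 1) := fun k => by ring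
    simp_rw [h4] at h2
    linarith

lemma tr_mul_comm (w : List X) (g h : FreeGroup X) : tr w (g * h) = tr w (h * g) := by
  unfold tr
  simp_rw [lam_mul, List.length_rotate]
  rw [Finset.sum_comm]
  conv_rhs => rw [Finset.sum_comm, ← Finset.sum_range_reflect]
  refine Finset.sum_congr rfl fun m hm => ?_
  have hm : m ≤ w.length := by simp at hm; omega
  rw [← sum_range_rotate w (fun v => lam (v.take (w.length + 1 - 1 - m)) h *
    lam (v.drop (w.length + 1 - 1 - m)) g) m]
  refine Finset.sum_congr rfl fun k _ => ?_
  have e : (w.rotate k).rotate m = (w.rotate k).drop m ++ (w.rotate k).take m :=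
    List.rotate_eq_drop_append_take (by simpa using hm)
  have e2 : w.length + 1 - 1 - m = ((w.rotate k).drop m).length := by simp
  rw [e, e2, List.take_left, List.drop_left, mul_comm]

lemma tr_conj (w : List X) (g u : FreeGroup X) : tr w (g * u * g⁻¹) = tr w u := by
  rw [tr_mul_comm, inv_mul_cancel_left]

/-- An element whose cyclic Magnus coefficients of degree at least two all vanish on cyclically
alternating words is conjugate to a power of a letter. -/
lemma exists_conj_eq_zpow [Nonempty X] {u : FreeGroup X}
    (h : ∀ w : List X, 2 ≤ w.length → (∀ k, (w.rotate k).IsChain (· ≠ ·)) → tr w u = 0) :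
    ∃ (i : X) (m : ℤ) (g : FreeGroup X), u = g * of i ^ m * g⁻¹ := by
  have hex : ∃ n, ∃ L g, Syl L ∧ u = g * syl L * g⁻¹ ∧ L.length = n := by
    obtain ⟨L, hL, rfl⟩ := exists_syl u
    exact ⟨_, L, 1, hL, by simp, rfl⟩
  classical
  obtain ⟨L, g, hL, hu, hn⟩ := Nat.find_spec hex
  have hmin : ∀ L' g', Syl L' → u = g' * syl L' * g'⁻¹ → L.length ≤ L'.length := by
    intro L' g' h1 h2
    rw [hn]
    exact Nat.find_min' hex ⟨L', g', h1, h2, rfl⟩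
  match L, hL, hu, hmin with
  | [], _, hu, _ => exact ⟨Classical.arbitrary X, 0, g, by simpa using hu⟩
  | [p], _, hu, _ => exact ⟨p.1, p.2, g, by simpa using hu⟩
  | p :: q :: M, hL, hu, hmin =>
    exfalso
    set L := p :: q :: M with hLdef
    have hlast : (L.getLast (by simp [hLdef])).1 ≠ p.1 := by
      intro hl
      obtain ⟨K, r, hK⟩ : ∃ K r, q :: M = K ++ [r] :=
        ⟨_, _, (List.dropLast_append_getLast (by simp)).symm⟩
      have hr : r.1 = p.1 := by
        rw [← hl]; simp [hLdef, hK]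
      have hK2 : Syl K := by
        have := hL.tail
        rw [hK] at this
        refine ⟨fun p hp => this.1 p (by simp [hp]), ?_⟩
        have h2 := this.2
        rw [List.map_append] at h2
        exact h2.left_of_append
      obtain ⟨L', hL', e, hlen⟩ := exists_syl_zpow_mul hK2 p.1 (r.2 + p.2)
      have := hmin L' (g * of p.1 ^ (-r.2)) hL' (by
        rw [hu, e, hLdef, syl_cons, hK, syl_append, syl_cons, syl_nil, hr, zpow_add]; group)
      have h3 := congrArg List.length hK
      simp [hLdef] at this h3
      omega
    set w := L.map Prod.fst with hw
    have hrot : ∀ k, (w.rotate k).IsChain (· ≠ ·) := by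
      intro k
      rw [← List.rotate_mod, List.rotate_eq_drop_append_take
        (Nat.mod_lt _ (by simp [hw, hLdef])).le]
      refine List.IsChain.append (hL.2.drop _) (hL.2.take _) ?_
      intro a ha b hb
      have ha' : a = w.getLast (by simp [hw, hLdef]) := by
        rw [List.getLast?_drop] at ha
        split_ifs at ha with h0
        · simp at ha
        · rw [List.getLast?_eq_getLast_of_ne_nil (by simp [hw, hLdef])] at ha
          simpa using ha.symm
      have hb' : b = p.1 := by
        rw [List.head?_take] at hb
        split_ifs at hb with h0
        · simp at hb
        · simpa [hw, hLdef] using hb.symm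
      rw [ha', hb']
      simp only [hw, List.getLast_map]
      exact hlast
    have h0 := h w (by simp [hw, hLdef]) hrot
    rw [hu, tr_conj, tr] at h0
    have h1 : ∀ k ∈ Finset.range w.length, lam (w.rotate k) (syl L) =
        if w.rotate k = w then (L.map Prod.snd).prod else 0 :=
      fun k _ => lam_syl hL (hrot k) (by simp [hw])
    rw [Finset.sum_congr rfl h1, ← Finset.sum_filter, Finset.sum_const, smul_eq_zero] at h0
    rcases h0 with h0 | h0
    · rw [Finset.card_eq_zero] at h0
      have : 0 ∈ (Finset.range w.length).filter (fun k => w.rotate k = w) := by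
        simp [hw, hLdef]
      rw [h0] at this
      simp at this
    · exact hL.prod_ne_zero h0

end FreeAut

namespace FreeAut

open FreeGroup (of of_ne_one)
open MulAut (conj)

variable {X : Type*} [DecidableEq X] [Fintype X]

/-- The exponent sum vector. -/
noncomputable def lamV (u : FreeGroup X) : X → ℚ := fun i => lam [i] u

omit [Fintype X] in
lemma lamV_one : lamV (1 : FreeGroup X) = 0 := by ext i; simp [lamV, lam_one]

lemma lamV_mul (u v : FreeGroup X) : lamV (u * v) = lamV u + lamV v := by
  ext i; simp [lamV, lam_singleton_mul]

lemma lamV_inv (u : FreeGroup X) : lamV u⁻¹ = -lamV u := by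
  ext i; simp [lamV, lam_singleton_inv]

omit [Fintype X] in
lemma lamV_of (j : X) : lamV (of j) = Pi.single j 1 := by
  ext i; simp [lamV, Pi.single_apply]

lemma lamV_eq_iff {u v : FreeGroup X} : lamV u = lamV v ↔ u * v⁻¹ ∈ FF X 2 := by
  rw [mem_FF_two, funext_iff]
  refine forall_congr' fun i => ?_
  rw [lam_singleton_mul, lam_singleton_inv, lamV, lamV, ← sub_eq_add_neg, sub_eq_zero]
  exact Int.cast_inj

lemma toLin_lamV (y : MulAut (FreeGroup X)) (u : FreeGroup X) :
    Matrix.toLin' (Matrix.of fun i j => (lam [i] (y (of j)) : ℚ)) (lamV u) = lamV (y u) := by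
  have hof (j : X) : Matrix.toLin' (Matrix.of fun i j => (lam [i] (y (of j)) : ℚ))
      (lamV (of j)) = lamV (y (of j)) := by
    rw [lamV_of, Matrix.toLin'_apply, Matrix.mulVec_single_one]
    rfl
  induction u using FreeGroup.induction_on with
  | C1 => rw [map_one, lamV_one, map_zero]
  | of j => exact hof j
  | inv_of j _ => rw [map_inv, lamV_inv, lamV_inv, map_neg, ← hof]
  | mul u v hu hv => rw [map_mul, lamV_mul, lamV_mul, map_add, hu, hv]

/-- The action of an automorphism on the rational abelianization. -/
noncomputable def ab : MulAut (FreeGroup X) →* Module.End ℚ (X → ℚ) where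
  toFun y := Matrix.toLin' (Matrix.of fun i j => (lam [i] (y (of j)) : ℚ))
  map_one' := by
    refine LinearMap.pi_ext' fun j => LinearMap.ext_ring ?_
    rw [LinearMap.comp_apply, LinearMap.comp_apply, LinearMap.single_apply, ← lamV_of]
    exact toLin_lamV 1 (of j)
  map_mul' y z := by
    refine LinearMap.pi_ext' fun j => LinearMap.ext_ring ?_
    rw [LinearMap.comp_apply, LinearMap.comp_apply, LinearMap.single_apply, ← lamV_of,
      Module.End.mul_apply, toLin_lamV z, toLin_lamV y]
    exact toLin_lamV (y * z) (of j)

lemma ab_lamV (y : MulAut (FreeGroup X)) (u : FreeGroup X) : ab y (lamV u) = lamV (y u) :=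
  toLin_lamV y u

lemma mem_AA_one_of_ab {y : MulAut (FreeGroup X)} (h : ab y = 1) : y ∈ AA X 1 := by
  rw [mem_AA_iff]
  intro u
  rw [one_add_one_eq_two, ← lamV_eq_iff, ← ab_lamV, h, Module.End.one_apply]

lemma hom_eq_prod {A : Type*} [CommGroup A] (φ : FreeGroup X →* A) (u : FreeGroup X) :
    φ u = ∏ i, φ (of i) ^ lam [i] u := by
  induction u using FreeGroup.induction_on with
  | C1 => simp [lam_one]
  | of j => simp
  | inv_of j _ => simp [lam_singleton_inv]
  | mul u v hu hv => simp [lam_singleton_mul, zpow_add, Finset.prod_mul_distrib, ← hu, ← hv]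

lemma mem_of_mem_FF_two {N : Subgroup (FreeGroup X)} (hN : ∀ u v, u * v * (v * u)⁻¹ ∈ N)
    {u : FreeGroup X} (hu : u ∈ FF X 2) : u ∈ N := by
  have h1 : u ∈ commutator (FreeGroup X) := by
    rw [← Abelianization.ker_of, MonoidHom.mem_ker, hom_eq_prod]
    exact Finset.prod_eq_one fun i _ => by rw [mem_FF_two.1 hu i, zpow_zero]
  refine (show commutator (FreeGroup X) ≤ N from ?_) h1
  rw [commutator_def, Subgroup.commutator_le]
  intro a _ b _
  have := hN a b
  rwa [mul_inv_rev, ← mul_assoc] at this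

lemma coef_map_mul_sub {k : ℕ} (hk : 1 ≤ k) {y z : MulAut (FreeGroup X)} (hy : y ∈ AA X k)
    (hz : z ∈ AA X k) (u : FreeGroup X) {w : List X} (hw : w.length ≤ k + 1) :
    coef w (el ((y * z) u) - el u) = coef w (el (y u) - el u) + coef w (el (z u) - el u) := by
  have h1 := J.lin_sub (y := y.toMonoidHom) hy (hz u)
  rw [map_sub, lin_el, lin_el] at h1
  have h2 := h1 w (by omega)
  simp only [MulEquiv.toMonoidHom_eq_coe, MonoidHom.coe_coe, map_sub] at h2
  simp only [MulAut.mul_apply, map_sub]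
  linarith

lemma coef_map_pow_sub {k : ℕ} (hk : 1 ≤ k) {y : MulAut (FreeGroup X)} (hy : y ∈ AA X k)
    (n : ℕ) (u : FreeGroup X) {w : List X} (hw : w.length ≤ k + 1) :
    coef w (el ((y ^ n) u) - el u) = n * coef w (el (y u) - el u) := by
  induction n with
  | zero => simp
  | succ n ih =>
    rw [pow_succ, coef_map_mul_sub hk (pow_mem hy n) hy u hw, ih]
    push_cast; ring

lemma mem_AA_succ_of_pow {k n : ℕ} (hk : 1 ≤ k) (hn : n ≠ 0) {y : MulAut (FreeGroup X)}
    (hy : y ∈ AA X k) (h : y ^ n ∈ AA X (k + 1)) : y ∈ AA X (k + 1) := by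
  intro u w hw
  have h1 := h u w hw
  rw [coef_map_pow_sub hk hy n u (by omega)] at h1
  simpa [hn] using h1

variable (f : MulAut (MulAut (FreeGroup X)))

omit [DecidableEq X] [Fintype X] in
lemma map_conj_aut (α : MulAut (FreeGroup X)) (v : FreeGroup X) :
    f (conj (α v)) = f α * f (conj v) * (f α)⁻¹ := by
  rw [← conj_apply_aut, map_mul, map_mul, map_inv]

omit [DecidableEq X] [Fintype X] in
lemma map_conj_symm (α : MulAut (FreeGroup X)) (v : FreeGroup X) :
    f (conj (f.symm α v)) = α * f (conj v) * α⁻¹ := by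
  rw [map_conj_aut, MulEquiv.apply_symm_apply]

lemma map_conj_mem_AA_one (u : FreeGroup X) : f (conj u) ∈ AA X 1 := by
  have h := rep_conj_eq_one (V := X → ℚ) (by simp) (ab.comp f.toMonoidHom) u
  rw [MonoidHom.comp_apply] at h
  exact mem_AA_one_of_ab h

lemma map_conj_mem_AA_of_mem_FF_two {k : ℕ} (h : ∀ u, f (conj u) ∈ AA X k) {v : FreeGroup X}
    (hv : v ∈ FF X 2) : f (conj v) ∈ AA X (k + k) := by
  refine mem_of_mem_FF_two (N := (AA X (k + k)).comap (f.toMonoidHom.comp conj)) (fun u v => ?_) hv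
  rw [Subgroup.mem_comap, map_mul, map_mul, map_inv, map_mul]
  exact commutator_mem_AA (h u) (h v)

lemma mem_FF_two_of_map_conj [Nontrivial X] {k : ℕ} (hk : 1 ≤ k) (h : ∀ u, f (conj u) ∈ AA X k)
    (hex : ∃ u, f (conj u) ∉ AA X (k + 1)) {v : FreeGroup X} (hv : f (conj v) ∈ AA X (k + 1)) :
    v ∈ FF X 2 := by
  by_contra hv2
  let W : Subgroup (FreeGroup X) := (AA X (k + 1)).comap (f.toMonoidHom.comp conj)
  have hW {u : FreeGroup X} : u ∈ W ↔ f (conj u) ∈ AA X (k + 1) := Iff.rfl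
  have hchar (α : MulAut (FreeGroup X)) {u : FreeGroup X} (hu : u ∈ W) : α u ∈ W := by
    rw [hW, map_conj_aut]; exact (AA_normal _).conj_mem _ hu _
  have hF {u : FreeGroup X} (hu : u ∈ FF X 2) : u ∈ W :=
    AA_anti (by omega) (map_conj_mem_AA_of_mem_FF_two f h hu)
  obtain ⟨i, hi⟩ : ∃ i, lam [i] v ≠ 0 := by
    by_contra! h0; exact hv2 (mem_FF_two.2 h0)
  obtain ⟨j, hj⟩ := exists_ne i
  have h1 : trv hj v * v⁻¹ ∈ W := mul_mem (hchar _ hv) (inv_mem hv)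
  have h2 : lamV (trv hj v * v⁻¹) = lamV (of j ^ lam [i] v) := by
    rw [lamV_mul, lamV_inv, ← ab_lamV]
    have h3 : lamV v = ∑ k, (lam [k] v : ℚ) • lamV (of k) := by
      ext k
      simp [lamV]
    have h4 (k : X) : ab (trv hj) (lamV (of k)) =
        lamV (of k) + if k = i then lamV (of j) else 0 := by
      rw [ab_lamV]
      rcases eq_or_ne k i with rfl | hk
      · rw [trv_self, lamV_mul, if_pos rfl]
      · rw [trv_of_ne _ hk, if_neg hk, add_zero]
    have h5 : lamV (of j ^ lam [i] v) = (lam [i] v : ℚ) • lamV (of j) := by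
      ext k; simp [lamV, lam_singleton_zpow]
    rw [h5]
    nth_rewrite 1 [h3]
    rw [map_sum]
    simp only [map_smul, h4, smul_add, Finset.sum_add_distrib, ← h3]
    simp
  have h3 : of j ^ lam [i] v ∈ W := by
    have := mul_mem (inv_mem (hF (lamV_eq_iff.1 h2))) h1
    rwa [mul_inv_rev, inv_inv, inv_mul_cancel_right] at this
  have h4 : of j ∈ W := by
    rw [hW]
    refine mem_AA_succ_of_pow (n := (lam [i] v).natAbs) hk (by simpa using hi) (h _) ?_
    rw [← map_pow, ← map_pow, ← hW]
    rw [← zpow_natCast]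
    rcases Int.natAbs_eq (lam [i] v) with e | e
    · rwa [← e]
    · rw [← neg_eq_iff_eq_neg] at e
      rwa [← e, zpow_neg, inv_mem_iff]
  obtain ⟨u, hu⟩ := hex
  refine hu (?_ : u ∈ W)
  have hall (l : X) : of l ∈ W := by
    have := hchar (FreeGroup.freeGroupCongr (Equiv.swap j l) : MulAut (FreeGroup X)) h4
    simpa using this
  clear hu
  induction u using FreeGroup.induction_on with
  | C1 => exact one_mem _
  | of l => exact hall l
  | inv_of l _ => exact inv_mem (hall l)
  | mul u v hu hv => exact mul_mem hu hv

omit [DecidableEq X] [Fintype X] in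
/-- The commutator of an inner automorphism with an element of the image of the inner
automorphisms, seen in both groups. -/
lemma conj_map_mul_inv (u v : FreeGroup X) :
    conj (f (conj v) u * u⁻¹) = f (conj (v * (f.symm (conj u) v)⁻¹)) := by
  rw [map_mul, ← conj_apply_aut, map_mul conj v, map_mul, map_inv, map_inv, map_inv, map_conj_symm]
  group

theorem map_conj_mem_AA_two_iff [Nontrivial X] {v : FreeGroup X} :
    f (conj v) ∈ AA X 2 ↔ v ∈ FF X 2 := by
  refine ⟨fun hv => ?_, map_conj_mem_AA_of_mem_FF_two f (map_conj_mem_AA_one f)⟩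
  obtain ⟨k, hk, h, hex⟩ : ∃ k, 1 ≤ k ∧ (∀ u, f (conj u) ∈ AA X k) ∧
      ∃ u, f (conj u) ∉ AA X (k + 1) := by
    by_contra! hne
    have hall (k : ℕ) : ∀ u, f (conj u) ∈ AA X (k + 1) := by
      induction k with
      | zero => exact map_conj_mem_AA_one f
      | succ k ih => exact hne (k + 1) (by omega) ih
    obtain ⟨a, b, hab⟩ := exists_pair_ne X
    have h1 : f (conj (of a)) = 1 :=
      eq_one_of_forall_mem_AA fun k => AA_anti (Nat.le_succ k) (hall k _)
    rw [EmbeddingLike.map_eq_one_iff, ← map_one conj] at h1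
    exact of_ne_one a (conj_injective_aut hab h1)
  obtain rfl : k = 1 := by
    by_contra hk1
    obtain ⟨u, hu⟩ := hex
    refine hu (mem_AA_of_gen fun i => ?_)
    rw [← mul_inv_mem_FF]
    have h1 := mem_AA_iff.1 (h u) (of i)
    have h2 := conj_mem_AA h1
    rw [conj_map_mul_inv] at h2
    have h3 := map_conj_mem_AA_of_mem_FF_two f h (mem_FF_two_of_map_conj f hk h ⟨u, hu⟩ h2)
    rw [← conj_map_mul_inv] at h3
    exact FF_anti (by omega) (mem_FF_of_conj_mem_AA h3)
  exact mem_FF_two_of_map_conj f le_rfl h hex hv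

end FreeAut

namespace FreeAut

open FreeGroup (of of_ne_one)
open MulAut (conj)

variable {X : Type*} [DecidableEq X] [Fintype X]

section weights

variable {V : Type*} [AddCommGroup V] [Module ℚ V] [FiniteDimensional ℚ V]
  {ρ : MulAut (FreeGroup X) →* Module.End ℚ V}

lemma rep_tau_of_isWeight (hV : Module.finrank ℚ V ≤ Fintype.card X) {S : Finset X} {v : V}
    (hv : IsWeight ρ S v) (h0 : v ≠ 0) {i j k : X} (hij : j ≠ i) (hS : i ∈ S ↔ j ∈ S)
    (hk : k ∈ S) (hki : k ≠ i) (hkj : k ≠ j) {w : V}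
    (hw : ∀ t, t ≠ i → t ≠ j → ρ (tau t 1) w = (if t ∈ S then -1 else 1 : ℚ) • w) :
    ρ (tau j 1) w = (if j ∈ S then -1 else 1 : ℚ) • w := by
  set χ : ℚ := if j ∈ S then -1 else 1 with hχ
  have hχ2 : χ * χ = 1 := by rw [hχ]; split_ifs <;> norm_num
  have none {S' : Finset X} {w' : V} (hS' : ∀ t, t ≠ i → t ≠ j → (t ∈ S' ↔ t ∈ S))
      (hj : j ∈ S' ↔ j ∉ S) (hw' : IsWeight ρ S' w') : w' = 0 := by
    by_contra h0'
    by_cases hjS : j ∈ S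
    · have hsub : S' ⊂ S := by
        refine (Finset.ssubset_iff_of_subset fun t ht => ?_).2 ⟨j, hjS, by tauto⟩
        by_cases h1 : t = i
        · subst h1; tauto
        by_cases h2 : t = j
        · subst h2; tauto
        · exact (hS' t h1 h2).1 ht
      have h1 := Finset.card_lt_card hsub
      have h2 := Finset.card_pos.2 ⟨k, (hS' k hki hkj).2 hk⟩
      have h3 := Finset.card_le_univ S
      exact h1.ne (card_eq_of_isWeight hV hw' h0' hv h0 h2 (by omega))
    · have hsub : S ⊂ S' := by
        refine (Finset.ssubset_iff_of_subset fun t ht => ?_).2 ⟨j, by tauto, hjS⟩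
        by_cases h1 : t = i
        · subst h1; tauto
        by_cases h2 : t = j
        · subst h2; tauto
        · exact (hS' t h1 h2).2 ht
      have h1 := Finset.card_lt_card hsub
      have h2 := Finset.card_pos.2 ⟨k, hk⟩
      have h3 := Finset.card_le_univ S'
      exact h1.ne (card_eq_of_isWeight hV hv h0 hw' h0' h2 (by omega))
  set w' := w - χ • ρ (tau j 1) w with hw'
  have h1 : ρ (tau j 1) w' = - χ • w' := by
    rw [hw', map_sub, map_smul, rep_tau_tau, smul_sub, smul_smul, neg_mul, hχ2]
    module
  have hwt (t : X) (hi : t ≠ i) (hj : t ≠ j) :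
      ρ (tau t 1) w' = (if t ∈ S then -1 else 1 : ℚ) • w' := by
    rw [hw', map_sub, map_smul, rep_tau_comm, hw t hi hj, map_smul, smul_comm χ, smul_sub]
  have key (ε : ℚ) (hε : ε = 1 ∨ ε = -1) : w' + ε • ρ (tau i 1) w' = 0 := by
    have hε2 : ε * ε = 1 := by rcases hε with rfl | rfl <;> norm_num
    have a1 : ρ (tau i 1) (w' + ε • ρ (tau i 1) w') = ε • (w' + ε • ρ (tau i 1) w') := by
      rw [map_add, map_smul, rep_tau_tau, smul_add, smul_smul, hε2]; module
    have a2 : ρ (tau j 1) (w' + ε • ρ (tau i 1) w') = (-χ) • (w' + ε • ρ (tau i 1) w') := by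
      rw [map_add, map_smul, rep_tau_comm, h1, map_smul]; module
    refine none (S' := ((S.erase i).erase j ∪ (if ε = -1 then {i} else ∅)) ∪
      (if j ∈ S then ∅ else {j})) (fun t hi hj => ?_) ?_ (fun t => ?_)
    · split_ifs <;> simp [hi, hj]
    · by_cases h : j ∈ S <;> split_ifs <;> simp [h, hij]
    · by_cases hi : t = i
      · subst hi
        rw [a1]
        congr 1
        rcases hε with rfl | rfl <;> by_cases h : j ∈ S <;>
          simp [h, hij.symm, (by norm_num : (1 : ℚ) ≠ -1)]
      by_cases hj : t = j
      · subst hj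
        rw [a2]
        congr 1
        rcases hε with rfl | rfl <;> by_cases h : t ∈ S <;>
          simp [hχ, h, hij, (by norm_num : (1 : ℚ) ≠ -1)]
      · rw [map_add, map_smul, rep_tau_comm, hwt t hi hj, map_smul, smul_comm ε, ← smul_add]
        congr 1
        have : t ∈ ((S.erase i).erase j ∪ (if ε = -1 then {i} else ∅)) ∪
            (if j ∈ S then ∅ else {j}) ↔ t ∈ S := by
          split_ifs <;> simp [hi, hj]
        simp only [this]
  have : w' = 0 := by
    have e : w' = (1 / 2 : ℚ) • ((w' + (1 : ℚ) • ρ (tau i 1) w') + (w' + (-1 : ℚ) • ρ (tau i 1) w'))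
      := by module
    rw [e, key 1 (by simp), key (-1) (by simp)]; simp
  rw [hw', sub_eq_zero] at this
  nth_rewrite 2 [this]
  rw [smul_smul, hχ2, one_smul]

lemma rep_trv_eq_inv (hV : Module.finrank ℚ V ≤ Fintype.card X) {S : Finset X} {v : V}
    (hv : IsWeight ρ S v) {i j k : X} (hij : j ≠ i) (hS : i ∈ S ↔ j ∈ S)
    (hk : k ∈ S) (hki : k ≠ i) (hkj : k ≠ j) : ρ (trv hij) v = ρ (trv hij)⁻¹ v := by
  rcases eq_or_ne v 0 with rfl | h0
  · rw [map_zero, map_zero]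
  have h1 := rep_tau_of_isWeight hV hv h0 hij hS hk hki hkj (w := ρ (trv hij) v)
    (fun t hi hj => by
      rw [← Module.End.mul_apply, ← map_mul, ← trv_mul_tau hij hi hj, map_mul,
        Module.End.mul_apply, hv t, map_smul])
  rw [← tau_mul_trv_mul_tau, map_mul, map_mul, Module.End.mul_apply, Module.End.mul_apply, hv j,
    map_smul, map_smul, h1, smul_smul]
  split_ifs <;> simp

end weights

lemma coef_nil_lin (y : FreeGroup X →* FreeGroup X) (z : ZF X) : coef [] (lin y z) = coef [] z := by
  have h : J 1 (z - coef [] z • 1) := fun w hw => by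
    obtain rfl : w = [] := List.length_eq_zero_iff.1 (by omega)
    rw [map_sub, map_smul, coef_nil_one, smul_eq_mul, mul_one, sub_self]
  have h1 := h.lin y [] (by simp)
  rw [map_sub, map_smul, map_one, map_sub, map_smul, coef_nil_one] at h1
  simpa [sub_eq_zero] using h1

omit [Fintype X] in
lemma coef_singleton_el_sub_one (i j : X) :
    coef [j] (el (of i) - 1 : ZF X) = if j = i then 1 else 0 := by
  have h := lam_cons_of i j []
  rw [lam] at h
  rw [map_sub, h, coef_one]
  simp

/-- The Fox derivatives compute the coefficients. -/
lemma coef_cons_eq {k : ℕ} {d : X → ZF X} (hd : ∀ i, J k (d i)) (j : X) {w : List X}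
    (hw : w.length = k) : coef (j :: w) (∑ i, (el (of i) - 1) * d i) = coef w (d j) := by
  rw [map_sum]
  have (i : X) : coef (j :: w) ((el (of i) - 1) * d i) = if j = i then coef w (d i) else 0 := by
    rw [← List.singleton_append, coef_append_mul (J_one_el_sub_one _) (hd i) rfl hw,
      coef_singleton_el_sub_one, ite_mul, one_mul, zero_mul]
  simp [this]

lemma coef_cons_lin {k : ℕ} {d : X → ZF X} (hd : ∀ i, J k (d i)) (α : MulAut (FreeGroup X)) (j : X)
    {w : List X} (hw : w.length = k) :
    coef (j :: w) (lin α.toMonoidHom (∑ i, (el (of i) - 1) * d i)) =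
      ∑ p, lam [j] (α (of p)) * coef w (lin α.toMonoidHom (d p)) := by
  rw [map_sum, map_sum]
  refine Finset.sum_congr rfl fun p _ => ?_
  rw [map_mul, map_sub, map_one, lin_el, ← List.singleton_append,
    coef_append_mul (J_one_el_sub_one _) ((hd p).lin _) rfl hw, map_sub, coef_one]
  simp [lam]

lemma coef_singleton_lin (α : MulAut (FreeGroup X)) {z : ZF X} (hz : J 1 z) (l : X) :
    coef [l] (lin α.toMonoidHom z) = ∑ q, lam [l] (α (of q)) * coef [q] z := by
  obtain ⟨d, hJ, hd⟩ := exists_fox_of_J hz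
  rw [hd, coef_cons_lin hJ α l rfl]
  simp_rw [coef_nil_lin, coef_cons_eq hJ _ (w := []) rfl]

lemma coef_pair_lin (α : MulAut (FreeGroup X)) {z : ZF X} (hz : J 2 z) (j l : X) :
    coef [j, l] (lin α.toMonoidHom z) =
      ∑ p, ∑ q, lam [j] (α (of p)) * lam [l] (α (of q)) * coef [p, q] z := by
  obtain ⟨d, hJ, hd⟩ := exists_fox_of_J hz
  rw [hd, coef_cons_lin hJ α j rfl]
  simp_rw [coef_singleton_lin α (hJ _), coef_cons_eq hJ _ (w := [_]) rfl, Finset.mul_sum, mul_assoc]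

lemma coef_pair_map_sub {y : MulAut (FreeGroup X)} (hy : y ∈ AA X 1) (p q : X) (u : FreeGroup X) :
    coef [p, q] (el (y u) - el u) = ∑ k, lam [k] u * lam [p, q] (y (of k)) := by
  have hmul (u v : FreeGroup X) : coef [p, q] (el (y (u * v)) - el (u * v)) =
      coef [p, q] (el (y u) - el u) + coef [p, q] (el (y v) - el v) := by
    have h : el (y (u * v)) - el (u * v) =
        (el (y u) - el u) * el (y v) + el u * (el (y v) - el v) := by
      rw [map_mul, map_mul, map_mul]; noncomm_ring
    have h1 := coef_append_mul (hy u) (J_zero (el (y v))) (v := [p, q]) (w := []) rfl rfl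
    have h2 := coef_append_mul (J_zero (el u)) (hy v) (v := []) (w := [p, q]) rfl rfl
    simp only [List.append_nil, List.nil_append, coef_nil_el, mul_one, one_mul] at h1 h2
    rw [h, map_add, h1, h2]
  have hof (i : X) : coef [p, q] (el (y (of i)) - el (of i)) = lam [p, q] (y (of i)) := by
    have h := lam_cons_of i p [q]
    rw [lam] at h
    rw [map_sub, h]
    simp [lam]
  have hone : coef [p, q] (el (y 1) - el 1) = 0 := by simp
  induction u using FreeGroup.induction_on with
  | C1 => simp [lam_one]
  | of i => simp [hof]
  | inv_of i h =>
    have h2 := hmul (of i)⁻¹ (of i)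
    rw [inv_mul_cancel, hone] at h2
    simp_rw [lam_singleton_inv, neg_mul, Finset.sum_neg_distrib]
    rw [← h]
    omega
  | mul u v hu hv =>
    rw [hmul, hu, hv, ← Finset.sum_add_distrib]
    simp_rw [lam_singleton_mul, add_mul]

/-- The change of coordinates formula for the second Johnson homomorphism. -/
lemma lam_pair_conj {y : MulAut (FreeGroup X)} (hy : y ∈ AA X 1) (α : MulAut (FreeGroup X))
    (i j l : X) : lam [j, l] ((α * y * α⁻¹) (of i)) = ∑ p, ∑ q,
      lam [j] (α (of p)) * lam [l] (α (of q)) *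
        ∑ k, lam [k] (α⁻¹ (of i)) * lam [p, q] (y (of k)) := by
  have h := coef_pair_lin α (hy (α⁻¹ (of i))) j l
  have h0 := lam_cons_of i j [l]
  rw [map_sub, lin_el, lin_el, map_sub] at h
  simp only [MulEquiv.toMonoidHom_eq_coe, MonoidHom.coe_coe] at h
  rw [MulAut.apply_inv_self] at h
  rw [lam] at h0
  rw [h0, if_neg (by simp), sub_zero] at h
  rw [lam, MulAut.mul_apply, MulAut.mul_apply, h]
  simp_rw [coef_pair_map_sub hy]

lemma lam_shuffle (j l : X) (u : FreeGroup X) :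
    lam [j, l] u + lam [l, j] u + (if j = l then lam [j] u else 0) = lam [j] u * lam [l] u := by
  induction u using FreeGroup.induction_on with
  | C1 => simp [lam_one]
  | of i => simp [lam_cons_of]; grind
  | inv_of i h =>
    have h1 := lam_pair_mul j l (of i) (of i)⁻¹
    have h2 := lam_pair_mul l j (of i) (of i)⁻¹
    rw [mul_inv_cancel, lam_one (by simp)] at h1 h2
    simp_rw [lam_singleton_inv] at *
    split_ifs at * <;> linarith
  | mul u v hu hv =>
    simp_rw [lam_pair_mul, lam_singleton_mul]
    split_ifs at * <;> linarith

lemma lam_pair_antisymm {y : MulAut (FreeGroup X)} (hy : y ∈ AA X 1) (i j l : X) :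
    lam [j, l] (y (of i)) = -lam [l, j] (y (of i)) := by
  have he := mem_FF_two.1 (mem_AA_iff.1 hy (of i))
  have h (j l : X) : lam [j, l] (y (of i)) = lam [j, l] (y (of i) * (of i)⁻¹) := by
    have := lam_pair_mul j l (y (of i) * (of i)⁻¹) (of i)
    rw [inv_mul_cancel_right, he] at this
    simpa [lam_cons_of] using this
  have h1 := lam_shuffle j l (y (of i) * (of i)⁻¹)
  rw [← h, ← h, he, he] at h1
  simp at h1
  linarith

lemma lam_pair_conj_of (g : FreeGroup X) (i j l : X) : lam [j, l] (conj g (of i)) =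
    (if l = i then lam [j] g else 0) - (if j = i then lam [l] g else 0) := by
  have h := lam_pair_mul j l g g⁻¹
  rw [mul_inv_cancel, lam_one (by simp), lam_singleton_inv] at h
  rw [MulAut.conj_apply, lam_pair_mul, lam_pair_mul, lam_singleton_mul, lam_singleton_inv]
  simp only [lam_cons_of]
  have h' : lam [j, l] g⁻¹ = lam [j] g * lam [l] g - lam [j, l] g := by linarith
  rw [h']
  split_ifs <;> simp_all <;> ring

lemma exists_lam_eq (z : X → ℤ) : ∃ g : FreeGroup X, ∀ j, lam [j] g = z j := by
  have h (s : Finset X) : ∃ g : FreeGroup X, ∀ j, lam [j] g = if j ∈ s then z j else 0 := by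
    induction s using Finset.induction_on with
    | empty => exact ⟨1, fun j => by simp [lam_one]⟩
    | insert a s ha ih =>
      obtain ⟨g, hg⟩ := ih
      refine ⟨g * of a ^ z a, fun j => ?_⟩
      rw [lam_singleton_mul, lam_singleton_zpow, hg, lam_singleton_of]
      by_cases h : j = a
      · subst h; simp [ha]
      · simp [h]
  obtain ⟨g, hg⟩ := h Finset.univ
  exact ⟨g, fun j => by simpa using hg j⟩

lemma mul_mem_AA_two {y z : MulAut (FreeGroup X)} (hy : y ∈ AA X 1) (hz : z ∈ AA X 1)
    (h : ∀ i j l, lam [j, l] (y (of i)) = lam [j, l] (z (of i))) : z⁻¹ * y ∈ AA X 2 := by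
  refine mem_AA_of_gen fun i w hw => ?_
  rcases Nat.lt_or_ge w.length 2 with h2 | h2
  · exact mul_mem (inv_mem hz) hy (of i) w h2
  obtain ⟨j, l, rfl⟩ := List.length_eq_two.1 (show w.length = 2 by omega)
  have h3 := coef_map_mul_sub le_rfl (inv_mem hz) hz (of i) (w := [j, l]) (by simp)
  rw [inv_mul_cancel, MulAut.one_apply, sub_self, map_zero] at h3
  rw [coef_map_mul_sub le_rfl (inv_mem hz) hy (of i) (by simp)]
  have := h i j l
  simp only [lam] at this
  rw [map_sub, map_sub] at h3 ⊢
  linarith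

end FreeAut

namespace FreeAut

open FreeGroup (of of_ne_one)
open MulAut (conj)

variable {X : Type*} [DecidableEq X] [Fintype X] (f : MulAut (MulAut (FreeGroup X)))

/-- The linear extension of the second Johnson homomorphism on the images of the inner
automorphisms. -/
noncomputable def tens (i j l : X) : (X → ℚ) →ₗ[ℚ] ℚ :=
  ∑ a, (lam [j, l] (f (conj (of a)) (of i)) : ℚ) • LinearMap.proj a

lemma tens_lamV (i j l : X) (v : FreeGroup X) :
    tens f i j l (lamV v) = lam [j, l] (f (conj v) (of i)) := by
  have hmul (u v : FreeGroup X) : lam [j, l] (f (conj (u * v)) (of i)) =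
      lam [j, l] (f (conj u) (of i)) + lam [j, l] (f (conj v) (of i)) := by
    have h := coef_map_mul_sub le_rfl (map_conj_mem_AA_one f u) (map_conj_mem_AA_one f v) (of i)
      (w := [j, l]) (by simp)
    have h0 := lam_cons_of i j [l]
    rw [if_neg (by simp), lam] at h0
    simpa [lam, h0] using h
  have hone : lam [j, l] (f (conj 1) (of i)) = 0 := by
    have := hmul 1 1
    rw [mul_one] at this
    omega
  induction v using FreeGroup.induction_on with
  | C1 => rw [hone, lamV_one, map_zero, Int.cast_zero]
  | of a =>
    rw [lamV_of, tens, LinearMap.sum_apply, Finset.sum_eq_single a]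
    · simp
    · intro b _ hb; simp [hb]
    · simp
  | inv_of a h =>
    have h2 := hmul (of a) (of a)⁻¹
    rw [mul_inv_cancel, hone] at h2
    rw [lamV_inv, map_neg, h, neg_eq_iff_add_eq_zero]
    exact_mod_cast h2.symm
  | mul u v hu hv => rw [lamV_mul, map_add, hu, hv, hmul, Int.cast_add]

omit f [Fintype X] in
lemma linearMap_ext_lamV [Finite X] {M N : (X → ℚ) →ₗ[ℚ] ℚ}
    (h : ∀ a, M (lamV (of a)) = N (lamV (of a))) : M = N :=
  LinearMap.pi_ext' fun a => LinearMap.ext_ring (by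
    rw [LinearMap.comp_apply, LinearMap.comp_apply, LinearMap.single_apply, ← lamV_of]
    exact h a)

/-- The action on the rational abelianization, twisted by an automorphism. -/
noncomputable def twist : MulAut (FreeGroup X) →* Module.End ℚ (X → ℚ) :=
  ab.comp f.symm.toMonoidHom

lemma twist_lamV (α : MulAut (FreeGroup X)) (v : FreeGroup X) :
    twist f α (lamV v) = lamV (f.symm α v) := by
  rw [twist, MonoidHom.comp_apply, ab_lamV, MulEquiv.toMonoidHom_eq_coe, MonoidHom.coe_coe]

lemma tens_twist (α : MulAut (FreeGroup X)) (i j l : X) (v : X → ℚ) :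
    tens f i j l (twist f α v) = ∑ p, ∑ q, (lam [j] (α (of p)) : ℚ) * lam [l] (α (of q)) *
      ∑ k, (lam [k] (α⁻¹ (of i)) : ℚ) * tens f k p q v := by
  have h : (tens f i j l).comp (twist f α) = ∑ p, ∑ q,
      ((lam [j] (α (of p)) : ℚ) * lam [l] (α (of q))) •
        ∑ k, (lam [k] (α⁻¹ (of i)) : ℚ) • tens f k p q := by
    refine linearMap_ext_lamV fun a => ?_
    simp only [LinearMap.comp_apply, twist_lamV, tens_lamV, map_conj_symm,
      lam_pair_conj (map_conj_mem_AA_one f _), LinearMap.sum_apply, LinearMap.smul_apply]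
    push_cast
    rfl
  have := LinearMap.congr_fun h v
  simpa only [LinearMap.comp_apply, LinearMap.sum_apply, LinearMap.smul_apply, smul_eq_mul]
    using this

lemma tens_twist_tau (t i j l : X) (v : X → ℚ) : tens f i j l (twist f (tau t 1) v) =
    (if i = t then -1 else 1 : ℚ) * (if j = t then -1 else 1) * (if l = t then -1 else 1) *
      tens f i j l v := by
  obtain ⟨e, he⟩ : ∃ e : X → ℚ, ∀ i, e i = if i = t then -1 else 1 := ⟨_, fun _ => rfl⟩
  have h (j p : X) : (lam [j] (tau t 1 (of p)) : ℚ) = if j = p then e j else 0 := by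
    rw [he]
    rcases eq_or_ne p t with rfl | hp
    · rw [tau_one_self, lam_singleton_inv, lam_singleton_of]
      split_ifs <;> simp
    · rw [tau_of_ne _ hp, lam_singleton_of]
      split_ifs <;> simp_all
  have h2 : (tau t 1)⁻¹ = tau t 1 := by
    rw [inv_eq_iff_mul_eq_one, tau_mul_self]
  rw [tens_twist, h2, ← he, ← he, ← he]
  simp only [h, ite_mul, zero_mul, mul_ite, mul_zero, Finset.sum_ite_eq, Finset.sum_ite_eq',
    Finset.mem_univ, if_true]
  ring

lemma tens_twist_trv {r s : X} (hrs : s ≠ r) (i j l : X) (v : X → ℚ) :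
    tens f i j l (twist f (trv hrs) v) = ∑ p, ∑ q,
      ((if j = p then 1 else 0) + if p = r then (if j = s then 1 else 0) else 0) *
      ((if l = q then 1 else 0) + if q = r then (if l = s then 1 else 0) else 0) *
        (tens f i p q v - if i = r then tens f s p q v else 0) := by
  have h (j p : X) : (lam [j] (trv hrs (of p)) : ℚ) =
      (if j = p then 1 else 0) + if p = r then (if j = s then 1 else 0) else 0 := by
    rcases eq_or_ne p r with rfl | hp
    · rw [trv_self, lam_singleton_mul, lam_singleton_of, lam_singleton_of]
      simp
    · rw [trv_of_ne _ hp, lam_singleton_of]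
      simp [hp]
  have h' (k : X) : (lam [k] ((trv hrs)⁻¹ (of i)) : ℚ) =
      (if k = i then 1 else 0) - if k = s then (if i = r then 1 else 0) else 0 := by
    rcases eq_or_ne i r with rfl | hp
    · rw [trv_inv_self, lam_singleton_mul, lam_singleton_inv, lam_singleton_of,
        lam_singleton_of]
      simp [sub_eq_add_neg]
    · rw [trv_inv_of_ne _ hp, lam_singleton_of]
      simp [hp]
  rw [tens_twist]
  simp only [h, h', sub_mul, Finset.sum_sub_distrib, ite_mul, one_mul, zero_mul,
    Finset.sum_ite_eq', Finset.mem_univ, if_true]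

lemma tens_twist_trv_inv {r s : X} (hrs : s ≠ r) (i j l : X) (v : X → ℚ) :
    tens f i j l (twist f (trv hrs)⁻¹ v) = ∑ p, ∑ q,
      ((if j = p then 1 else 0) - if p = r then (if j = s then 1 else 0) else 0) *
      ((if l = q then 1 else 0) - if q = r then (if l = s then 1 else 0) else 0) *
        (tens f i p q v + if i = r then tens f s p q v else 0) := by
  have h (j p : X) : (lam [j] ((trv hrs)⁻¹ (of p)) : ℚ) =
      (if j = p then 1 else 0) - if p = r then (if j = s then 1 else 0) else 0 := by
    rcases eq_or_ne p r with rfl | hp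
    · rw [trv_inv_self, lam_singleton_mul, lam_singleton_inv, lam_singleton_of,
        lam_singleton_of]
      simp [sub_eq_add_neg]
    · rw [trv_inv_of_ne _ hp, lam_singleton_of]
      simp [hp]
  have h' (k : X) : (lam [k] ((trv hrs) (of i)) : ℚ) =
      (if k = i then 1 else 0) + if k = s then (if i = r then 1 else 0) else 0 := by
    rcases eq_or_ne i r with rfl | hp
    · rw [trv_self, lam_singleton_mul, lam_singleton_of, lam_singleton_of]
      simp
    · rw [trv_of_ne _ hp, lam_singleton_of]
      simp [hp]
  rw [tens_twist, inv_inv]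
  simp only [h, h', add_mul, Finset.sum_add_distrib, ite_mul, one_mul, zero_mul,
    Finset.sum_ite_eq', Finset.mem_univ, if_true]

lemma tens_eq_zero_of_isWeight {S : Finset X} {v : X → ℚ} (hv : IsWeight (twist f) S v)
    {i j l : X} (t : X) (ht : (if i = t then -1 else 1 : ℚ) * (if j = t then -1 else 1) *
      (if l = t then -1 else 1) = if t ∈ S then 1 else -1) : tens f i j l v = 0 := by
  have h := tens_twist_tau f t i j l v
  rw [hv t, map_smul, ht, smul_eq_mul] at h
  split_ifs at h <;> linarith

lemma tens_of_distinct {q r t : X} (hrq : r ≠ q) (htq : t ≠ q) (hrt : r ≠ t) (v : X → ℚ) :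
    tens f q r t v = 0 := by
  refine isWeight_induction (ρ := twist f) (p := fun v => tens f q r t v = 0)
    (fun u v hu hv => by rw [map_add, hu, hv, add_zero]) (fun S v hv => ?_) v
  by_cases hq : q ∈ S
  swap
  · exact tens_eq_zero_of_isWeight f hv q (by simp [hrq, htq, hq])
  by_cases hr : r ∈ S
  swap
  · exact tens_eq_zero_of_isWeight f hv r (by simp [hrq.symm, hrt.symm, hr])
  by_cases ht : t ∈ S
  swap
  · exact tens_eq_zero_of_isWeight f hv t (by simp [htq.symm, hrt, ht])
  have h := congrArg (tens f r r t) (rep_trv_eq_inv (by simp) hv (i := r) (j := q) (k := t)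
    hrq.symm (by tauto) ht hrt.symm htq)
  rw [tens_twist_trv, tens_twist_trv_inv] at h
  simp [hrq, htq] at h
  linarith

lemma tens_diag {i i' j : X} (hi : i ≠ j) (hi' : i' ≠ j) (v : X → ℚ) :
    tens f i j i v = tens f i' j i' v := by
  rcases eq_or_ne i i' with rfl | hii
  · rfl
  refine isWeight_induction (ρ := twist f) (p := fun v => tens f i j i v = tens f i' j i' v)
    (fun u v hu hv => by rw [map_add, map_add, hu, hv]) (fun S v hv => ?_) v
  by_cases hS : ∃ t, ¬ (t = j ↔ t ∈ S)
  · obtain ⟨t, ht⟩ := hS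
    rw [tens_eq_zero_of_isWeight f hv (i := i) t (by split_ifs <;> grind),
      tens_eq_zero_of_isWeight f hv (i := i') t (by split_ifs <;> grind)]
  push Not at hS
  have h := congrArg (tens f i j i') (rep_trv_eq_inv (by simp) hv (i := i) (j := i') (k := j)
    hii.symm (by simp [← hS, hi, hi']) ((hS j).1 rfl) hi.symm hi'.symm)
  rw [tens_twist_trv, tens_twist_trv_inv] at h
  simp [hi'.symm, add_mul, sub_mul, Finset.sum_add_distrib] at h
  linarith

/-- Modulo the next term of the Johnson filtration, the images of the inner automorphisms are
inner. -/
theorem exists_conj_inv_mul_mem_AA_two [Nontrivial X] (v : FreeGroup X) :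
    ∃ g, (conj g)⁻¹ * f (conj v) ∈ AA X 2 := by
  choose o ho using fun j : X => exists_ne j
  obtain ⟨g, hg⟩ := exists_lam_eq fun j => lam [j, o j] (f (conj v) (of (o j)))
  refine ⟨g, mul_mem_AA_two (map_conj_mem_AA_one f v)
    (conj_mem_AA (by rw [FF_one_eq]; trivial)) fun i j l => ?_⟩
  have hd {i j : X} (hij : i ≠ j) : lam [j, i] (f (conj v) (of i)) = lam [j] g := by
    have := tens_diag f hij (ho j) (lamV v)
    rw [tens_lamV, tens_lamV] at this
    rw [hg]
    exact_mod_cast this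
  have ha := lam_pair_antisymm (map_conj_mem_AA_one f v) i j l
  rw [lam_pair_conj_of]
  by_cases hjl : j = l
  · subst hjl
    split_ifs <;> omega
  by_cases hl : l = i
  · subst hl
    rw [if_pos rfl, if_neg hjl, sub_zero, hd (Ne.symm hjl)]
  by_cases hj : j = i
  · subst hj
    rw [if_neg hl, if_pos rfl, ha, hd hjl, zero_sub]
  have := tens_of_distinct f hj hl hjl (lamV v)
  rw [tens_lamV] at this
  rw [if_neg hl, if_neg hj, sub_zero]
  exact_mod_cast this

end FreeAut

namespace FreeAut

open FreeGroup (of of_ne_one)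
open MulAut (conj)

variable {X : Type*} [DecidableEq X] [Fintype X]

/-- The commutator of two elements. -/
def comm (u v : FreeGroup X) : FF X 2 :=
  ⟨u * v * (v * u)⁻¹, commutator_mem_FF (k := 1) (l := 1) (by rw [FF_one_eq]; trivial)
    (by rw [FF_one_eq]; trivial)⟩

lemma comm_inv (u v : FreeGroup X) : (comm u v)⁻¹ = comm v u := by
  ext1; simp [comm]

lemma lam_pair_comm (p q : X) (u v : FreeGroup X) :
    lam [p, q] (comm u v : FreeGroup X) = lam [p] u * lam [q] v - lam [q] u * lam [p] v := by
  have h1 := lam_pair_mul p q (comm u v : FreeGroup X) (v * u)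
  have h2 := mem_FF_two.1 (comm u v).2
  rw [h2, show (comm u v : FreeGroup X) * (v * u) = u * v by
    simp only [comm]; group, lam_pair_mul,
    lam_pair_mul] at h1
  linarith

lemma lam_pair_mul_of_mem_FF_two {u v : FreeGroup X} (hu : u ∈ FF X 2) (p q : X) :
    lam [p, q] (u * v) = lam [p, q] u + lam [p, q] v := by
  rw [lam_pair_mul, mem_FF_two.1 hu]; ring

section

variable {A : Type*} [CommGroup A] {θ : FF X 2 →* A}
  (hθ : ∀ (a : FreeGroup X) (u : FF X 2), θ ⟨a * u * a⁻¹, (FF_normal 2).conj_mem _ u.2 a⟩ = θ u)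

include hθ

lemma map_comm_mul_left (a a' b : FreeGroup X) :
    θ (comm (a * a') b) = θ (comm a b) * θ (comm a' b) := by
  rw [← hθ a (comm a' b), mul_comm, ← map_mul]
  congr 1
  ext1
  simp only [comm, Subgroup.coe_mul]
  group

lemma map_comm_eq_prod_left (a b : FreeGroup X) :
    θ (comm a b) = ∏ p, θ (comm (of p) b) ^ lam [p] a :=
  hom_eq_prod (MonoidHom.mk' (fun a => θ (comm a b)) fun a a' => map_comm_mul_left hθ a a' b) a

lemma map_comm_eq_prod (a b : FreeGroup X) :
    θ (comm a b) = ∏ p, ∏ q, θ (comm (of p) (of q)) ^ (lam [p] a * lam [q] b) := by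
  rw [map_comm_eq_prod_left hθ]
  refine Finset.prod_congr rfl fun p _ => ?_
  rw [← comm_inv, map_inv, map_comm_eq_prod_left hθ, ← Finset.prod_inv_distrib,
    ← Finset.prod_zpow]
  refine Finset.prod_congr rfl fun q _ => ?_
  rw [← comm_inv, map_inv, inv_zpow, inv_zpow, inv_zpow, inv_inv, mul_comm, zpow_mul]

lemma map_eq_prod_lam_pair (u : FF X 2) : ∃ r : X → X → Prop, ∃ _ : DecidableRel r,
    θ u = ∏ p, ∏ q, if r p q then θ (comm (of p) (of q)) ^ lam [p, q] (u : FreeGroup X) else 1 := by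
  classical
  refine ⟨WellOrderingRel, inferInstance, ?_⟩
  let N : Subgroup (FreeGroup X) :=
    { carrier := {u | ∃ h : u ∈ FF X 2, θ ⟨u, h⟩ = ∏ p, ∏ q, if WellOrderingRel p q then
        θ (comm (of p) (of q)) ^ lam [p, q] u else 1}
      one_mem' := ⟨one_mem _, by
        rw [show (⟨1, one_mem _⟩ : FF X 2) = 1 from rfl, map_one]; simp [lam_one]⟩
      mul_mem' := by
        rintro u v ⟨hu, hu'⟩ ⟨hv, hv'⟩
        refine ⟨mul_mem hu hv, ?_⟩
        rw [show (⟨u * v, mul_mem hu hv⟩ : FF X 2) = ⟨u, hu⟩ * ⟨v, hv⟩ from rfl, map_mul, hu', hv',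
          ← Finset.prod_mul_distrib]
        refine Finset.prod_congr rfl fun p _ => ?_
        rw [← Finset.prod_mul_distrib]
        refine Finset.prod_congr rfl fun q _ => ?_
        rw [lam_pair_mul_of_mem_FF_two hu, zpow_add]
        split_ifs <;> simp
      inv_mem' := by
        rintro u ⟨hu, hu'⟩
        refine ⟨inv_mem hu, ?_⟩
        rw [show (⟨u⁻¹, inv_mem hu⟩ : FF X 2) = (⟨u, hu⟩ : FF X 2)⁻¹ from rfl, map_inv, hu',
          ← Finset.prod_inv_distrib]
        refine Finset.prod_congr rfl fun p _ => ?_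
        rw [← Finset.prod_inv_distrib]
        refine Finset.prod_congr rfl fun q _ => ?_
        have h := lam_pair_mul_of_mem_FF_two hu p q (v := u⁻¹)
        rw [mul_inv_cancel, lam_one (by simp)] at h
        rw [show lam [p, q] u⁻¹ = -lam [p, q] u by omega, zpow_neg]
        split_ifs <;> simp }
  suffices (u : FreeGroup X) ∈ N from this.2
  refine mem_of_mem_FF_two (fun a b => show ∃ _, _ from ⟨(comm a b).2, ?_⟩) u.2
  change θ (comm a b) = ∏ p, ∏ q, if WellOrderingRel p q then
    θ (comm (of p) (of q)) ^ lam [p, q] (comm a b : FreeGroup X) else 1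
  have hsplit (p q : X) : θ (comm (of p) (of q)) ^ (lam [p] a * lam [q] b) =
      (if WellOrderingRel p q then θ (comm (of p) (of q)) ^ (lam [p] a * lam [q] b) else 1) *
      (if WellOrderingRel q p then θ (comm (of p) (of q)) ^ (lam [p] a * lam [q] b) else 1) := by
    rcases trichotomous_of WellOrderingRel p q with h | rfl | h
    · rw [if_pos h, if_neg (asymm h), mul_one]
    · rw [if_neg (irrefl p), one_mul, show comm (of p) (of p) = 1 by ext1; simp [comm], map_one,
        one_zpow]
    · rw [if_pos h, if_neg (asymm h), one_mul]
  rw [map_comm_eq_prod hθ]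
  rw [Finset.prod_congr rfl fun p _ => Finset.prod_congr rfl fun q _ => hsplit p q]
  simp_rw [Finset.prod_mul_distrib]
  nth_rewrite 2 [Finset.prod_comm]
  rw [← Finset.prod_mul_distrib]
  refine Finset.prod_congr rfl fun p _ => ?_
  rw [← Finset.prod_mul_distrib]
  refine Finset.prod_congr rfl fun q _ => ?_
  rw [lam_pair_comm, zpow_sub, ← comm_inv (of p) (of q), map_inv, inv_zpow, mul_comm (lam [q] a)]
  split_ifs
  · rfl
  · simp

end

lemma mem_of_mem_FF_three {N : Subgroup (FreeGroup X)} [N.Normal]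
    (hN : ∀ u ∈ FF X 2, ∀ v, u * v * (v * u)⁻¹ ∈ N) {u : FreeGroup X} (hu : u ∈ FF X 3) :
    u ∈ N := by
  have hc (u : FF X 2) : (QuotientGroup.mk' N).comp (FF X 2).subtype u ∈
      Subgroup.center (FreeGroup X ⧸ N) := by
    rw [Subgroup.mem_center_iff]
    intro g
    induction g using QuotientGroup.induction_on with
    | H v =>
      refine (QuotientGroup.eq_iff_div_mem.2 ?_ : ((v * u : FreeGroup X) : FreeGroup X ⧸ N) =
        (u * v : FreeGroup X))
      have := inv_mem (hN u u.2 v)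
      simpa [div_eq_mul_inv] using this
  let _ : CommGroup (Subgroup.center (FreeGroup X ⧸ N)) :=
    { (inferInstance : Group (Subgroup.center (FreeGroup X ⧸ N))) with
      mul_comm := fun a b => Subtype.ext (Subgroup.mem_center_iff.1 b.2 a) }
  let θ : FF X 2 →* Subgroup.center (FreeGroup X ⧸ N) :=
    ((QuotientGroup.mk' N).comp (FF X 2).subtype).codRestrict _ hc
  have hθ (a : FreeGroup X) (u : FF X 2) :
      θ ⟨a * u * a⁻¹, (FF_normal 2).conj_mem _ u.2 a⟩ = θ u := by
    ext1
    change ((a * u * a⁻¹ : FreeGroup X) : FreeGroup X ⧸ N) = (u : FreeGroup X)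
    have h : ((a : FreeGroup X) : FreeGroup X ⧸ N) * (u : FreeGroup X) = (u : FreeGroup X) * a :=
      Subgroup.mem_center_iff.1 (hc u) a
    rw [QuotientGroup.mk_mul, QuotientGroup.mk_mul, h, ← QuotientGroup.mk_mul,
      ← QuotientGroup.mk_mul, mul_inv_cancel_right]
  have hu2 : u ∈ FF X 2 := FF_anti (by omega) hu
  obtain ⟨r, _, h⟩ := map_eq_prod_lam_pair (θ := θ) hθ ⟨u, hu2⟩
  have h1 : θ ⟨u, hu2⟩ = 1 := by
    rw [h]
    refine Finset.prod_eq_one fun p _ => Finset.prod_eq_one fun q _ => ?_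
    rw [mem_FF_iff_lam.1 hu [p, q] (by simp) (by simp), zpow_zero, ite_self]
  exact (QuotientGroup.eq_one_iff u).1 (congrArg Subtype.val h1)

end FreeAut

namespace FreeAut

open FreeGroup (of of_ne_one)
open MulAut (conj)

variable {X : Type*} [DecidableEq X] [Fintype X] (f : MulAut (MulAut (FreeGroup X)))

lemma map_conj_mem_AA_three {u : FreeGroup X} (hu : u ∈ FF X 3) : f (conj u) ∈ AA X 3 := by
  have : ((AA X 3).comap (f.toMonoidHom.comp conj)).Normal := Subgroup.Normal.comap (AA_normal 3) _
  refine mem_of_mem_FF_three (N := (AA X 3).comap (f.toMonoidHom.comp conj)) (fun u hu v => ?_) hu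
  rw [Subgroup.mem_comap, map_mul, map_mul, map_inv, map_mul]
  exact commutator_mem_AA (map_conj_mem_AA_of_mem_FF_two f (map_conj_mem_AA_one f) hu)
    (map_conj_mem_AA_one f v)

/-- The inner automorphism of `g` agrees with the image of that of `v` modulo the second term of
the Johnson filtration. -/
def Rel (g v : FreeGroup X) : Prop := (conj g)⁻¹ * f (conj v) ∈ AA X 2

variable {f}

lemma rel_iff {g v : FreeGroup X} : Rel f g v ↔
    ((conj g : MulAut (FreeGroup X)) : MulAut (FreeGroup X) ⧸ AA X 2) = f (conj v) :=
  QuotientGroup.eq.symm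

lemma Rel.mul {g v g' v' : FreeGroup X} (h : Rel f g v) (h' : Rel f g' v') :
    Rel f (g * g') (v * v') := by
  rw [rel_iff] at *
  rw [map_mul, map_mul, map_mul, QuotientGroup.mk_mul, QuotientGroup.mk_mul, h, h']

lemma Rel.inv {g v : FreeGroup X} (h : Rel f g v) : Rel f g⁻¹ v⁻¹ := by
  rw [rel_iff] at *
  rw [map_inv, map_inv, map_inv, QuotientGroup.mk_inv, QuotientGroup.mk_inv, h]

lemma Rel.zpow {g v : FreeGroup X} (h : Rel f g v) (n : ℤ) : Rel f (g ^ n) (v ^ n) := by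
  rw [rel_iff] at *
  rw [map_zpow, map_zpow, map_zpow, QuotientGroup.mk_zpow, QuotientGroup.mk_zpow, h]

lemma Rel.map {g v : FreeGroup X} (h : Rel f g v) (α : MulAut (FreeGroup X)) :
    Rel f (α g) (f.symm α v) := by
  have := (AA_normal 2).conj_mem _ h α
  rw [Rel, map_conj_symm, ← conj_apply_aut]
  convert this using 1
  group

lemma Rel.mem_FF_two_iff [Nontrivial X] {g v : FreeGroup X} (h : Rel f g v) :
    g ∈ FF X 2 ↔ v ∈ FF X 2 := by
  rw [← map_conj_mem_AA_two_iff f (v := v), ← conj_mem_AA_iff (u := g),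
    ← QuotientGroup.eq_one_iff (conj g), rel_iff.1 h, QuotientGroup.eq_one_iff]

lemma Rel.lamV_eq_iff [Nontrivial X] {g v g' v' : FreeGroup X} (h : Rel f g v)
    (h' : Rel f g' v') : lamV g = lamV g' ↔ lamV v = lamV v' := by
  rw [FreeAut.lamV_eq_iff, FreeAut.lamV_eq_iff, (h.mul h'.inv).mem_FF_two_iff]

lemma Rel.apply_mul_inv_mem {g v : FreeGroup X} (h : Rel f g v) (u : FreeGroup X) :
    f (conj v) u * (g * u * g⁻¹)⁻¹ ∈ FF X 3 := by
  have h1 := (map_aut_mem_FF (conj g)).2 (mem_AA_iff.1 h u)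
  rwa [map_mul, map_inv, MulAut.mul_apply, MulAut.apply_inv_self, MulAut.conj_apply] at h1

lemma comm_mul_inv_mem_AA_three {y y' z z' : MulAut (FreeGroup X)} (hz : z ∈ AA X 1)
    (hz' : z' ∈ AA X 1) (h : z⁻¹ * y ∈ AA X 2) (h' : z'⁻¹ * y' ∈ AA X 2) :
    ((y * y' * (y' * y)⁻¹ : MulAut (FreeGroup X)) : MulAut (FreeGroup X) ⧸ AA X 3) =
      (z * z' * (z' * z)⁻¹ : MulAut (FreeGroup X)) := by
  have hc {c t : MulAut (FreeGroup X)} (h : c ∈ AA X 2) (ht : t ∈ AA X 1) :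
      (c : MulAut (FreeGroup X) ⧸ AA X 3) * t = t * c := by
    have := (QuotientGroup.eq_one_iff _).2 (commutator_mem_AA h ht)
    rwa [QuotientGroup.mk_mul, QuotientGroup.mk_inv, mul_inv_eq_one, QuotientGroup.mk_mul,
      QuotientGroup.mk_mul] at this
  obtain ⟨c, rfl⟩ : ∃ c, y = z * c := ⟨z⁻¹ * y, by group⟩
  obtain ⟨c', rfl⟩ : ∃ c, y' = z' * c := ⟨z'⁻¹ * y', by group⟩
  rw [inv_mul_cancel_left] at h h'
  have h1 := hc h hz'
  have h2 := hc h' hz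
  have h3 := hc h (AA_anti (by omega) h')
  simp only [QuotientGroup.mk_mul, QuotientGroup.mk_inv]
  generalize (c : MulAut (FreeGroup X) ⧸ AA X 3) = c at *
  generalize (c' : MulAut (FreeGroup X) ⧸ AA X 3) = c' at *
  generalize (z : MulAut (FreeGroup X) ⧸ AA X 3) = z at *
  generalize (z' : MulAut (FreeGroup X) ⧸ AA X 3) = z' at *
  have e1 : z * c * (z' * c') = z * z' * (c * c') := by
    rw [mul_assoc, ← mul_assoc c, h1]; group
  have e2 : z' * c' * (z * c) = z' * z * (c * c') := by
    rw [mul_assoc, ← mul_assoc c', h2, h3]; group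
  rw [e1, e2]
  group

/-- The commutator of an inner automorphism with an image of one, computed in two ways. -/
lemma Rel.exists_comm {v u h : FreeGroup X} (hh : Rel f.symm h u) :
    ∃ w, f (conj w) = conj (f (conj v) u * u⁻¹) ∧
      (w : FreeGroup X ⧸ FF X 3) = (v * h * (h * v)⁻¹ : FreeGroup X) := by
  refine ⟨_, (conj_map_mul_inv f u v).symm, ?_⟩
  have := hh.apply_mul_inv_mem v
  rw [← QuotientGroup.eq_one_iff, QuotientGroup.mk_mul, QuotientGroup.mk_inv,
    mul_inv_eq_one] at this
  rw [QuotientGroup.mk_mul, QuotientGroup.mk_inv, this, ← QuotientGroup.mk_inv,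
    ← QuotientGroup.mk_mul]
  congr 1
  group

lemma Rel.comm_eq [Nontrivial X] {g v u h k : FreeGroup X} (hv : Rel f g v)
    (hu : Rel f.symm h u) (hk : Rel f k h) :
    ((g * u * (u * g)⁻¹ : FreeGroup X) : FreeGroup X ⧸ FF X 3) =
      (g * k * (k * g)⁻¹ : FreeGroup X) := by
  have h1 : ((f (conj v) u * u⁻¹ : FreeGroup X) : FreeGroup X ⧸ FF X 3) =
      (g * u * (u * g)⁻¹ : FreeGroup X) := by
    have := hv.apply_mul_inv_mem u
    rw [← QuotientGroup.eq_one_iff, QuotientGroup.mk_mul, QuotientGroup.mk_inv,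
      mul_inv_eq_one] at this
    rw [QuotientGroup.mk_mul, this, ← QuotientGroup.mk_mul]
    congr 1
    group
  obtain ⟨w, hw, hw'⟩ := hu.exists_comm (v := v)
  have h2 := (QuotientGroup.eq_one_iff _).2 (map_conj_mem_AA_three f
    ((QuotientGroup.eq_one_iff _).1 (mul_inv_eq_one.2 hw')))
  rw [map_mul, map_mul, QuotientGroup.mk_mul, hw] at h2
  have h3 := comm_mul_inv_mem_AA_three (conj_mem_AA (k := 1) (by rw [FF_one_eq]; trivial))
    (conj_mem_AA (k := 1) (by rw [FF_one_eq]; trivial)) hv hk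
  rw [map_inv, map_inv, QuotientGroup.mk_inv, mul_inv_eq_one] at h2
  rw [← map_mul, ← map_mul, ← map_mul, ← map_mul, ← map_inv, ← map_inv, ← map_mul, ← map_mul, ← h2,
    ← map_mul, ← map_mul, ← map_inv, ← map_mul] at h3
  rw [← h1, ← mul_inv_eq_one, ← QuotientGroup.mk_inv, ← QuotientGroup.mk_mul,
    QuotientGroup.eq_one_iff, ← conj_mem_AA_iff, ← QuotientGroup.eq_one_iff, map_mul, map_inv,
    QuotientGroup.mk_mul, QuotientGroup.mk_inv, mul_inv_eq_one]
  exact h3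

lemma lam_pair_eq_of_mk_eq {u v : FreeGroup X} (h : (u : FreeGroup X ⧸ FF X 3) = v) (p q : X) :
    lam [p, q] u = lam [p, q] v := by
  rw [QuotientGroup.eq, mem_FF_iff_lam] at h
  have h1 := lam_pair_mul p q u (u⁻¹ * v)
  rw [mul_inv_cancel_left, h [q] (by simp) (by simp), h [p, q] (by simp) (by simp)] at h1
  linarith

lemma Rel.lam_eq [Nontrivial X] {u h k : FreeGroup X} (hu : Rel f.symm h u) (hk : Rel f k h)
    (s : X) : lam [s] k = lam [s] u := by
  have key {g v : FreeGroup X} (hv : Rel f g v) (p q : X) :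
      lam [p] g * (lam [q] u - lam [q] k) = lam [q] g * (lam [p] u - lam [p] k) := by
    have h1 := lam_pair_eq_of_mk_eq (hv.comm_eq hu hk) p q
    have h2 := lam_pair_comm p q g u
    have h3 := lam_pair_comm p q g k
    simp only [comm] at h2 h3
    linarith
  by_contra hs
  replace hs : lam [s] u - lam [s] k ≠ 0 := by omega
  obtain ⟨i, j, hij⟩ := exists_pair_ne X
  obtain ⟨g, hg⟩ : ∃ g, Rel f g (of i) := exists_conj_inv_mul_mem_AA_two f (of i)
  obtain ⟨g', hg'⟩ : ∃ g, Rel f g (of j) := exists_conj_inv_mul_mem_AA_two f (of j)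
  have hr := (hg.zpow (lam [s] g')).mul (hg'.zpow (-lam [s] g))
  have h0 := hr.mem_FF_two_iff.1 (mem_FF_two.2 fun p => by
    rw [lam_singleton_mul, lam_singleton_zpow, lam_singleton_zpow]
    refine mul_right_cancel₀ hs ?_
    linear_combination lam [s] g' * key hg p s - lam [s] g * key hg' p s)
  have h2 := mem_FF_two.1 h0 j
  rw [lam_singleton_mul, lam_singleton_zpow, lam_singleton_zpow] at h2
  replace h2 : lam [s] g = 0 := by simpa [lam_singleton_of, hij.symm] using h2
  have h3 : of i ∈ FF X 2 := hg.mem_FF_two_iff.1 (mem_FF_two.2 fun p => by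
    have := key hg p s
    rw [h2, zero_mul] at this
    exact (mul_eq_zero.1 this).resolve_right hs)
  have := mem_FF_two.1 h3 i
  simp at this

lemma Rel.symm [Nontrivial X] {g v : FreeGroup X} (h : Rel f.symm v g) : Rel f g v := by
  obtain ⟨k, hk⟩ : ∃ k, Rel f k v := exists_conj_inv_mul_mem_AA_two f v
  have h1 : lamV k = lamV g := by
    ext s
    exact congrArg Int.cast (h.lam_eq hk s)
  rw [FreeAut.lamV_eq_iff, ← conj_mem_AA_iff] at h1
  have h2 := mul_mem ((AA_normal 2).conj_mem _ h1 (conj g⁻¹)) hk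
  rw [Rel]
  convert h2 using 1
  simp only [map_mul, map_inv]
  group

variable (f) in
lemma exists_rel_right [Nontrivial X] (g : FreeGroup X) : ∃ v, Rel f g v := by
  obtain ⟨v, hv⟩ := exists_conj_inv_mul_mem_AA_two f.symm g
  exact ⟨v, Rel.symm hv⟩

instance conj_range_normal : (conj : FreeGroup X →* _).range.Normal :=
  ⟨by rintro _ ⟨u, rfl⟩ α; exact ⟨α u, (conj_apply_aut α u).symm⟩⟩

variable (f) in
lemma map_conj_mem_sup [Nontrivial X] {u : FreeGroup X} (hu : u ∈ FF X 2) (m : ℕ) :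
    f (conj u) ∈ (conj : FreeGroup X →* _).range ⊔ AA X (m + 2) := by
  let d : FreeGroup X →* MulAut (FreeGroup X) := f.toMonoidHom.comp conj
  let K := (conj : FreeGroup X →* _).range.comap d
  have hd (m) : ((conj : FreeGroup X →* _).range ⊔ AA X m).Normal :=
    have := AA_normal (X := X) m
    Subgroup.sup_normal _ _
  have hK : FF X 2 ≤ K ⊔ FF X 3 := fun u hu => by
    have : K.Normal := Subgroup.Normal.comap conj_range_normal d
    refine mem_of_mem_FF_two (fun a b => ?_) hu
    obtain ⟨g, hg⟩ := exists_rel_right f.symm b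
    obtain ⟨w, hw, hw'⟩ := Rel.exists_comm (v := a) hg
    rw [QuotientGroup.eq] at hw'
    have hwK : w ∈ K := ⟨_, hw.symm⟩
    simpa using Subgroup.mul_mem_sup hwK hw'
  induction m generalizing u with
  | zero =>
    exact Subgroup.mem_sup_right (map_conj_mem_AA_of_mem_FF_two f (map_conj_mem_AA_one f) hu)
  | succ m ih =>
    let M := ((conj : FreeGroup X →* _).range ⊔ AA X (m + 3)).comap d
    have hM : M.Normal := Subgroup.Normal.comap (hd _) d
    have hKM : K ≤ M := Subgroup.comap_mono le_sup_left
    refine (hK.trans (sup_le hKM fun u hu => mem_of_mem_FF_three (fun u hu v => ?_) hu)) hu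
    have := AA_normal (X := X) (m + 2)
    obtain ⟨n, hn, z, hz, hnz⟩ := Subgroup.mem_sup_of_normal_right.1 (ih hu)
    have h1 := commutator_mem_AA hz (map_conj_mem_AA_one f v)
    have h2 := conj_range_normal.conj_mem _ (inv_mem hn) (f (conj v))
    have h3 : n * (z * f (conj v) * (f (conj v) * z)⁻¹) * (f (conj v) * n⁻¹ * (f (conj v))⁻¹) ∈
        (conj : FreeGroup X →* _).range ⊔ AA X (m + 3) :=
      mul_mem (Subgroup.mul_mem_sup hn h1) (Subgroup.mem_sup_left h2)
    rw [Subgroup.mem_comap, map_mul, map_inv, map_mul, map_mul]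
    change f (conj u) * f (conj v) * _ ∈ _
    rw [← hnz]
    convert h3 using 1
    change _ * (f (conj v) * f (conj u))⁻¹ = _
    rw [← hnz]
    group

end FreeAut

namespace FreeAut

open FreeGroup (of of_ne_one)
open MulAut (conj)

variable {X : Type*} [DecidableEq X] [Fintype X]

lemma lam_eq_of_mul_inv_mem {k : ℕ} {u v : FreeGroup X} (h : u * v⁻¹ ∈ FF X k) {w : List X}
    (hw : w.length < k) : lam w u = lam w v := by
  have := mul_inv_mem_FF.1 h w hw
  rwa [map_sub, sub_eq_zero] at this

omit [Fintype X] in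
lemma lam_of_eq_zero (i : X) {w : List X} (hw : 2 ≤ w.length) : lam w (of i) = 0 := by
  match w, hw with
  | j :: k :: w, _ => simp [lam_cons_of]

lemma lam_append_mul_of (i k : X) (w : List X) (u : FreeGroup X) :
    lam (w ++ [k]) (u * of i) = lam (w ++ [k]) u + if k = i then lam w u else 0 := by
  have h0 : lam ([] : List X) (of i) = 1 := lam_nil _
  rw [lam_mul, List.length_append, List.length_singleton, Finset.sum_range_succ,
    Finset.sum_range_succ, Finset.sum_eq_zero]
  · have h1 : (w ++ [k]).drop (w.length + 1) = [] := by simp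
    have h2 : (w ++ [k]).take (w.length + 1) = w ++ [k] := List.take_of_length_le (by simp)
    rw [h1, h2, h0, List.take_left, List.drop_left, lam_cons_of]
    split_ifs <;> simp_all; ring
  · intro l hl
    rw [Finset.mem_range] at hl
    rw [lam_of_eq_zero i (by simp; omega), mul_zero]

/-- Elements commuting with a letter to high order have coefficients supported on powers of that
letter. -/
lemma lam_eq_zero_of_commute {m : ℕ} {i : X} {g : FreeGroup X}
    (h : g * of i * (of i * g)⁻¹ ∈ FF X (m + 1)) {w : List X} (hw : w.length < m)
    (hk : ∃ k ∈ w, k ≠ i) : lam w g = 0 := by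
  have key (k : X) (w : List X) (hw : w.length + 1 < m) :
      lam (k :: w) g = if k = i then lam (w ++ [i]) g else 0 := by
    have h1 := lam_eq_of_mul_inv_mem h (w := k :: (w ++ [i])) (by simp; omega)
    rw [← List.cons_append, lam_append_mul_of, if_pos rfl, List.cons_append, lam_cons_of_mul] at h1
    linarith
  obtain ⟨k, hk, hki⟩ := hk
  obtain ⟨s, t, rfl⟩ := List.append_of_mem hk
  clear hk
  induction s generalizing t with
  | nil => rw [List.nil_append, key k t (by simpa using hw), if_neg hki]
  | cons a s ih =>
    rw [List.cons_append, key _ _ (by simpa using hw)]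
    split_ifs
    · rw [List.append_assoc, List.cons_append]
      exact ih _ (by simp at hw ⊢; omega)
    · rfl

lemma exists_eq_conj_of_forall_mem_AA [Nontrivial X] {y : MulAut (FreeGroup X)}
    (hy : ∀ m, ∃ g, (conj g)⁻¹ * y ∈ AA X m) : ∃ g, y = conj g := by
  have hmod {y : MulAut (FreeGroup X)} {g : FreeGroup X} {m : ℕ} (h : (conj g)⁻¹ * y ∈ AA X m)
      (u : FreeGroup X) : y u * (g * u * g⁻¹)⁻¹ ∈ FF X (m + 1) := by
    have h1 := (map_aut_mem_FF (conj g)).2 (mem_AA_iff.1 h u)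
    rwa [map_mul, map_inv, MulAut.mul_apply, MulAut.apply_inv_self, MulAut.conj_apply] at h1
  have hmul {y : MulAut (FreeGroup X)} (hy : ∀ m, ∃ g, (conj g)⁻¹ * y ∈ AA X m)
      (h : FreeGroup X) (m : ℕ) : ∃ g, (conj g)⁻¹ * (conj h * y) ∈ AA X m := by
    obtain ⟨g, hg⟩ := hy m
    refine ⟨h * g, ?_⟩
    convert hg using 1
    rw [map_mul]
    group
  have hcomm {y : MulAut (FreeGroup X)} {g u p : FreeGroup X} {m : ℕ}
      (h : (conj g)⁻¹ * y ∈ AA X m) (hu : y u = p * u * p⁻¹) :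
      (p⁻¹ * g) * u * (u * (p⁻¹ * g))⁻¹ ∈ FF X (m + 1) := by
    have h1 := inv_mem (hmod h u)
    have := (FF_normal (X := X) (m + 1)).conj_mem _ h1 p⁻¹
    rw [hu] at this
    convert this using 1
    group
  have hletter (i : X) : ∃ p, y (of i) = p * of i * p⁻¹ := by
    have heq {w : List X} {g : FreeGroup X} (h : (conj g)⁻¹ * y ∈ AA X w.length) :
        tr w (y (of i)) = tr w (of i) := by
      rw [← tr_conj w g (of i)]
      refine Finset.sum_congr rfl fun k _ => lam_eq_of_mul_inv_mem (hmod h _) (by simp)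
    obtain ⟨k, n, p, hp⟩ := exists_conj_eq_zpow (u := y (of i)) fun w hw _ => by
      obtain ⟨g, hg⟩ := hy w.length
      rw [heq hg]
      exact Finset.sum_eq_zero fun k _ => lam_of_eq_zero i (by simpa using hw)
    obtain ⟨g, hg⟩ := hy 1
    have h1 := lam_eq_of_mul_inv_mem (hmod hg (of i)) (w := [i]) (by simp)
    rw [hp, lam_singleton_conj, lam_singleton_conj, lam_singleton_zpow, lam_singleton_of,
      lam_singleton_of, if_pos rfl] at h1
    split_ifs at h1 with hik
    · exact ⟨p, by rw [hp, ← hik, show n = 1 by simpa using h1, zpow_one]⟩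
    · simp at h1
  obtain ⟨i, j, hij⟩ := exists_pair_ne X
  obtain ⟨q, hq⟩ := hletter i
  obtain ⟨p', hp'⟩ := hletter j
  obtain ⟨p, rfl⟩ : ∃ p, p' = q * p := ⟨q⁻¹ * p', by group⟩
  have hfix : ∀ y : MulAut (FreeGroup X), (∀ m, ∃ g, (conj g)⁻¹ * y ∈ AA X m) → y (of i) = of i →
      y (of j) = of j → y = 1 := by
    intro y hy hi hj
    refine eq_one_of_forall_mem_AA fun m => ?_
    obtain ⟨g, hg⟩ := hy m
    have h1 := hcomm hg (p := 1) (u := of i) (by simpa using hi)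
    have h2 := hcomm hg (p := 1) (u := of j) (by simpa using hj)
    rw [inv_one, one_mul] at h1 h2
    have h3 : g ∈ FF X m := mem_FF_iff_lam.2 fun w hw hm => by
      obtain ⟨k, w, rfl⟩ := List.exists_cons_of_ne_nil hw
      rcases ne_or_eq k i with hk | rfl
      · exact lam_eq_zero_of_commute h1 hm ⟨k, by simp, hk⟩
      · exact lam_eq_zero_of_commute h2 hm ⟨k, by simp, hij⟩
    have := mul_mem (conj_mem_AA h3) hg
    rwa [mul_inv_cancel_left] at this
  have hp : ∃ a b : ℤ, p = of i ^ a * of j ^ b := by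
    obtain ⟨L, hL, rfl⟩ := exists_syl p
    obtain ⟨g, hg⟩ := hmul hy q⁻¹ (L.length + 2)
    have h1 := hcomm hg (p := 1) (u := of i) (by simp [hq, mul_assoc])
    have h2 := hcomm hg (p := syl L) (u := of j) (by simp [hp', mul_assoc])
    rw [inv_one, one_mul] at h1
    have h2' : (g⁻¹ * syl L) * of j * (of j * (g⁻¹ * syl L))⁻¹ ∈ FF X (L.length + 2 + 1) := by
      have := (FF_normal (X := X) (L.length + 2 + 1)).conj_mem _ (inv_mem h2) (g⁻¹ * syl L)
      convert this using 1
      group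
    have h3 := lam_syl_self hL
    rw [← mul_inv_cancel_left g (syl L), lam_mul] at h3
    obtain ⟨k, -, hk⟩ := Finset.exists_ne_zero_of_sum_ne_zero h3
    have ht : ∀ a ∈ (L.map Prod.fst).take k, a = i := by
      by_contra! h
      exact hk (by rw [lam_eq_zero_of_commute h1 (by simp) h, zero_mul])
    have hd : ∀ a ∈ (L.map Prod.fst).drop k, a = j := by
      by_contra! h
      exact hk (by rw [lam_eq_zero_of_commute h2' (by simp; omega) h, mul_zero])
    have hpow : ∀ (M : List (X × ℤ)) (i : X), (∀ a ∈ M.map Prod.fst, a = i) →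
        ∃ e : ℤ, syl M = of i ^ e := by
      intro M i hM
      induction M with
      | nil => exact ⟨0, by simp⟩
      | cons p M ih =>
        obtain ⟨e, he⟩ := ih fun a ha => hM a (by simp at ha ⊢; tauto)
        exact ⟨p.2 + e, by rw [syl_cons, he, hM p.1 (by simp), zpow_add]⟩
    obtain ⟨a, ha⟩ := hpow (L.take k) i (by rwa [List.map_take])
    obtain ⟨b, hb⟩ := hpow (L.drop k) j (by rwa [List.map_drop])
    exact ⟨a, b, by rw [← ha, ← hb, ← syl_append, List.take_append_drop]⟩
  obtain ⟨a, b, rfl⟩ := hp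
  have := hfix _ (hmul hy (q * of i ^ a)⁻¹)
    (by simp only [MulAut.mul_apply, hq, MulAut.conj_apply]; group)
    (by simp only [MulAut.mul_apply, hp', MulAut.conj_apply]; group)
  rw [map_inv, inv_mul_eq_one] at this
  exact ⟨_, this.symm⟩

/-- Automorphisms of the automorphism group preserve the inner automorphisms by elements of the
commutator subgroup up to inner automorphisms. -/
lemma exists_map_conj_eq_conj [Nontrivial X] (f : MulAut (MulAut (FreeGroup X)))
    {u : FreeGroup X} (hu : u ∈ FF X 2) : ∃ v ∈ FF X 2, f (conj u) = conj v := by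
  obtain ⟨v, hv⟩ := exists_eq_conj_of_forall_mem_AA (y := f (conj u)) fun m => by
    have := AA_normal (X := X) (m + 2)
    obtain ⟨_, ⟨g, rfl⟩, z, hz, hgz⟩ :=
      Subgroup.mem_sup_of_normal_right.1 (map_conj_mem_sup f hu m)
    refine ⟨g, ?_⟩
    rw [← hgz, inv_mul_cancel_left]
    exact AA_anti (by omega) hz
  refine ⟨v, ?_, hv⟩
  rw [← conj_mem_AA_iff, ← hv, map_conj_mem_AA_two_iff]
  exact hu

end FreeAut

namespace FreeAut

open FreeGroup (of of_ne_one)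
open MulAut (conj)

variable {X : Type*} [DecidableEq X]

omit [DecidableEq X] in
lemma mk_cons (p : X × Bool) (W : List (X × Bool)) :
    FreeGroup.mk (p :: W) = FreeGroup.mk [p] * FreeGroup.mk W := by
  rw [FreeGroup.mul_mk]; rfl

/-- The action of the inversion of the letter `i` on signed letters. -/
def flip (i : X) (p : X × Bool) : X × Bool := (p.1, if p.1 = i then !p.2 else p.2)

lemma tau_one_mk (i : X) (W : List (X × Bool)) :
    tau i 1 (FreeGroup.mk W) = FreeGroup.mk (W.map (flip i)) := by
  induction W with
  | nil => exact map_one _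
  | cons p W ih =>
    obtain ⟨k, b⟩ := p
    have h1 : FreeGroup.mk [(k, true)] = of k := rfl
    have h2 : FreeGroup.mk [(k, false)] = (of k)⁻¹ := rfl
    rw [List.map_cons, mk_cons, mk_cons _ (W.map _), map_mul, ih]
    congr 1
    by_cases hk : k = i
    · subst hk
      cases b <;> simp [flip, h1, h2]
    · cases b <;> simp [flip, hk, h1, h2, tau_of_ne]

lemma toWord_tau_one (i : X) (u : FreeGroup X) : (tau i 1 u).toWord = u.toWord.map (flip i) := by
  conv_lhs => rw [← FreeGroup.mk_toWord (x := u), tau_one_mk, FreeGroup.toWord_mk]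
  refine FreeGroup.IsReduced.reduce_eq ?_
  have h := FreeGroup.isReduced_toWord (x := u)
  rw [FreeGroup.IsReduced] at h ⊢
  rw [List.isChain_map]
  refine h.imp fun a b hab h' => ?_
  simp only [flip] at h' ⊢
  rw [h', hab h']

lemma mem_range_incl_of_tau_one {i : X} {u : FreeGroup X} (h : tau i 1 u = u) :
    u ∈ (incl i).range := by
  have h1 := toWord_tau_one i u
  rw [h] at h1
  rw [← FreeGroup.mk_toWord (x := u)]
  generalize u.toWord = W at h1
  induction W with
  | nil => exact one_mem _
  | cons p W ih =>
    rw [List.map_cons, List.cons.injEq] at h1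
    obtain ⟨k, b⟩ := p
    have hk : k ≠ i := by
      rintro rfl
      simpa [flip] using h1.1
    rw [mk_cons]
    refine mul_mem ?_ (ih h1.2)
    cases b
    · exact ⟨(of ⟨k, hk⟩)⁻¹, by rw [map_inv, incl_of]; rfl⟩
    · exact ⟨of ⟨k, hk⟩, incl_of _ _⟩

/-- The elements inverted by the inversion of a letter. -/
lemma exists_eq_mul_tau_one_inv {i : X} {e : FreeGroup X} (h : tau i 1 e = e⁻¹) :
    ∃ (w : FreeGroup X) (m : ℤ), e = w * of i ^ m * (tau i 1 w)⁻¹ := by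
  have h1 := toWord_tau_one i e
  rw [h, FreeGroup.toWord_inv] at h1
  rw [← FreeGroup.mk_toWord (x := e)]
  generalize e.toWord = W at h1
  induction W using List.bidirectionalRec with
  | nil => exact ⟨1, 0, by simp; rfl⟩
  | singleton p =>
    obtain ⟨k, b⟩ := p
    have hk : k = i := by
      by_contra hk
      simp [FreeGroup.invRev, flip, hk] at h1
    subst hk
    cases b
    · exact ⟨1, -1, by simp; rfl⟩
    · exact ⟨1, 1, by simp; rfl⟩
  | cons_append s W t ih =>
    have h2 : (t.1, !t.2) = flip i s ∧ FreeGroup.invRev W = W.map (flip i) ∧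
        (s.1, !s.2) = flip i t := by simpa [FreeGroup.invRev] using h1
    obtain ⟨w, m, hw⟩ := ih h2.2.1
    have h3 : FreeGroup.mk [t] = (tau i 1 (FreeGroup.mk [s]))⁻¹ := by
      rw [tau_one_mk, List.map_singleton, ← h2.1, FreeGroup.inv_mk]
      simp [FreeGroup.invRev]
    refine ⟨FreeGroup.mk [s] * w, m, ?_⟩
    rw [mk_cons, ← FreeGroup.mul_mk, hw, h3, map_mul]
    group

variable [Fintype X]

lemma exists_eq_mul_tau_one_inv_of_mem_FF {i : X} {e : FreeGroup X} (h : tau i 1 e = e⁻¹)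
    (he : e ∈ FF X 2) : ∃ w ∈ FF X 2, e = w * (tau i 1 w)⁻¹ := by
  have hlam (w : FreeGroup X) : lam [i] (tau i 1 w) = - lam [i] w := by
    induction w using FreeGroup.induction_on with
    | C1 => simp [lam_one]
    | of k =>
      rcases eq_or_ne k i with rfl | hk
      · simp [lam_singleton_inv]
      · simp [tau_of_ne _ hk, hk.symm]
    | inv_of k ih => rw [map_inv, lam_singleton_inv, ih, lam_singleton_inv]
    | mul u v hu hv => rw [map_mul, lam_singleton_mul, hu, hv, lam_singleton_mul]; ring
  have hsub (k : X) (w : FreeGroup X) :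
      lam [k] (substHom i 1 w) = lam [k] w - if k = i then lam [i] w else 0 := by
    induction w using FreeGroup.induction_on with
    | C1 => simp [lam_one]
    | of l =>
      rcases eq_or_ne l i with rfl | hl
      · simp [lam_one]
      · simp [substHom_of_ne _ hl, hl.symm]
    | inv_of l ih =>
      rw [map_inv, lam_singleton_inv, ih, lam_singleton_inv, lam_singleton_inv]
      split_ifs <;> ring
    | mul u v hu hv =>
      rw [map_mul, lam_singleton_mul, hu, hv, lam_singleton_mul, lam_singleton_mul]
      split_ifs <;> ring
  have hfix (w : FreeGroup X) : tau i 1 (substHom i 1 w) = substHom i 1 w := by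
    induction w using FreeGroup.induction_on with
    | C1 => simp
    | of l =>
      rcases eq_or_ne l i with rfl | hl
      · simp
      · rw [substHom_of_ne _ hl, tau_of_ne _ hl]
    | inv_of l ih => rw [map_inv, map_inv, ih]
    | mul u v hu hv => rw [map_mul, map_mul, hu, hv]
  obtain ⟨w, m, rfl⟩ := exists_eq_mul_tau_one_inv h
  have h1 := mem_FF_two.1 he i
  rw [lam_singleton_mul, lam_singleton_mul, lam_singleton_zpow, lam_singleton_inv, hlam,
    lam_singleton_of, if_pos rfl, mul_one] at h1
  obtain ⟨l, rfl⟩ : ∃ l, m = l + l := ⟨-lam [i] w, by linarith⟩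
  have h2 : lam [i] (w * of i ^ l) = 0 := by
    rw [lam_singleton_mul, lam_singleton_zpow, lam_singleton_of, if_pos rfl, mul_one]; linarith
  refine ⟨w * of i ^ l * (substHom i 1 (w * of i ^ l))⁻¹, mem_FF_two.2 fun k => ?_, ?_⟩
  · rw [lam_singleton_mul, lam_singleton_inv, hsub, h2]
    split_ifs <;> ring
  · rw [map_mul (tau i 1), map_inv (tau i 1), hfix, map_mul (tau i 1), map_zpow (tau i 1),
      tau_one_self, zpow_add]
    group

lemma eq_one_of_mem_FF_two_of_commute {e : FreeGroup X} {j : X} (he : e ∈ FF X 2)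
    (h : e * of j = of j * e) : e = 1 := by
  by_contra h1
  obtain ⟨p, q, -, hq, hpq⟩ := exists_zpow_eq_zpow h h1 (of_ne_one j)
  have h2 := congrArg (lam [j]) hpq
  rw [lam_singleton_zpow, lam_singleton_zpow, lam_singleton_of, if_pos rfl,
    mem_FF_two.1 he] at h2
  omega

variable [Nontrivial X] (f : MulAut (MulAut (FreeGroup X)))

lemma exists_rel_mem_range (j : X) :
    ∃ v, Rel f (of j) v ∧ f (conj v) ∈ (conj : FreeGroup X →* _).range := by
  obtain ⟨i, hi⟩ := exists_ne j
  have inj := conj_injective_aut hi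
  set a := tau i (1 : FreeGroup {k // k ≠ i}) with ha
  have ha2 : a * a = 1 := tau_mul_self i 1
  have ha2' : a⁻¹ = a := inv_eq_of_mul_eq_one_left ha2
  have haj : a (of j) = of j := tau_of_ne _ hi.symm
  have hcomm {v : FreeGroup X} (hv : Rel f (of j) v) {α : MulAut (FreeGroup X)}
      (hα : α (of j) = of j) : ∃ e ∈ FF X 2, α * f (conj v) * α⁻¹ = conj e * f (conj v) := by
    have h1 := hv.map α
    rw [hα] at h1
    have h2 := (h1.lamV_eq_iff hv).1 rfl
    rw [lamV_eq_iff] at h2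
    obtain ⟨e, he, hfe⟩ := exists_map_conj_eq_conj f h2
    refine ⟨e, he, ?_⟩
    rw [← map_conj_symm, ← hfe, ← map_mul, ← map_mul, inv_mul_cancel_right]
  obtain ⟨v₀, hv₀⟩ := exists_rel_right f (of j)
  obtain ⟨e, he, hae⟩ := hcomm hv₀ haj
  have hinv : a e = e⁻¹ := inj (by
    rw [map_inv, ← conj_apply_aut, eq_mul_inv_of_mul_eq hae.symm, ha2']
    have h3 (y : MulAut (FreeGroup X)) : a * (a * y * a * y⁻¹) * a = (a * a) * y * a * y⁻¹ * a := by
      group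
    rw [h3, ha2, mul_inv_rev, mul_inv_rev, mul_inv_rev, inv_inv, ha2', one_mul, mul_assoc,
      mul_assoc])
  obtain ⟨w, hw, rfl⟩ := exists_eq_mul_tau_one_inv_of_mem_FF hinv he
  obtain ⟨s, hs, hfs⟩ := exists_map_conj_eq_conj f.symm (inv_mem (map_aut_mem_FF a |>.2 hw))
  have hfs' : f (conj s) = conj (a w)⁻¹ := by rw [← hfs, MulEquiv.apply_symm_apply]
  have hrel : Rel f (of j) (s * v₀) := by
    have h1 : Rel f 1 s := by
      rw [Rel, map_one, inv_one, one_mul, hfs', conj_mem_AA_iff]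
      exact inv_mem ((map_aut_mem_FF a).2 hw)
    simpa using h1.mul hv₀
  refine ⟨s * v₀, hrel, ?_⟩
  set y := f (conj (s * v₀)) with hy
  have hay : a * y = y * a := by
    have hyw : y = conj (a w)⁻¹ * f (conj v₀) := by rw [hy, map_mul, map_mul, hfs']
    rw [← mul_inv_eq_iff_eq_mul, hyw, ← mul_assoc, ← inv_mul_cancel_right (a * _) a, conj_apply_aut,
      mul_assoc, mul_assoc, ← mul_assoc a, hae, ← mul_assoc, ← map_mul, map_inv, ← MulAut.mul_apply,
      ha2, MulAut.one_apply, inv_mul_cancel_left]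
  have hrange : of j ∈ (incl i).range := ⟨of ⟨j, hi.symm⟩, incl_of _ _⟩
  have htau (w : FreeGroup {k // k ≠ i}) : tau i w * y = y * tau i w := by
    have hj : tau i w (of j) = of j := tau_of_ne _ hi.symm
    obtain ⟨e, he, hwe⟩ := hcomm hrel hj
    rw [← hy] at hwe
    obtain ⟨b, hb⟩ : y⁻¹ (of j) ∈ (incl i).range := by
      refine mem_range_incl_of_tau_one ?_
      have : a * y⁻¹ = y⁻¹ * a := Commute.inv_right hay
      change (a * y⁻¹) (of j) = _
      rw [this, MulAut.mul_apply, haj]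
    have hyb : y (incl i b) = of j := by rw [hb, MulAut.apply_inv_self]
    have h1 := DFunLike.congr_fun (mul_inv_eq_iff_eq_mul.1 hwe) (incl i b)
    simp only [MulAut.mul_apply, tau_incl, hyb, hj, MulAut.conj_apply] at h1
    rw [eq_one_of_mem_FF_two_of_commute he (eq_mul_inv_iff_mul_eq.1 h1).symm, map_one, one_mul,
      mul_inv_eq_iff_eq_mul] at hwe
    exact hwe
  obtain ⟨g, hg⟩ := eq_conj_of_commute_tau i y
    (fun w u => (DFunLike.congr_fun (htau w) u).symm) (by
      rintro ⟨b, hb⟩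
      have h1 := hb (of ⟨j, hi.symm⟩)
      rw [incl_of] at h1
      have h2 := mem_FF_two.1 (mem_AA_iff.1 (map_conj_mem_AA_one f (s * v₀)) (of j)) j
      rw [← hy, h1, lam_singleton_mul, lam_singleton_conj, lam_singleton_inv, lam_singleton_of,
        if_pos rfl] at h2
      norm_num at h2)
  exact ⟨g, hg.symm⟩

lemma map_conj_mem_range (v : FreeGroup X) : f (conj v) ∈ (conj : FreeGroup X →* _).range := by
  obtain ⟨g, hg⟩ : ∃ g, Rel f g v := exists_conj_inv_mul_mem_AA_two f v
  obtain ⟨u, hu, hfu⟩ : ∃ u, Rel f g u ∧ f (conj u) ∈ (conj : FreeGroup X →* _).range := by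
    clear hg
    induction g using FreeGroup.induction_on with
    | C1 => exact ⟨1, by simp [Rel], by simp⟩
    | of j => exact exists_rel_mem_range f j
    | inv_of j ih =>
      obtain ⟨u, hu, hfu⟩ := ih
      exact ⟨u⁻¹, hu.inv, by rw [map_inv, map_inv]; exact inv_mem hfu⟩
    | mul g h ihg ihh =>
      obtain ⟨u, hu, hfu⟩ := ihg
      obtain ⟨u', hu', hfu'⟩ := ihh
      exact ⟨u * u', hu.mul hu', by rw [map_mul, map_mul]; exact mul_mem hfu hfu'⟩
  have h1 := (hg.lamV_eq_iff hu).1 rfl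
  rw [lamV_eq_iff] at h1
  obtain ⟨z, -, hz⟩ := exists_map_conj_eq_conj f h1
  have h2 := mul_mem (show conj z ∈ (conj : FreeGroup X →* _).range from ⟨z, rfl⟩) hfu
  rwa [← hz, ← map_mul, ← map_mul, inv_mul_cancel_right] at h2

end FreeAut

/-- The automorphism group of any non-abelian free group is complete:
it has trivial center and every automorphism of `Aut F` is inner. -/
theorem aut_free_group_complete (X : Type*) (a b : X) (hab : a ≠ b) :
    Subgroup.center (MulAut (FreeGroup X)) = ⊥ ∧
      ∀ f : MulAut (MulAut (FreeGroup X)), ∃ g : MulAut (FreeGroup X),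
        f = MulAut.conj g := by
  classical
  refine ⟨FreeAut.center_aut hab, FreeAut.exists_eq_conj_aut hab fun f u => ?_⟩
  have : Nontrivial X := ⟨a, b, hab⟩
  cases finite_or_infinite X
  · have := Fintype.ofFinite X
    obtain ⟨v, hv⟩ := FreeAut.map_conj_mem_range f u
    exact ⟨v, hv.symm⟩
  · exact FreeAut.map_conj_eq_conj_of_infinite f u
end

section
/- Let F be a free group with basis {x} ∪ Y, Y nonempty, and φ the quasi-conjugation φ(x) = x⁻¹, φ(y) = x y x⁻¹ (y ∈ Y). Then every σ ∈ Aut(F) commuting with φ either fixes x and restricts to an automorphism of the subgroup ⟨Y⟩, or sends x to x⁻¹ and satisfies σ(y) ∈ x·⟨Y⟩·x⁻¹ for all y ∈ Y with y ↦ x⁻¹σ(y)x an automorphism of ⟨Y⟩. -/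
namespace FreeGroup

variable {α : Type*}

theorem mk_cons (l : α × Bool) (L : List (α × Bool)) : mk (l :: L) = mk [l] * mk L := by
  simp

theorem head?_invRev (L : List (α × Bool)) :
    (invRev L).head? = L.getLast?.map fun l => (l.1, !l.2) := by
  simp [invRev]

theorem getLast?_invRev (L : List (α × Bool)) :
    (invRev L).getLast? = L.head?.map fun l => (l.1, !l.2) := by
  simp [invRev]

/-- The subgroup generated by the basis elements other than `x`. -/
def others (x : α) : Subgroup (FreeGroup α) := Subgroup.closure (of '' {x}ᶜ)

theorem mk_mem_others {x : α} {L : List (α × Bool)} (h : ∀ l ∈ L, l.1 ≠ x) :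
    mk L ∈ others x := by
  induction L with
  | nil => exact one_mem _
  | cons l L ih =>
    rw [mk_cons]
    refine mul_mem ?_ (ih fun m hm => h m (List.mem_cons_of_mem _ hm))
    have hm : of l.1 ∈ others x :=
      Subgroup.subset_closure ⟨l.1, h l List.mem_cons_self, rfl⟩
    obtain ⟨a, b⟩ := l
    cases b
    · simpa [of, inv_mk, invRev] using inv_mem hm
    · exact hm

variable [DecidableEq α]

/-- Inversion of the letters `x` and `x⁻¹`, fixing all the other letters. -/
def flipLetter (x : α) (l : α × Bool) : α × Bool := if l.1 = x then (l.1, !l.2) else l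

/-- The endomorphism inverting the basis element `x` and fixing the other ones. -/
def flip (x : α) : FreeGroup α →* FreeGroup α :=
  lift fun a => if a = x then (of a)⁻¹ else of a

theorem flip_of_self (x : α) : flip x (of x) = (of x)⁻¹ := by simp [flip]

theorem flip_of_ne {x a : α} (h : a ≠ x) : flip x (of a) = of a := by simp [flip, h]

theorem flip_mk (x : α) (L : List (α × Bool)) : flip x (mk L) = mk (L.map (flipLetter x)) := by
  induction L with
  | nil => exact _root_.map_one _
  | cons l L ih =>
    rw [mk_cons, _root_.map_mul, ih, List.map_cons, mk_cons (flipLetter x l)]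
    congr 1
    obtain ⟨a, b⟩ := l
    by_cases h : a = x <;> cases b <;> simp [flip, flipLetter, h, of, inv_mk, invRev]

theorem flip_flip (x : α) (g : FreeGroup α) : flip x (flip x g) = g := by
  have : (flip x).comp (flip x) = MonoidHom.id _ := by
    ext a
    by_cases h : a = x <;> simp [flip, h]
  exact DFunLike.congr_fun this g

theorem toWord_flip (x : α) (g : FreeGroup α) :
    (flip x g).toWord = g.toWord.map (flipLetter x) := by
  conv_lhs => rw [← mk_toWord (x := g), flip_mk, toWord_mk]
  apply IsReduced.reduce_eq
  refine List.isChain_map_of_isChain _ ?_ (isReduced_toWord (x := g))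
  rintro ⟨a, b⟩ ⟨c, d⟩ h
  unfold flipLetter
  grind

theorem flip_eq_self_iff {x : α} {g : FreeGroup α} : flip x g = g ↔ g ∈ others x := by
  constructor
  · intro h
    rw [← mk_toWord (x := g)]
    apply mk_mem_others
    have h' : g.toWord.map (flipLetter x) = g.toWord.map id := by
      rw [← toWord_flip, h, List.map_id]
    rintro ⟨a, b⟩ hl rfl
    have := List.map_inj_left.1 h' _ hl
    simp [flipLetter] at this
  · intro h
    have : others x ≤ (flip x).eqLocus (MonoidHom.id _) := by
      rw [others, Subgroup.closure_le]
      rintro _ ⟨a, ha, rfl⟩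
      exact flip_of_ne ha
    exact this h

theorem head?_toWord_of_flip_eq_conj {x : α} {k : FreeGroup α}
    (hk : flip x k = of x * k * (of x)⁻¹) (h1 : k ≠ 1) :
    k.toWord.head? = some (x, false) := by
  by_contra hne
  have hred : IsReduced ((x, true) :: k.toWord) := by
    refine List.isChain_cons.2 ⟨?_, isReduced_toWord⟩
    rintro ⟨a, b⟩ hy rfl
    cases b
    · exact absurd hy hne
    · rfl
  have heq : mk (k.toWord.map (flipLetter x) ++ [(x, true)]) = mk ((x, true) :: k.toWord) := by
    rw [← mul_mk, ← flip_mk, mk_cons (x, true) k.toWord, mk_toWord, hk]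
    exact inv_mul_cancel_right (of x * k) (of x)
  have hr := reduce.sound heq
  rw [hred.reduce_eq] at hr
  have hs : (x, true) :: k.toWord = k.toWord.map (flipLetter x) ++ [(x, true)] := by
    refine List.Sublist.eq_of_length ?_ (by simp)
    rw [← hr]
    exact reduce.red.sublist
  rcases hL : k.toWord with _ | ⟨⟨a, b⟩, L⟩
  · exact h1 (toWord_eq_nil_iff.1 hL)
  · rw [hL] at hs hne
    simp only [List.map_cons, List.cons_append, List.cons.injEq] at hs
    have h2 := hs.1
    unfold flipLetter at h2
    grind

theorem eq_one_of_flip_eq_conj {x : α} {k : FreeGroup α}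
    (hk : flip x k = of x * k * (of x)⁻¹) : k = 1 := by
  induction hn : k.norm using Nat.strong_induction_on generalizing k with
  | _ n ih =>
  by_contra h1
  have hh := head?_toWord_of_flip_eq_conj hk h1
  have hh' := head?_toWord_of_flip_eq_conj (x := x) (k := k⁻¹) (by rw [_root_.map_inv, hk]; group)
    (inv_ne_one.2 h1)
  rw [toWord_inv] at hh'
  obtain ⟨M, hM⟩ : ∃ M, k.toWord = (x, false) :: (M ++ [(x, true)]) := by
    rcases hL : k.toWord with _ | ⟨a, L⟩
    · simp [hL] at hh
    · rcases List.eq_nil_or_concat L with rfl | ⟨M, b, rfl⟩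
      · rw [hL] at hh hh'
        simp at hh
        simp [invRev, hh] at hh'
      · rw [hL] at hh hh'
        obtain ⟨c, d⟩ := b
        simp at hh
        simp [invRev] at hh'
        exact ⟨M, by simp [hh, hh']⟩
  have hkM : k = (of x)⁻¹ * mk M * of x := by
    rw [← mk_toWord (x := k), hM, mk_cons, ← mul_mk, ← mul_assoc]
    rfl
  have hm : mk M = of x * flip x (mk M) * (of x)⁻¹ := by
    have h3 := hk
    rw [hkM, _root_.map_mul, _root_.map_mul, _root_.map_inv, flip_of_self] at h3
    simpa [mul_assoc] using h3.symm
  have h4 : flip x (mk M) = 1 := by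
    refine ih (flip x (mk M)).norm ?_ (by rw [flip_flip]; exact hm) rfl
    rw [flip_mk, ← hn]
    refine norm_mk_le.trans_lt ?_
    simp [norm, hM]
  rw [h4] at hm
  rw [hkM, hm] at h1
  simp at h1

theorem eq_of_cons_append_eq_invRev {x : α} {a b : α × Bool} {L : List (α × Bool)}
    (h : (a :: (L ++ [b])).map (flipLetter x) = invRev (a :: (L ++ [b]))) :
    flipLetter x a = (b.1, !b.2) ∧ L.map (flipLetter x) = invRev L := by
  simp only [List.map_cons, List.map_append, invRev, List.reverse_cons, List.reverse_append,
    List.map_nil, List.reverse_nil, List.nil_append, List.cons_append, List.cons.injEq] at h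
  refine ⟨h.1, ?_⟩
  simpa [invRev] using (List.append_inj' h.2 rfl).1

theorem mk_eq_mul_flip_inv {x : α} {L : List (α × Bool)}
    (h : L.map (flipLetter x) = invRev L) :
    ∃ q, mk L = q * (flip x q)⁻¹ ∨ ∃ f, mk L = q * mk [(x, f)] * (flip x q)⁻¹ := by
  induction L using List.bidirectionalRec with
  | nil => exact ⟨1, Or.inl (by simp [← one_eq_mk])⟩
  | singleton a =>
    refine ⟨1, Or.inr ⟨a.2, ?_⟩⟩
    obtain ⟨a, b⟩ := a
    simp [invRev, flipLetter] at h
    by_cases hax : a = x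
    · simp [hax]
    · simp [hax] at h
  | cons_append a L b ih =>
    obtain ⟨hab, hL⟩ := eq_of_cons_append_eq_invRev h
    obtain ⟨q, hq⟩ := ih hL
    have hb : mk [b] = (flip x (mk [a]))⁻¹ := by
      rw [flip_mk, List.map_singleton, hab, inv_mk]
      simp [invRev]
    refine ⟨mk [a] * q, ?_⟩
    rw [mk_cons, ← mul_mk, hb, _root_.map_mul]
    rcases hq with hq | ⟨f, hq⟩
    · left; rw [hq]; group
    · right; refine ⟨f, ?_⟩; rw [hq]; group

theorem map_toWord_eq_invRev {x : α} {g : FreeGroup α} (h : flip x g = g⁻¹) :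
    g.toWord.map (flipLetter x) = invRev g.toWord := by
  rw [← toWord_flip, h, toWord_inv]

theorem exists_mk_eq_conj {x : α} {L : List (α × Bool)} (hr : IsReduced L) (hne : L ≠ [])
    (h : L.map (flipLetter x) = invRev L) :
    ∃ a ∈ others x, ∃ f, ∃ L₀, IsReduced L₀ ∧ L₀.head? = some (x, f) ∧
      L₀.getLast? = some (x, f) ∧ mk L = a * mk L₀ * a⁻¹ := by
  induction L using List.bidirectionalRec with
  | nil => exact absurd rfl hne
  | singleton a =>
    obtain ⟨a, b⟩ := a
    have hax : a = x := by
      by_contra hax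
      simp [invRev, flipLetter, hax] at h
    subst hax
    exact ⟨1, one_mem _, b, [(a, b)], hr, rfl, rfl, by simp⟩
  | cons_append a L b ih =>
    obtain ⟨hab, hL⟩ := eq_of_cons_append_eq_invRev h
    obtain ⟨c, d⟩ := b
    obtain ⟨a, e⟩ := a
    by_cases hax : a = x
    · subst hax
      simp [flipLetter] at hab
      obtain ⟨rfl, rfl⟩ := hab
      refine ⟨1, one_mem _, e, _, hr, rfl, ?_, by simp⟩
      rw [← List.cons_append, List.getLast?_append]
      rfl
    · simp [flipLetter, hax] at hab
      obtain ⟨rfl, rfl⟩ := hab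
      have hLr : IsReduced L := hr.infix ⟨[_], [_], rfl⟩
      have hLne : L ≠ [] := by
        rintro rfl
        simp [IsReduced] at hr
      obtain ⟨r, hrm, f, L₀, h1, h2, h3, h4⟩ := ih hLr hLne hL
      refine ⟨mk [(a, !d)] * r, mul_mem (mk_mem_others ?_) hrm, f, L₀, h1, h2, h3, ?_⟩
      · simpa using hax
      · have hb : mk [(a, d)] = (mk [(a, !d)])⁻¹ := by simp [inv_mk, invRev]
        rw [mk_cons, ← mul_mk, h4, hb]
        group

/-- The letter-to-word substitution replacing `(x, f)` by the word `W`. -/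
def substLetter (x : α) (f : Bool) (W : List (α × Bool)) (l : α × Bool) : List (α × Bool) :=
  if l.1 = x then (if l.2 = f then W else invRev W) else [l]

theorem IsReduced.invRev {L : List (α × Bool)} (h : IsReduced L) : IsReduced (invRev L) := by
  apply IsReduced.of_reduce_eq
  rw [reduce_invRev, h.reduce_eq]

section substLetter

variable {x : α} {f : Bool} {W : List (α × Bool)}

theorem head?_substLetter (hW : W.getLast? = some (x, f)) (hW' : W.head? = some (x, f))
    (l : α × Bool) : (substLetter x f W l).head? = some l := by
  obtain ⟨a, b⟩ := l
  unfold substLetter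
  split_ifs with h1 h2
  · simp_all
  · simp_all [head?_invRev]; cases b <;> cases f <;> simp_all
  · rfl

theorem getLast?_substLetter (hW : W.getLast? = some (x, f)) (hW' : W.head? = some (x, f))
    (l : α × Bool) : (substLetter x f W l).getLast? = some l := by
  obtain ⟨a, b⟩ := l
  unfold substLetter
  split_ifs with h1 h2
  · simp_all
  · simp_all [getLast?_invRev]; cases b <;> cases f <;> simp_all
  · rfl

theorem isReduced_flatMap_substLetter (hr : IsReduced W) (hW : W.getLast? = some (x, f))
    (hW' : W.head? = some (x, f)) {L : List (α × Bool)} (hL : IsReduced L) :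
    IsReduced (L.flatMap (substLetter x f W)) := by
  unfold IsReduced List.flatMap
  rw [List.isChain_flatten]
  · constructor
    · intro w hw
      obtain ⟨l, -, rfl⟩ := List.mem_map.1 hw
      unfold substLetter
      split_ifs
      · exact hr
      · exact hr.invRev
      · exact List.isChain_singleton _
    · refine List.isChain_map_of_isChain _ ?_ hL
      intro a b hab
      simpa [head?_substLetter hW hW', getLast?_substLetter hW hW'] using hab
  · intro hm
    obtain ⟨l, -, hl⟩ := List.mem_map.1 hm
    have := head?_substLetter hW hW' l
    simp [hl] at this

theorem lift_mk_eq_mk_flatMap_substLetter (L : List (α × Bool)) :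
    lift (fun a => mk (substLetter x f W (a, true))) (mk L) =
      mk (L.flatMap (substLetter x f W)) := by
  induction L with
  | nil => exact _root_.map_one _
  | cons l L ih =>
    rw [mk_cons, _root_.map_mul, ih, List.flatMap_cons, ← mul_mk]
    congr 1
    obtain ⟨a, b⟩ := l
    by_cases h : a = x <;> cases b <;> cases f <;> simp [substLetter, h, inv_mk, invRev_invRev]
    all_goals simp [invRev]

theorem eq_singleton_of_closure_eq_top (hr : IsReduced W) (hW : W.getLast? = some (x, f))
    (hW' : W.head? = some (x, f))
    (hc : of x ∈ Subgroup.closure (insert (mk W) (others x : Set (FreeGroup α)))) :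
    W = [(x, f)] := by
  set τ : FreeGroup α →* FreeGroup α := lift fun a => mk (substLetter x f W (a, true)) with hτ
  have hle : Subgroup.closure (insert (mk W) (others x : Set (FreeGroup α))) ≤ τ.range := by
    rw [Subgroup.closure_le, Set.insert_subset_iff]
    constructor
    · refine ⟨mk [(x, f)], ?_⟩
      rw [hτ, lift_mk_eq_mk_flatMap_substLetter]
      simp [substLetter]
    · change others x ≤ τ.range
      rw [others, Subgroup.closure_le]
      rintro _ ⟨a, ha, rfl⟩
      refine ⟨of a, ?_⟩
      have ha' : a ≠ x := ha
      rw [hτ, lift_apply_of]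
      simp [substLetter, ha', of]
  obtain ⟨g, hg⟩ := hle hc
  rw [← mk_toWord (x := g), hτ, lift_mk_eq_mk_flatMap_substLetter] at hg
  have h := congrArg toWord hg
  rw [toWord_mk, (isReduced_flatMap_substLetter hr hW hW' isReduced_toWord).reduce_eq,
    toWord_of] at h
  rcases hL : g.toWord with _ | ⟨l, M⟩
  · simp [hL] at h
  · rw [hL, List.flatMap_cons] at h
    have hl : substLetter x f W l = [(x, true)] := by
      have hne := head?_substLetter hW hW' l
      rcases hs : substLetter x f W l with _ | ⟨c, N⟩
      · simp [hs] at hne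
      · rw [hs] at h
        simp at h
        simp [h]
    have hlen : W.length = 1 := by
      unfold substLetter at hl
      split_ifs at hl with h1 h2
      · simp [hl]
      · rw [← invRev_length, hl]; rfl
      · simp at hl
        simp [hl] at h1
    obtain ⟨c, rfl⟩ := List.length_eq_one_iff.1 hlen
    simpa using hW'

end substLetter

theorem map_flip_of_forall_mul_self {x : α} {A : Type*} [CommGroup A] (hA : ∀ a : A, a * a = 1)
    (χ : FreeGroup α →* A) (g : FreeGroup α) : χ (flip x g) = χ g := by
  have : χ.comp (flip x) = χ := by
    ext a
    by_cases h : a = x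
    · simpa [flip, h] using inv_eq_of_mul_eq_one_left (hA _)
    · simp [flip, h]
  exact DFunLike.congr_fun this g

/-- An automorphism commuting with the quasi-conjugation `g ↦ x * flip x g * x⁻¹` maps `others x`
to a conjugate `v * others x * v⁻¹`, for some `v` with `v⁻¹ * x * flip x v` equal to `x` or `x⁻¹`. -/
theorem exists_conj_of_commute {x : α} (σ : MulAut (FreeGroup α))
    (hσ : ∀ g, σ (of x * flip x g * (of x)⁻¹) = of x * flip x (σ g) * (of x)⁻¹) :
    ∃ v f, σ (of x) = of x * flip x v * v⁻¹ ∧ v⁻¹ * of x * flip x v = mk [(x, f)] ∧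
      ∀ g, g ∈ others x ↔ v⁻¹ * σ g * v ∈ others x := by
  have hw : flip x ((of x)⁻¹ * σ (of x)) = ((of x)⁻¹ * σ (of x))⁻¹ := by
    have h := hσ (of x)
    rw [flip_of_self, mul_inv_cancel, one_mul, _root_.map_inv] at h
    rw [_root_.map_mul, _root_.map_inv, flip_of_self, mul_inv_rev, h]
    group
  obtain ⟨q, hq⟩ := mk_eq_mul_flip_inv (map_toWord_eq_invRev hw)
  rw [mk_toWord] at hq
  replace hq : (of x)⁻¹ * σ (of x) = q * (flip x q)⁻¹ := by
    refine hq.resolve_right ?_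
    rintro ⟨f, hf⟩
    let ε : FreeGroup α →* Multiplicative (ZMod 2) := lift fun _ => Multiplicative.ofAdd 1
    let χ : FreeGroup α →* Multiplicative (ZMod 2) := ε.comp σ⁻¹.toMonoidHom
    have hA : ∀ a : Multiplicative (ZMod 2), a * a = 1 := by decide
    have h1 : χ (σ (of x)) = Multiplicative.ofAdd 1 := by
      change ε (σ⁻¹ (σ (of x))) = _
      simp [ε]
    have h2 : χ (mk [(x, f)]) = χ (of x) := by
      cases f
      · change χ (of x)⁻¹ = _
        rw [_root_.map_inv]
        exact inv_eq_of_mul_eq_one_left (hA _)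
      · rfl
    have h3 := congrArg χ hf
    rw [_root_.map_mul, _root_.map_mul, _root_.map_mul, _root_.map_inv, _root_.map_inv,
      map_flip_of_forall_mul_self hA, h1, h2] at h3
    generalize χ (of x) = s at h3
    generalize χ q = t at h3
    revert s t
    decide
  set v := flip x q with hv
  have hqv : flip x v = q := flip_flip x q
  have hwv : σ (of x) = of x * flip x v * v⁻¹ := by
    rw [hqv, mul_assoc, ← hq]; group
  have hmem : ∀ g, g ∈ others x ↔ v⁻¹ * σ g * v ∈ others x := by
    intro g
    have h : v⁻¹ * σ (flip x g) * v = (flip x v)⁻¹ * flip x (σ g) * flip x v := by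
      have h' := hσ g
      rw [_root_.map_mul, _root_.map_mul, _root_.map_inv, hwv] at h'
      calc _ = (of x * flip x v)⁻¹ * (of x * flip x v * v⁻¹ * σ (flip x g) *
            (of x * flip x v * v⁻¹)⁻¹) * (of x * flip x v) := by group
        _ = _ := by rw [h']; group
    rw [← flip_eq_self_iff, ← flip_eq_self_iff, _root_.map_mul, _root_.map_mul, _root_.map_inv, ← h,
      mul_left_inj, mul_right_inj, σ.injective.eq_iff]
  have hgen : ∀ g, v⁻¹ * σ g * v ∈
      Subgroup.closure (insert (v⁻¹ * of x * flip x v) (others x : Set (FreeGroup α))) := by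
    intro g
    induction g using FreeGroup.induction_on with
    | C1 => simp
    | of a =>
      apply Subgroup.subset_closure
      by_cases ha : a = x
      · left
        rw [ha, hwv]; group
      · right
        exact (hmem _).1 (Subgroup.subset_closure ⟨a, ha, rfl⟩)
    | inv_of a ih =>
      have := inv_mem ih
      rw [_root_.map_inv]
      convert this using 1
      group
    | mul g h ihg ihh =>
      have := mul_mem ihg ihh
      rw [_root_.map_mul]
      convert this using 1
      group
  have hp : flip x (v⁻¹ * of x * flip x v) = (v⁻¹ * of x * flip x v)⁻¹ := by
    rw [_root_.map_mul, _root_.map_mul, flip_flip, _root_.map_inv, flip_of_self]; group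
  have hp1 : v⁻¹ * of x * flip x v ≠ 1 := by
    intro h
    refine of_ne_one x (σ.injective ?_)
    rw [_root_.map_one, hwv]
    calc _ = v * (v⁻¹ * of x * flip x v) * v⁻¹ := by group
      _ = 1 := by rw [h]; group
  obtain ⟨a, ha, f, W, hr, hh, hl, hW⟩ := exists_mk_eq_conj isReduced_toWord
    (mt toWord_eq_nil_iff.1 hp1) (map_toWord_eq_invRev hp)
  rw [mk_toWord] at hW
  have hW1 : W = [(x, f)] := by
    refine eq_singleton_of_closure_eq_top hr hl hh ?_
    have hle : Subgroup.closure (insert (v⁻¹ * of x * flip x v) (others x : Set (FreeGroup α))) ≤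
        Subgroup.closure (insert (mk W) (others x : Set (FreeGroup α))) := by
      have hsub : ∀ g ∈ others x,
          g ∈ Subgroup.closure (insert (mk W) (others x : Set (FreeGroup α))) :=
        fun g hg => Subgroup.subset_closure (Or.inr hg)
      rw [Subgroup.closure_le, Set.insert_subset_iff]
      refine ⟨?_, hsub⟩
      rw [hW]
      exact mul_mem (mul_mem (hsub a ha) (Subgroup.subset_closure (Or.inl rfl)))
        (inv_mem (hsub a ha))
    apply hle
    have := hgen (σ⁻¹ (v * of x * v⁻¹))
    rw [MulAut.apply_inv_self] at this
    convert this using 1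
    group
  rw [hW1] at hW
  have hfa : flip x a = a := flip_eq_self_iff.2 ha
  refine ⟨v * a, f, ?_, ?_, fun g => (hmem g).trans ?_⟩
  · rw [hwv, _root_.map_mul, hfa]; group
  · rw [_root_.map_mul, hfa]
    calc _ = a⁻¹ * (v⁻¹ * of x * flip x v) * a := by group
      _ = _ := by rw [hW]; group
  · have h : (v * a)⁻¹ * σ g * (v * a) = a⁻¹ * (v⁻¹ * σ g * v) * a := by group
    rw [h, Subgroup.mul_mem_cancel_right _ ha, Subgroup.mul_mem_cancel_left _ (inv_mem ha)]

theorem others_dichotomy_of_commute {x : α} (σ : MulAut (FreeGroup α))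
    (hσ : ∀ g, σ (of x * flip x g * (of x)⁻¹) = of x * flip x (σ g) * (of x)⁻¹) :
    (σ (of x) = of x ∧ ∀ g, g ∈ others x ↔ σ g ∈ others x) ∨
    (σ (of x) = (of x)⁻¹ ∧ ∀ g, g ∈ others x ↔ (of x)⁻¹ * σ g * of x ∈ others x) := by
  obtain ⟨v, f, hw, hv, hmem⟩ := exists_conj_of_commute σ hσ
  cases f
  · right
    replace hv : v⁻¹ * of x * flip x v = (of x)⁻¹ := hv
    have hfv : flip x v = (of x)⁻¹ * v * (of x)⁻¹ := by
      calc _ = (of x)⁻¹ * v * (v⁻¹ * of x * flip x v) := by group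
        _ = _ := by rw [hv]
    have h1 : (of x)⁻¹ * v = 1 := by
      refine eq_one_of_flip_eq_conj (x := x) ?_
      rw [_root_.map_mul, _root_.map_inv, flip_of_self, hfv]
      group
    have hvx : v = of x := (inv_mul_eq_one.1 h1).symm
    subst hvx
    refine ⟨?_, hmem⟩
    rw [hw, flip_of_self]; group
  · left
    replace hv : v⁻¹ * of x * flip x v = of x := hv
    have hfv : flip x v = (of x)⁻¹ * v * of x := by
      calc _ = (of x)⁻¹ * v * (v⁻¹ * of x * flip x v) := by group
        _ = _ := by rw [hv]
    have h1 : flip x v = 1 := by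
      refine eq_one_of_flip_eq_conj (x := x) ?_
      rw [flip_flip, hfv]
      group
    have hv1 : v = 1 := by
      have h2 := congrArg (flip x) h1
      rwa [flip_flip, _root_.map_one] at h2
    subst hv1
    refine ⟨by simpa using hw, by simpa using hmem⟩

end FreeGroup

/-- Description of the centralizer of a quasi-conjugation `φ` attached to a
basis `{x} ∪ Y`: every `σ` commuting with `φ` either fixes `x` and restricts to
an automorphism of `⟨Y⟩`, or inverts `x` and acts on `⟨Y⟩` as `x ∘ θ ∘ x⁻¹`
for an automorphism `θ` of `⟨Y⟩`. -/
theorem centralizer_of_quasi_conjugation (α : Type*) (x : α) (Y : Set α)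
    (hx : x ∉ Y) (hY : Y.Nonempty) (hcover : ∀ a : α, a = x ∨ a ∈ Y)
    (φ : MulAut (FreeGroup α))
    (hφx : φ (FreeGroup.of x) = (FreeGroup.of x)⁻¹)
    (hφy : ∀ y ∈ Y, φ (FreeGroup.of y)
      = FreeGroup.of x * FreeGroup.of y * (FreeGroup.of x)⁻¹)
    (σ : MulAut (FreeGroup α)) (hσ : σ * φ = φ * σ) :
    (σ (FreeGroup.of x) = FreeGroup.of x ∧
      Set.BijOn σ (Subgroup.closure (FreeGroup.of '' Y) : Set (FreeGroup α))
        (Subgroup.closure (FreeGroup.of '' Y) : Set (FreeGroup α))) ∨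
    (σ (FreeGroup.of x) = (FreeGroup.of x)⁻¹ ∧
      (∀ y ∈ Y, σ (FreeGroup.of y) ∈
        (fun c => FreeGroup.of x * c * (FreeGroup.of x)⁻¹) ''
          (Subgroup.closure (FreeGroup.of '' Y) : Set (FreeGroup α))) ∧
      Set.BijOn (fun c => (FreeGroup.of x)⁻¹ * σ c * FreeGroup.of x)
        (Subgroup.closure (FreeGroup.of '' Y) : Set (FreeGroup α))
        (Subgroup.closure (FreeGroup.of '' Y) : Set (FreeGroup α))) := by
  classical
  obtain rfl : Y = {x}ᶜ := by
    ext a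
    refine ⟨?_, fun ha => (hcover a).resolve_left ha⟩
    rintro ha rfl
    exact hx ha
  have hφ : ∀ g, φ g = FreeGroup.of x * FreeGroup.flip x g * (FreeGroup.of x)⁻¹ := by
    have : φ.toMonoidHom = (MulAut.conj (FreeGroup.of x)).toMonoidHom.comp (FreeGroup.flip x) := by
      ext a
      by_cases ha : a = x
      · subst ha
        simp [hφx, FreeGroup.flip_of_self]
      · simp [hφy a ha, FreeGroup.flip_of_ne ha]
    exact fun g => DFunLike.congr_fun this g
  have hσ' : ∀ g, σ (φ g) = φ (σ g) := fun g => DFunLike.congr_fun hσ g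
  simp only [hφ] at hσ'
  change (_ ∧ Set.BijOn σ (FreeGroup.others x : Set (FreeGroup α)) (FreeGroup.others x : Set (FreeGroup α))) ∨
    (_ ∧ (∀ y ∈ _, _ ∈ _ '' (FreeGroup.others x : Set (FreeGroup α))) ∧
      Set.BijOn _ (FreeGroup.others x : Set (FreeGroup α)) (FreeGroup.others x : Set (FreeGroup α)))
  refine (FreeGroup.others_dichotomy_of_commute σ hσ').imp ?_ ?_
  · rintro ⟨h1, h2⟩
    refine ⟨h1, fun g hg => (h2 g).1 hg, σ.injective.injOn, fun g hg => ?_⟩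
    exact ⟨σ⁻¹ g, (h2 _).2 (by simpa using hg), by simp⟩
  · rintro ⟨h1, h2⟩
    refine ⟨h1, fun y hy => ?_, fun g hg => (h2 g).1 hg, fun g _ h _ hgh => ?_, fun g hg => ?_⟩
    · exact ⟨_, (h2 _).1 (Subgroup.subset_closure ⟨y, hy, rfl⟩), by group⟩
    · exact σ.injective (mul_left_cancel (mul_right_cancel hgh))
    · refine ⟨σ⁻¹ (FreeGroup.of x * g * (FreeGroup.of x)⁻¹), (h2 _).2 ?_, ?_⟩
      · simpa [mul_assoc] using hg
      · simp [mul_assoc]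
end
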